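/- If K is a closed curve in ℝ³ of finite total curvature containing a knotted (nontrivially knotted) inscribed polygon, then its second hull h₂(K) is nonempty: there exists a point p such that every plane through p cuts K at least four times. -/

import Mathlib

open Set
open scoped Classical ENNReal

noncomputable section

variable {E : Type*} [NormedAddCommGroup E] [NormedSpace ℝ E]

/-- The connected components of the periodic level set `Z ⊆ ℝ`, with one
canonical representative chosen per period. -/
def circComps (Z : Set ℝ) : Set (Set ℝ) :=
  {S | ∃ t ∈ Z, S = connectedComponentIn Z t ∧ sInf S ∈ Ico (0 : ℝ) 1}

/-- The arc of the curve just after the component `S` lies above the level `c`. -/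
def AboveAfter (g : ℝ → ℝ) (c : ℝ) (S : Set ℝ) : Prop :=
  ∃ ε > 0, ∀ s ∈ Ioo (sSup S) (sSup S + ε), c < g s

/-- The arc of the curve just before the component `S` lies above the level `c`. -/
def AboveBefore (g : ℝ → ℝ) (c : ℝ) (S : Set ℝ) : Prop :=
  ∃ ε > 0, ∀ s ∈ Ioo (sInf S - ε) (sInf S), c < g s

/-- A glancing intersection: the arcs just before and just after the component `S`
lie on the same side of the level `c`; such components are counted twice. -/
def IsGlancing (g : ℝ → ℝ) (c : ℝ) (S : Set ℝ) : Prop :=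
  AboveBefore g c S ↔ AboveAfter g c S

/-- Number of intersections of the closed curve `K` (a `1`-periodic map `ℝ → E`)
with the hyperplane `{x | f x = c}`: components of the preimage are counted once,
glancing components twice, and a curve contained in the hyperplane counts as two
intersections. (Infinitely many components give an infinite count.) -/
def cutCount (K : ℝ → E) (f : E →L[ℝ] ℝ) (c : ℝ) : Cardinal :=
  if {t : ℝ | f (K t) = c} = univ then 2
  else Cardinal.mk (circComps {t : ℝ | f (K t) = c})
    + Cardinal.mk ({S ∈ circComps {t : ℝ | f (K t) = c} | IsGlancing (fun t => f (K t)) c S})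

/-- `K` cuts the hyperplane `{x | f x = c}` at least `m` times. -/
def CutsAtLeast (K : ℝ → E) (f : E →L[ℝ] ℝ) (c : ℝ) (m : ℕ) : Prop :=
  (m : Cardinal) ≤ cutCount K f c

/-- The `n`-th hull of the closed curve `K`: points `p` such that every hyperplane
through `p` is cut at least `2n` times by `K`. -/
def hull (K : ℝ → E) (n : ℕ) : Set E :=
  {p | ∀ f : E →L[ℝ] ℝ, f ≠ 0 → CutsAtLeast K f (f p) (2 * n)}

/-- The standard round circle in `ℝ³`. -/
def roundCircle : Set (EuclideanSpace ℝ (Fin 3)) :=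
  {x | x 0 ^ 2 + x 1 ^ 2 = 1 ∧ x 2 = 0}

/-- Two subsets of `ℝ³` are ambient isotopic: there is a continuous family of
homeomorphisms of `ℝ³`, starting at the identity, carrying one to the other. -/
def AmbientIsotopic (A B : Set (EuclideanSpace ℝ (Fin 3))) : Prop :=
  ∃ H : ℝ → EuclideanSpace ℝ (Fin 3) → EuclideanSpace ℝ (Fin 3),
    Continuous (fun q : ℝ × EuclideanSpace ℝ (Fin 3) => H q.1 q.2) ∧
    (∀ t, IsHomeomorph (H t)) ∧ (∀ x, H 0 x = x) ∧ H 1 '' A = B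

/-- A subset of `ℝ³` is an unknot if it is ambient isotopic to the round circle. -/
def IsUnknot (K : Set (EuclideanSpace ℝ (Fin 3))) : Prop :=
  AmbientIsotopic K roundCircle

/-- The closed polygonal loop (as a `1`-periodic map `ℝ → E`) through the
cyclically ordered vertices `v 0, …, v m`. -/
def polyLoop {m : ℕ} (v : Fin (m + 1) → E) : ℝ → E := fun s =>
  let u : ℝ := Int.fract s * (m + 1)
  let i : Fin (m + 1) := ⟨⌊u⌋.toNat % (m + 1), Nat.mod_lt _ (Nat.succ_pos m)⟩
  v i + (u - (i : ℕ)) • (v (i + 1) - v i)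

/-- The total curvature (in the sense of Milnor) of a closed curve `K`:
the supremum over inscribed polygons of the sum of their exterior angles. -/
def totalCurvature (K : ℝ → EuclideanSpace ℝ (Fin 3)) : ℝ≥0∞ :=
  ⨆ (n : ℕ) (t : Fin (n + 3) → ℝ) (_ : StrictMono t)
    (_ : ∀ i, t i ∈ Ico (0 : ℝ) 1) (_ : ∀ i, K (t (i + 1)) ≠ K (t i)),
    ∑ i : Fin (n + 3),
      ENNReal.ofReal
        (InnerProductGeometry.angle
          (K (t (i + 1)) - K (t i)) (K (t (i + 2)) - K (t (i + 1))))

/-- Three-dimensional Euclidean space. -/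
abbrev V3 := EuclideanSpace ℝ (Fin 3)

/-- Isotopy supported in `W` carrying `X` to `Y`. -/
def Iso (W X Y : Set V3) : Prop :=
  ∃ F : (ℝ × V3) ≃ₜ (ℝ × V3), (∀ q, (F q).1 = q.1) ∧ (∀ x, F (0, x) = (0, x)) ∧
    (∀ t x, x ∉ W → F (t, x) = (t, x)) ∧ (fun x => (F (1, x)).2) '' X = Y

theorem Iso.refl (W X : Set V3) : Iso W X X :=
  ⟨Homeomorph.refl _, by simp, by simp, by simp, by simp⟩

theorem Iso.of_eq {W X Y : Set V3} (h : X = Y) : Iso W X Y := h ▸ Iso.refl W X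

theorem Iso.mono {W W' X Y : Set V3} (h : Iso W X Y) (hW : W ⊆ W') : Iso W' X Y := by
  obtain ⟨F, h1, h2, h3, h4⟩ := h
  exact ⟨F, h1, h2, fun t x hx => h3 t x (fun h => hx (hW h)), h4⟩

theorem Iso.eq_pair {F : (ℝ × V3) ≃ₜ (ℝ × V3)} (h1 : ∀ q, (F q).1 = q.1) (t : ℝ) (x : V3) :
    F (t, x) = (t, (F (t, x)).2) := Prod.ext (h1 _) rfl

theorem Iso.symm {W X Y : Set V3} (h : Iso W X Y) : Iso W Y X := by
  obtain ⟨F, h1, h2, h3, h4⟩ := h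
  refine ⟨F.symm, ?_, ?_, ?_, ?_⟩
  · intro q
    have := h1 (F.symm q)
    simpa using this.symm
  · intro x
    rw [Homeomorph.symm_apply_eq, h2]
  · intro t x hx
    rw [Homeomorph.symm_apply_eq, h3 t x hx]
  · rw [← h4, image_image]
    have : ∀ x, (F.symm (1, (F (1, x)).2)).2 = x := by
      intro x
      rw [← Iso.eq_pair h1]; simp
    simp [this]

theorem Iso.trans {W X Y Z : Set V3} (h : Iso W X Y) (h' : Iso W Y Z) : Iso W X Z := by
  obtain ⟨F, h1, h2, h3, h4⟩ := h
  obtain ⟨G, k1, k2, k3, k4⟩ := h'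
  refine ⟨F.trans G, ?_, ?_, ?_, ?_⟩
  · intro q; simp [k1, h1]
  · intro x; simp [h2, k2]
  · intro t x hx; simp [h3 t x hx, k3 t x hx]
  · rw [← k4, ← h4, image_image]
    refine image_congr fun x _ => ?_
    simp only [Homeomorph.trans_apply]
    rw [Iso.eq_pair h1 1 x]

theorem Iso.union {W X Y R : Set V3} (h : Iso W X Y) (hR : Disjoint R W) :
    Iso W (X ∪ R) (Y ∪ R) := by
  obtain ⟨F, h1, h2, h3, h4⟩ := h
  refine ⟨F, h1, h2, h3, ?_⟩
  rw [image_union, h4]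
  congr 1
  have : ∀ x ∈ R, (F (1, x)).2 = x := fun x hx => by
    rw [h3 1 x (disjoint_left.1 hR hx)]
  rw [image_congr this]; simp

theorem Iso.ambient {W X Y : Set V3} (h : Iso W X Y) (hY : IsUnknot Y) : IsUnknot X := by
  obtain ⟨F, h1, h2, h3, h4⟩ := h
  obtain ⟨H, k1, k2, k3, k4⟩ := hY
  have hF : ∀ t, IsHomeomorph (fun x => (F (t, x)).2) := by
    intro t
    have h1' : ∀ q, (F.symm q).1 = q.1 := fun q => by
      have := h1 (F.symm q); simpa using this.symm
    let G : V3 ≃ₜ V3 :=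
      { toFun := fun x => (F (t, x)).2
        invFun := fun x => (F.symm (t, x)).2
        left_inv := fun x => by
          show (F.symm (t, (F (t, x)).2)).2 = x
          rw [← Iso.eq_pair h1]; simp
        right_inv := fun x => by
          show (F (t, (F.symm (t, x)).2)).2 = x
          rw [← Iso.eq_pair (F := F.symm) h1']; simp
        continuous_toFun := by fun_prop
        continuous_invFun := by fun_prop }
    exact G.isHomeomorph
  refine ⟨fun t x => H t (F (t, x)).2, ?_, ?_, ?_, ?_⟩
  · have : Continuous (fun q : ℝ × V3 => (q.1, (F (q.1, q.2)).2)) :=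
      continuous_fst.prodMk (continuous_snd.comp F.continuous)
    exact k1.comp this
  · intro t
    exact (k2 t).comp (hF t)
  · intro x; simp [h2, k3]
  · rw [← k4, ← h4, image_image]

/-- Shear homeomorphism. -/
theorem Iso.shear (φ : V3 → ℝ) (hφ : Continuous φ) (d : V3) (h0 : ∀ x, 0 ≤ φ x)
    (h1 : ∀ x, φ x ≤ 1) (hs : ∀ x s, 0 < s → φ x - s < φ (x + s • d)) (X : Set V3) :
    Iso {x | 0 < φ x} X ((fun x => x + φ x • d) '' X) := by
  let cl : ℝ → ℝ := fun t => max 0 (min t 1)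
  have cl0 : ∀ t, 0 ≤ cl t := fun t => le_max_left _ _
  have cl1 : ∀ t, cl t ≤ 1 := fun t => max_le zero_le_one (min_le_right _ _)
  let F : ℝ × V3 → ℝ × V3 := fun q => (q.1, q.2 + (cl q.1 * φ q.2) • d)
  have hF : Continuous F := by
    have : Continuous cl := by fun_prop
    fun_prop
  have hinj : Function.Injective F := by
    rintro ⟨t, x⟩ ⟨t', x'⟩ h
    simp only [F, Prod.mk.injEq] at h
    obtain ⟨rfl, h⟩ := h
    have hx' : x' = x + (cl t * φ x - cl t * φ x') • d := by
      rw [sub_smul, ← add_sub_assoc, h]; abel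
    rcases lt_trichotomy (cl t * φ x - cl t * φ x') 0 with hn | hn | hn
    · have hx : x = x' + (-(cl t * φ x - cl t * φ x')) • d := by
        have h2 := hx'
        rw [neg_smul, ← sub_eq_add_neg, eq_sub_iff_add_eq]; exact h2.symm
      have := hs x' _ (neg_pos.2 hn)
      rw [← hx] at this
      have c0 := cl0 t; have c1 := cl1 t
      have : 0 < φ x' - φ x := by
        by_contra hh
        nlinarith
      nlinarith
    · rw [hn] at hx'; simp at hx'; rw [hx']
    · have := hs x _ hn
      rw [← hx'] at this
      have c0 := cl0 t; have c1 := cl1 t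
      have : 0 < φ x - φ x' := by
        by_contra hh
        nlinarith
      nlinarith
  have hsurj : Function.Surjective F := by
    rintro ⟨t, y⟩
    have hc : ContinuousOn (fun s : ℝ => s + cl t * φ (y + s • d)) (Icc (-1) 0) := by fun_prop
    have := intermediate_value_Icc (by norm_num : (-1 : ℝ) ≤ 0) hc
    have h0' : (0 : ℝ) ∈ Icc (-1 + cl t * φ (y + (-1 : ℝ) • d)) (0 + cl t * φ (y + (0 : ℝ) • d)) := by
      have a1 := cl0 t; have a2 := cl1 t
      have b1 := h0 (y + (-1 : ℝ) • d); have b2 := h1 (y + (-1 : ℝ) • d)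
      have b3 := h0 (y + (0 : ℝ) • d)
      constructor
      · nlinarith
      · nlinarith [mul_nonneg a1 b3]
    obtain ⟨s, -, hs⟩ := this h0'
    refine ⟨(t, y + s • d), ?_⟩
    simp only [F, Prod.mk.injEq, true_and]
    have : y + s • d + (cl t * φ (y + s • d)) • d = y + (s + cl t * φ (y + s • d)) • d := by
      module
    rw [this]; simp only at hs; rw [hs]; simp
  have hdist : ∀ q, ‖F q - q‖ ≤ ‖d‖ := by
    rintro ⟨t, x⟩
    have : F (t, x) - (t, x) = (0, (cl t * φ x) • d) := by simp [F]
    rw [this, Prod.norm_def]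
    simp only [norm_zero, norm_smul]
    have a1 := cl0 t; have a2 := cl1 t; have b1 := h0 x; have b2 := h1 x
    rw [Real.norm_of_nonneg (mul_nonneg a1 b1)]
    have : cl t * φ x ≤ 1 := by nlinarith
    apply max_le (norm_nonneg _)
    nlinarith [norm_nonneg d]
  have hproper : IsProperMap F := by
    rw [isProperMap_iff_tendsto_cocompact]
    refine ⟨hF, ?_⟩
    rw [← Metric.cobounded_eq_cocompact, ← tendsto_norm_atTop_iff_cobounded]
    have : Filter.Tendsto (fun q : ℝ × V3 => ‖q‖ - ‖d‖) (Bornology.cobounded _) Filter.atTop :=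
      Filter.tendsto_atTop_add_const_right _ _ tendsto_norm_cobounded_atTop
    refine Filter.tendsto_atTop_mono ?_ this
    intro q
    have := norm_sub_norm_le q (F q)
    rw [norm_sub_rev] at this
    linarith [hdist q]
  let e := Equiv.ofBijective F ⟨hinj, hsurj⟩
  let G : (ℝ × V3) ≃ₜ (ℝ × V3) :=
    e.toHomeomorphOfContinuousClosed hF hproper.isClosedMap
  have hG : ∀ q, G q = F q := fun q => rfl
  refine ⟨G, fun q => rfl, ?_, ?_, ?_⟩
  · intro x; rw [hG]; simp [F, cl]
  · intro t x hx
    have : φ x = 0 := le_antisymm (not_lt.1 hx) (h0 x)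
    rw [hG]; simp [F, this]
  · refine image_congr fun x _ => ?_
    rw [hG]; simp [F, cl]

/-- Closed triangle. -/
def tri (a b c : V3) : Set V3 :=
  {x | ∃ α β γ : ℝ, 0 ≤ α ∧ 0 ≤ β ∧ 0 ≤ γ ∧ α + β + γ = 1 ∧ x = α • a + β • b + γ • c}

theorem tri_convex (a b c : V3) : Convex ℝ (tri a b c) := by
  rintro x ⟨α, β, γ, ha, hb, hc, hs, rfl⟩ y ⟨α', β', γ', ha', hb', hc', hs', rfl⟩ s t hs0 ht0 hst
  refine ⟨s * α + t * α', s * β + t * β', s * γ + t * γ', by positivity, by positivity,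
    by positivity, ?_, by module⟩
  have : s * α + t * α' + (s * β + t * β') + (s * γ + t * γ') =
    s * (α + β + γ) + t * (α' + β' + γ') := by ring
  rw [this, hs, hs']; linarith

theorem left_mem_tri (a b c : V3) : a ∈ tri a b c := ⟨1, 0, 0, by simp⟩
theorem mid_mem_tri (a b c : V3) : b ∈ tri a b c := ⟨0, 1, 0, by simp⟩
theorem right_mem_tri (a b c : V3) : c ∈ tri a b c := ⟨0, 0, 1, by simp⟩

theorem tri_subset {S : Set V3} (hS : Convex ℝ S) {a b c : V3} (ha : a ∈ S) (hb : b ∈ S)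
    (hc : c ∈ S) : tri a b c ⊆ S := by
  rintro x ⟨α, β, γ, h1, h2, h3, hs, rfl⟩
  have := hS.sum_mem (t := Finset.univ) (w := ![α, β, γ]) (z := ![a, b, c])
    (by intro i _; fin_cases i <;> simpa) (by simp [Fin.sum_univ_three, hs])
    (by intro i _; fin_cases i <;> simpa)
  simpa [Fin.sum_univ_three] using this

theorem tri_eq_hull (a b c : V3) : tri a b c = convexHull ℝ {a, b, c} := by
  apply Subset.antisymm
  · exact tri_subset (convex_convexHull ℝ _) (subset_convexHull ℝ _ (by simp))
      (subset_convexHull ℝ _ (by simp)) (subset_convexHull ℝ _ (by simp))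
  · apply convexHull_min _ (tri_convex a b c)
    rintro x (rfl | rfl | rfl)
    · exact left_mem_tri _ _ _
    · exact mid_mem_tri _ _ _
    · exact right_mem_tri _ _ _

theorem tri_compact (a b c : V3) : IsCompact (tri a b c) := by
  rw [tri_eq_hull]
  exact (Set.toFinite _).isCompact_convexHull ℝ

theorem tri_rev (a b c : V3) : tri a b c = tri c b a := by
  rw [tri_eq_hull, tri_eq_hull]; congr 1; ext; simp; tauto

theorem segment_compact (a b : V3) : IsCompact (segment ℝ a b) := by
  rw [← convexHull_pair]
  exact (Set.toFinite _).isCompact_convexHull ℝ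

/-- Support region of the elementary move. -/
def nbd (m e d : V3) (X Y : V3 →L[ℝ] ℝ) (δ : ℝ) : Set V3 :=
  {x | |X (x - m)| + Y (x - m) / (1 + δ) < 1 ∧ |X (x - m)| - Y (x - m) / δ < 1 ∧
    |X (x - m)| + ‖x - m - X (x - m) • e - Y (x - m) • d‖ / δ < 1}

theorem nbd_neg (m e d : V3) (X Y : V3 →L[ℝ] ℝ) (δ : ℝ) :
    nbd m (-e) d (-X) Y δ = nbd m e d X Y δ := by
  simp only [nbd, neg_apply, abs_neg, neg_smul, smul_neg, neg_neg]

theorem nbd_mono {m e d : V3} {X Y : V3 →L[ℝ] ℝ} {δ δ' : ℝ} (h : 0 < δ) (h' : δ ≤ δ') :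
    nbd m e d X Y δ ⊆ nbd m e d X Y δ' := by
  rintro x ⟨h1, h2, h3⟩
  have hd' : 0 < δ' := by linarith
  have h4 : ‖x - m - X (x - m) • e - Y (x - m) • d‖ / δ' ≤
      ‖x - m - X (x - m) • e - Y (x - m) • d‖ / δ := by gcongr
  have h5 : 0 ≤ ‖x - m - X (x - m) • e - Y (x - m) • d‖ / δ := by positivity
  refine ⟨?_, ?_, by linarith⟩
  · rcases le_total 0 (Y (x - m)) with hy | hy
    · have : Y (x - m) / (1 + δ') ≤ Y (x - m) / (1 + δ) := by gcongr
      linarith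
    · have : Y (x - m) / (1 + δ') ≤ 0 := div_nonpos_of_nonpos_of_nonneg hy (by linarith)
      linarith
  · rcases le_total 0 (Y (x - m)) with hy | hy
    · have : 0 ≤ Y (x - m) / δ' := by positivity
      linarith
    · have : -Y (x - m) / δ' ≤ -Y (x - m) / δ := by
        have : 0 ≤ -Y (x - m) := by linarith
        gcongr
      rw [neg_div, neg_div] at this
      linarith

theorem nbd_decomp {m e d : V3} {X Y : V3 →L[ℝ] ℝ} {δ : ℝ} (hδ : 0 < δ) {x : V3}
    (hx : x ∈ nbd m e d X Y δ) : ∃ (μ : ℝ) (σ q q' : V3), 0 ≤ μ ∧ μ < 1 ∧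
      (σ = m - e ∨ σ = m + e) ∧ q' ∈ segment ℝ m (m + d) ∧ dist q q' ≤ δ * (‖d‖ + 1) ∧
      x = (1 - μ) • q + μ • σ := by
  obtain ⟨h1, h2, h3⟩ := hx
  set ξ := X (x - m)
  set η := Y (x - m)
  set r := x - m - ξ • e - η • d with hr
  have hr0 : 0 ≤ ‖r‖ / δ := by positivity
  have hμ : |ξ| < 1 := by linarith
  have hp : 0 < 1 - |ξ| := by linarith
  set ν := η / (1 - |ξ|) with hν
  have hν1 : ν < 1 + δ := by
    rw [hν, div_lt_iff₀ hp]
    have : η / (1 + δ) < 1 - |ξ| := by linarith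
    rw [div_lt_iff₀ (by linarith)] at this
    linarith
  have hν2 : -δ < ν := by
    rw [hν, lt_div_iff₀ hp]
    have : -η / δ < 1 - |ξ| := by rw [neg_div]; linarith
    rw [div_lt_iff₀ hδ] at this
    linarith
  have hrr : ‖r‖ / (1 - |ξ|) ≤ δ := by
    rw [div_le_iff₀ hp]
    have : ‖r‖ / δ < 1 - |ξ| := by linarith
    rw [div_lt_iff₀ hδ] at this
    linarith
  obtain ⟨κ, hκ0, hκ1, hκ⟩ : ∃ κ : ℝ, 0 ≤ κ ∧ κ ≤ 1 ∧ |ν - κ| ≤ δ := by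
    rcases le_total ν 0 with h | h
    · exact ⟨0, le_rfl, zero_le_one, by rw [abs_le]; constructor <;> linarith⟩
    · rcases le_total ν 1 with h' | h'
      · exact ⟨ν, h, h', by simp [hδ.le]⟩
      · exact ⟨1, zero_le_one, le_rfl, by rw [abs_le]; constructor <;> linarith⟩
  have hην : (1 - |ξ|) * ν = η := by rw [hν]; field_simp
  have hq : dist (m + ν • d + (1 - |ξ|)⁻¹ • r) (m + κ • d) ≤ δ * (‖d‖ + 1) := by
    rw [dist_eq_norm]
    have : m + ν • d + (1 - |ξ|)⁻¹ • r - (m + κ • d) = (ν - κ) • d + (1 - |ξ|)⁻¹ • r := by module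
    rw [this]
    refine (norm_add_le _ _).trans ?_
    rw [norm_smul, norm_smul, norm_inv, Real.norm_of_nonneg hp.le, Real.norm_eq_abs]
    rw [div_eq_inv_mul] at hrr
    nlinarith [norm_nonneg d]
  have hseg : m + κ • d ∈ segment ℝ m (m + d) := ⟨1 - κ, κ, by linarith, hκ0, by ring, by module⟩
  have hxx : x = m + ξ • e + η • d + r := by rw [hr]; abel
  have hcomb : (1 - |ξ|) • (m + ν • d + (1 - |ξ|)⁻¹ • r) = (1 - |ξ|) • m + η • d + r := by
    rw [smul_add, smul_add, smul_smul, smul_smul, hην, mul_inv_cancel₀ hp.ne', one_smul]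
  rcases le_total 0 ξ with h | h
  · refine ⟨|ξ|, m + e, _, _, abs_nonneg _, hμ, Or.inr rfl, hseg, hq, ?_⟩
    rw [hcomb, hxx, abs_of_nonneg h]; module
  · refine ⟨|ξ|, m - e, _, _, abs_nonneg _, hμ, Or.inl rfl, hseg, hq, ?_⟩
    rw [hcomb, hxx, abs_of_nonpos h]; module

theorem seg_subset_tri (m e d : V3) {q' : V3} (h : q' ∈ segment ℝ m (m + d)) :
    q' ∈ tri (m - e) (m + d) (m + e) := by
  have h2 : m ∈ tri (m - e) (m + d) (m + e) :=
    ⟨1/2, 0, 1/2, by norm_num, le_rfl, by norm_num, by norm_num, by module⟩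
  exact (tri_convex _ _ _).segment_subset h2 (mid_mem_tri _ _ _) h

theorem nbd_subset_open {m e d : V3} {X Y : V3 →L[ℝ] ℝ} {W : Set V3} (hW : IsOpen W)
    (hc : Convex ℝ W) (h1 : m ∈ W) (h2 : m + d ∈ W) (h3 : m - e ∈ closure W)
    (h4 : m + e ∈ closure W) : ∃ δ > 0, nbd m e d X Y δ ⊆ W := by
  obtain ⟨ρ, hρ, hsub⟩ := (segment_compact m (m + d)).exists_thickening_subset_open hW
    (hc.segment_subset h1 h2)
  refine ⟨ρ / (2 * (‖d‖ + 1)), by positivity, ?_⟩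
  intro x hx
  obtain ⟨μ, σ, q, q', hμ0, hμ1, hσ, hq', hd, rfl⟩ := nbd_decomp (by positivity) hx
  have hqW : q ∈ W := by
    apply hsub
    rw [Metric.mem_thickening_iff]
    refine ⟨q', hq', ?_⟩
    have : ρ / (2 * (‖d‖ + 1)) * (‖d‖ + 1) = ρ / 2 := by field_simp
    rw [this] at hd
    linarith
  have hσW : σ ∈ closure W := by rcases hσ with rfl | rfl <;> assumption
  rw [← hW.interior_eq] at hqW ⊢
  exact hc.combo_interior_closure_mem_interior hqW hσW (by linarith) hμ0 (by ring)

theorem nbd_disj_far {m e d : V3} {X Y : V3 →L[ℝ] ℝ} {S : Set V3} (hS : IsClosed S)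
    (h : Disjoint (tri (m - e) (m + d) (m + e)) S) : ∃ δ > 0, Disjoint S (nbd m e d X Y δ) := by
  obtain ⟨ρ, hρ, hsub⟩ := (tri_compact (m - e) (m + d) (m + e)).exists_thickening_subset_open
    hS.isOpen_compl (disjoint_left.1 h)
  refine ⟨ρ / (2 * (‖d‖ + 1)), by positivity, ?_⟩
  rw [disjoint_left]
  intro x hxS hx
  obtain ⟨μ, σ, q, q', hμ0, hμ1, hσ, hq', hd, rfl⟩ := nbd_decomp (by positivity) hx
  refine hsub ?_ hxS
  rw [Metric.mem_thickening_iff]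
  refine ⟨(1 - μ) • q' + μ • σ, ?_, ?_⟩
  · refine tri_convex _ _ _ (seg_subset_tri m e d hq') ?_ (by linarith) hμ0 (by ring)
    rcases hσ with rfl | rfl
    · exact left_mem_tri _ _ _
    · exact right_mem_tri _ _ _
  · rw [dist_eq_norm] at hd ⊢
    have : (1 - μ) • q + μ • σ - ((1 - μ) • q' + μ • σ) = (1 - μ) • (q - q') := by module
    rw [this, norm_smul, Real.norm_of_nonneg (by linarith)]
    have : ρ / (2 * (‖d‖ + 1)) * (‖d‖ + 1) = ρ / 2 := by field_simp
    rw [this] at hd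
    nlinarith [norm_nonneg (q - q')]

theorem nbd_disj_ray {m e d : V3} {X Y : V3 →L[ℝ] ℝ} (hXe : X e = 1) (hYe : Y e = 0)
    (q : V3) (h : tri (m - e) (m + d) (m + e) ∩ segment ℝ (m - e) q ⊆ {m - e}) :
    ∃ δ > 0, Disjoint (segment ℝ (m - e) q) (nbd m e d X Y δ) := by
  by_contra hcon
  push Not at hcon
  set v := q - (m - e) with hv
  -- each failure gives inequalities
  have key : ∀ δ > 0, Y v / (1 + δ) < X v ∧ -Y v / δ < X v ∧
      ‖v - X v • e - Y v • d‖ / δ < X v := by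
    intro δ hδ
    have := hcon δ hδ
    rw [not_disjoint_iff] at this
    obtain ⟨x, hx, h1, h2, h3⟩ := this
    rw [segment_eq_image'] at hx
    obtain ⟨ε, ⟨hε0, hε1⟩, rfl⟩ := hx
    have hsub : m - e + ε • (q - (m - e)) - m = ε • v - e := by rw [hv]; module
    rw [hsub] at h1 h2 h3
    simp only [map_sub, map_smul, hXe, hYe, smul_eq_mul, sub_zero] at h1 h2 h3
    have hε : 0 < ε := by
      rcases hε0.eq_or_lt with rfl | h
      · simp at h1
      · exact h
    have habs : 1 - ε * X v ≤ |ε * X v - 1| := by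
      rw [abs_sub_comm]; exact le_abs_self _
    have e1 : ε * Y v / (1 + δ) = ε * (Y v / (1 + δ)) := by ring
    have e2 : ε * Y v / δ = ε * (Y v / δ) := by ring
    have e3 : ε • v - e - (ε * X v - 1) • e - (ε * Y v) • d = ε • (v - X v • e - Y v • d) := by
      module
    rw [e3, norm_smul, Real.norm_of_nonneg hε.le] at h3
    have e4 : ε * ‖v - X v • e - Y v • d‖ / δ = ε * (‖v - X v • e - Y v • d‖ / δ) := by ring
    rw [e1] at h1
    rw [e2] at h2
    rw [e4] at h3
    refine ⟨?_, ?_, ?_⟩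
    · by_contra hh; push Not at hh; nlinarith
    · rw [neg_div]; by_contra hh; push Not at hh; nlinarith
    · by_contra hh; push Not at hh; nlinarith
  have hX : 0 < X v := by
    have := (key 1 one_pos).2.2
    have h0 : 0 ≤ ‖v - X v • e - Y v • d‖ / 1 := by positivity
    linarith
  have hZ : v - X v • e - Y v • d = 0 := by
    by_contra hne
    have hn : 0 < ‖v - X v • e - Y v • d‖ := norm_pos_iff.2 hne
    have := (key (‖v - X v • e - Y v • d‖ / X v) (by positivity)).2.2
    rw [div_div_eq_mul_div, div_lt_iff₀ hn] at this
    linarith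
  have hY0 : 0 ≤ Y v := by
    by_contra hne
    push Not at hne
    have := (key (-Y v / X v) (div_pos (by linarith) hX)).2.1
    rw [div_div_eq_mul_div, div_lt_iff₀ (by linarith)] at this
    linarith
  have hYX : Y v ≤ X v := by
    by_contra hne
    push Not at hne
    have := (key (Y v / X v - 1) (by rw [gt_iff_lt, sub_pos, lt_div_iff₀ hX]; linarith)).1
    rw [add_sub_cancel, div_div_eq_mul_div, div_lt_iff₀ (by linarith)] at this
    linarith
  -- the point m - e + ε v is in the triangle
  obtain ⟨ε, hε0, hε1, hε2⟩ : ∃ ε : ℝ, 0 < ε ∧ ε ≤ 1 ∧ ε * X v ≤ 1 := by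
    refine ⟨min 1 (1 / X v), by positivity, min_le_left _ _, ?_⟩
    have : min 1 (1 / X v) ≤ 1 / X v := min_le_right _ _
    rw [le_div_iff₀ hX] at this
    linarith
  have hv' : v = X v • e + Y v • d := by
    rw [sub_sub, sub_eq_zero] at hZ; exact hZ
  have hmem : m - e + ε • v ∈ tri (m - e) (m + d) (m + e) := by
    refine ⟨1 - ε * (X v + Y v) / 2, ε * Y v, ε * (X v - Y v) / 2, ?_, by positivity, ?_, by ring, ?_⟩
    · nlinarith
    · have : 0 ≤ X v - Y v := by linarith
      positivity
    · nth_rw 1 [hv']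
      module
  have hseg : m - e + ε • v ∈ segment ℝ (m - e) q := by
    rw [segment_eq_image']
    exact ⟨ε, ⟨hε0.le, hε1⟩, rfl⟩
  have := h ⟨hmem, hseg⟩
  rw [mem_singleton_iff, add_eq_left, smul_eq_zero] at this
  rcases this with h | h
  · exact hε0.ne' h
  · rw [h] at hX; simp at hX

theorem segment_split {a b z : V3} (hz : z ∈ segment ℝ a b) :
    segment ℝ a b = segment ℝ z a ∪ segment ℝ z b := by
  apply Subset.antisymm
  · rw [segment_eq_image] at hz
    obtain ⟨t, ⟨ht0, ht1⟩, rfl⟩ := hz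
    rintro x ⟨u, v, hu, hv, huv, rfl⟩
    have hu' : u = 1 - v := by linarith
    subst hu'
    simp only
    rcases le_total v t with h | h
    · left
      rcases eq_or_lt_of_le ht0 with h0 | h0
      · have : v = 0 := by linarith
        subst this; subst h0; simp
      · refine ⟨v / t, 1 - v / t, by positivity, ?_, by ring, ?_⟩
        · rw [sub_nonneg, div_le_one h0]; exact h
        · have : v / t * t = v := by field_simp
          rw [smul_add, smul_smul, smul_smul, this]
          have h5 : v / t * (1 - t) = v / t - v := by rw [mul_sub, this]; ring
          rw [h5]; module
    · right
      rcases eq_or_lt_of_le ht1 with h1 | h1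
      · have : v = 1 := by linarith
        subst this; subst h1; simp
      · have h1' : 0 < 1 - t := by linarith
        refine ⟨(1 - v) / (1 - t), 1 - (1 - v) / (1 - t), div_nonneg hu (by linarith), ?_, by ring, ?_⟩
        · rw [sub_nonneg, div_le_one h1']; linarith
        · have : (1 - v) / (1 - t) * (1 - t) = 1 - v := by field_simp
          rw [smul_add, smul_smul, smul_smul, this]
          have h5 : (1 - v) / (1 - t) * t = (1 - v) / (1 - t) - (1 - v) := by linarith
          rw [h5]; module
  · apply union_subset
    · exact (convex_segment _ _).segment_subset hz (left_mem_segment _ _ _)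
    · exact (convex_segment _ _).segment_subset hz (right_mem_segment _ _ _)

theorem nbd_disj_seg {m e d : V3} {X Y : V3 →L[ℝ] ℝ} (hXe : X e = 1) (hYe : Y e = 0)
    (p q : V3) (h : tri (m - e) (m + d) (m + e) ∩ segment ℝ p q ⊆ {m - e, m + e}) :
    ∃ δ > 0, Disjoint (segment ℝ p q) (nbd m e d X Y δ) := by
  have he : e ≠ 0 := by rintro rfl; simp at hXe
  have hne : m - e ≠ m + e := by
    intro hh
    apply he
    have h2 : (2 : ℝ) • e = 0 := by
      have := sub_eq_zero.2 hh
      rw [← neg_eq_zero, ← this]; module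
    simpa using h2
  have comb : ∀ S S' : Set V3, (∃ δ > 0, Disjoint S (nbd m e d X Y δ)) →
      (∃ δ > 0, Disjoint S' (nbd m e d X Y δ)) → ∃ δ > 0, Disjoint (S ∪ S') (nbd m e d X Y δ) := by
    rintro S S' ⟨δ, h0, h1⟩ ⟨δ', h0', h1'⟩
    refine ⟨min δ δ', lt_min h0 h0', ?_⟩
    rw [disjoint_union_left]
    exact ⟨h1.mono_right (nbd_mono (lt_min h0 h0') (min_le_left _ _)),
      h1'.mono_right (nbd_mono (lt_min h0 h0') (min_le_right _ _))⟩
  have hnot : ¬ (m - e ∈ segment ℝ p q ∧ m + e ∈ segment ℝ p q) := by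
    rintro ⟨h1, h2⟩
    have hm : m ∈ segment ℝ (m - e) (m + e) :=
      ⟨1/2, 1/2, by norm_num, by norm_num, by norm_num, by module⟩
    have := h ⟨(tri_convex _ _ _).segment_subset (left_mem_tri _ _ _) (right_mem_tri _ _ _) hm,
      (convex_segment _ _).segment_subset h1 h2 hm⟩
    rcases this with h | h
    · apply he; simpa using (h : m = m - e).symm
    · apply he; simpa using (h : m = m + e)
  by_cases h1 : m - e ∈ segment ℝ p q
  · have h2 : m + e ∉ segment ℝ p q := fun h2 => hnot ⟨h1, h2⟩
    rw [segment_split h1]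
    have : ∀ x, segment ℝ (m - e) x ⊆ segment ℝ p q →
        tri (m - e) (m + d) (m + e) ∩ segment ℝ (m - e) x ⊆ {m - e} := by
      intro x hx y hy
      rcases h ⟨hy.1, hx hy.2⟩ with h | h
      · exact h
      · exact absurd (h ▸ hx hy.2) h2
    have hs := segment_split h1
    exact comb _ _ (nbd_disj_ray hXe hYe p (this p (hs ▸ subset_union_left)))
      (nbd_disj_ray hXe hYe q (this q (hs ▸ subset_union_right)))
  · by_cases h2 : m + e ∈ segment ℝ p q
    · rw [segment_split h2]
      have : ∀ x, segment ℝ (m + e) x ⊆ segment ℝ p q →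
          tri (m - -e) (m + d) (m + -e) ∩ segment ℝ (m - -e) x ⊆ {m - -e} := by
        intro x hx y hy
        rw [sub_neg_eq_add, ← sub_eq_add_neg] at *
        rw [tri_rev] at h
        rcases h ⟨hy.1, hx hy.2⟩ with h | h
        · exact absurd (h ▸ hx hy.2) h1
        · exact h
      have hs := segment_split h2
      have r1 := nbd_disj_ray (X := -X) (Y := Y) (by simp [hXe]) (by simp [hYe]) p
        (this p (hs ▸ subset_union_left))
      have r2 := nbd_disj_ray (X := -X) (Y := Y) (by simp [hXe]) (by simp [hYe]) q
        (this q (hs ▸ subset_union_right))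
      simp only [nbd_neg, sub_neg_eq_add] at r1 r2
      exact comb _ _ r1 r2
    · apply nbd_disj_far (segment_compact p q).isClosed
      rw [disjoint_left]
      intro x hx hx'
      rcases h ⟨hx, hx'⟩ with h | h
      · exact h1 (h ▸ hx')
      · exact h2 (h ▸ hx')

/-- The elementary move across a triangle. -/
theorem delta_core {m e d : V3} {X Y : V3 →L[ℝ] ℝ} (hXe : X e = 1) (hYe : Y e = 0)
    (hXd : X d = 0) (hYd : Y d = 1) {δ : ℝ} (hδ : 0 < δ) :
    Iso (nbd m e d X Y δ) (segment ℝ (m - e) (m + e))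
      (segment ℝ (m - e) (m + d) ∪ segment ℝ (m + d) (m + e)) := by
  let g : V3 → ℝ := fun x => max (max (Y (x - m) / (1 + δ)) (-Y (x - m) / δ))
    (‖x - m - X (x - m) • e - Y (x - m) • d‖ / δ)
  let φ : V3 → ℝ := fun x => max 0 (1 - |X (x - m)| - g x)
  have hg0 : ∀ x, 0 ≤ g x := fun x => le_max_of_le_right (by positivity)
  have hgc : Continuous g := by fun_prop
  have hφc : Continuous φ := by fun_prop
  have hstep : ∀ x s, 0 < s → φ x - s < φ (x + s • d) := by
    intro x s hs
    have hx : x + s • d - m = (x - m) + s • d := by abel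
    have hX : X (x + s • d - m) = X (x - m) := by rw [hx, map_add, map_smul, hXd]; simp
    have hY : Y (x + s • d - m) = Y (x - m) + s := by rw [hx, map_add, map_smul, hYd]; simp
    have hg : g (x + s • d) < g x + s := by
      simp only [g, hX, hY]
      have hz : x + s • d - m - X (x - m) • e - (Y (x - m) + s) • d =
        x - m - X (x - m) • e - Y (x - m) • d := by module
      rw [hz]
      refine max_lt (max_lt ?_ ?_) ?_
      · have h1 : (Y (x - m) + s) / (1 + δ) < Y (x - m) / (1 + δ) + s := by
          rw [add_div]
          have : s / (1 + δ) < s := by rw [div_lt_iff₀ (by linarith)]; nlinarith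
          linarith
        refine h1.trans_le ?_
        gcongr
        exact (le_max_left _ _).trans (le_max_left _ _)
      · have h1 : -(Y (x - m) + s) / δ < -Y (x - m) / δ + s := by
          have : -(Y (x - m) + s) / δ < -Y (x - m) / δ := by
            gcongr; linarith
          linarith
        refine h1.trans_le ?_
        gcongr
        exact (le_max_right _ _).trans (le_max_left _ _)
      · have : ‖x - m - X (x - m) • e - Y (x - m) • d‖ / δ ≤ _ := le_max_right
          (max (Y (x - m) / (1 + δ)) (-Y (x - m) / δ))
          (‖x - m - X (x - m) • e - Y (x - m) • d‖ / δ)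
        linarith
    simp only [φ, hX]
    rcases le_total (1 - |X (x - m)| - g x) 0 with h | h
    · rw [max_eq_left h]
      have := le_max_left 0 (1 - |X (x - m)| - g (x + s • d))
      linarith
    · rw [max_eq_right h]
      have := le_max_right 0 (1 - |X (x - m)| - g (x + s • d))
      linarith
  have h1 := Iso.shear φ hφc d (fun x => le_max_left _ _) (fun x => max_le zero_le_one (by
    have := hg0 x; have := abs_nonneg (X (x - m)); linarith)) hstep (segment ℝ (m - e) (m + e))
  have hval : ∀ ξ : ℝ, |ξ| ≤ 1 → m + ξ • e + φ (m + ξ • e) • d = m + ξ • e + (1 - |ξ|) • d := by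
    intro ξ hξ
    congr 2
    simp only [φ, g, add_sub_cancel_left, map_smul, hXe, hYe]
    simp [hξ]
  have himg : (fun x => x + φ x • d) '' segment ℝ (m - e) (m + e) =
      segment ℝ (m - e) (m + d) ∪ segment ℝ (m + d) (m + e) := by
    apply Subset.antisymm
    · rintro _ ⟨x, ⟨u, v, hu, hv, huv, rfl⟩, rfl⟩
      have hx : u • (m - e) + v • (m + e) = m + (v - u) • e := by
        have : u = 1 - v := by linarith
        subst this; module
      simp only [hx]
      have hle : |v - u| ≤ 1 := by rw [abs_le]; constructor <;> linarith
      rw [hval _ hle]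
      rcases le_total v u with h | h
      · left
        rw [abs_of_nonpos (by linarith)]
        refine ⟨u - v, 1 - (u - v), by linarith, by linarith, by ring, by module⟩
      · right
        rw [abs_of_nonneg (by linarith)]
        refine ⟨1 - (v - u), v - u, by linarith, by linarith, by ring, by module⟩
    · apply union_subset
      · rintro _ ⟨u, v, hu, hv, huv, rfl⟩
        refine ⟨m + (-u) • e, ⟨(1 + u) / 2, (1 - u) / 2, by linarith, by linarith, by ring, by module⟩, ?_⟩
        have hle : |-u| ≤ 1 := by rw [abs_le]; constructor <;> linarith
        simp only
        rw [hval _ hle, abs_of_nonpos (by linarith)]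
        have : v = 1 - u := by linarith
        subst this; module
      · rintro _ ⟨u, v, hu, hv, huv, rfl⟩
        refine ⟨m + v • e, ⟨(1 - v) / 2, (1 + v) / 2, by linarith, by linarith, by ring, by module⟩, ?_⟩
        have hle : |v| ≤ 1 := by rw [abs_le]; constructor <;> linarith
        simp only
        rw [hval _ hle, abs_of_nonneg (by linarith)]
        have : u = 1 - v := by linarith
        subst this; module
  rw [himg] at h1
  refine h1.mono ?_
  intro x hx
  have hx' : 0 < 1 - |X (x - m)| - g x := by
    by_contra hh
    rw [mem_ofPred_eq] at hx
    simp only [φ] at hx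
    rw [max_eq_left (not_lt.1 hh)] at hx
    exact lt_irrefl _ hx
  have g1 : Y (x - m) / (1 + δ) ≤ g x := (le_max_left _ _).trans (le_max_left _ _)
  have g2 : -Y (x - m) / δ ≤ g x := (le_max_right _ _).trans (le_max_left _ _)
  have g3 : ‖x - m - X (x - m) • e - Y (x - m) • d‖ / δ ≤ g x := le_max_right _ _
  rw [neg_div] at g2
  exact ⟨by linarith, by linarith, by linarith⟩

theorem exists_dual_pair {e d : V3} (h : LinearIndependent ℝ ![e, d]) :
    ∃ X : V3 →L[ℝ] ℝ, X e = 1 ∧ X d = 0 := by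
  have he : e ∉ Submodule.span ℝ {d} := by
    intro hh
    rw [Submodule.mem_span_singleton] at hh
    obtain ⟨s, hs⟩ := hh
    rw [LinearIndependent.pair_iff] at h
    have := (h 1 (-s) (by rw [← hs]; module)).1
    norm_num at this
  obtain ⟨f, hf, hk⟩ := Submodule.exists_le_ker_of_notMem he
  refine ⟨LinearMap.toContinuousLinearMap ((f e)⁻¹ • f), by simp [hf], ?_⟩
  have : f d = 0 := hk (Submodule.mem_span_singleton_self d)
  simp [this]

/-- Finite unions of segments. -/
def segs (L : List (V3 × V3)) : Set V3 := {x | ∃ s ∈ L, x ∈ segment ℝ s.1 s.2}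

theorem delta {a b c : V3} (hli : LinearIndependent ℝ ![c - a, b - a]) {W : Set V3}
    (hW : IsOpen W) (hc : Convex ℝ W) (hb : b ∈ W) (ha : a ∈ closure W) (hcc : c ∈ closure W)
    (hac : (1/2 : ℝ) • (a + c) ∈ W) (L : List (V3 × V3)) (hL : tri a b c ∩ segs L ⊆ {a, c}) :
    Iso W (segment ℝ a c ∪ segs L) ((segment ℝ a b ∪ segment ℝ b c) ∪ segs L) := by
  obtain ⟨m, hm⟩ : ∃ m, m = (1/2 : ℝ) • (a + c) := ⟨_, rfl⟩
  obtain ⟨e, he⟩ : ∃ e, e = (1/2 : ℝ) • (c - a) := ⟨_, rfl⟩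
  obtain ⟨d, hd⟩ : ∃ d, d = b - m := ⟨_, rfl⟩
  have ea : a = m - e := by rw [hm, he]; module
  have ec : c = m + e := by rw [hm, he]; module
  have eb : b = m + d := by rw [hd]; abel
  have hli' : LinearIndependent ℝ ![e, d] := by
    rw [LinearIndependent.pair_iff] at hli ⊢
    intro s t hst
    have h2 := hli ((s - t) / 2) t (by rw [← hst, hd, hm, he]; module)
    constructor <;> linarith [h2.1, h2.2]
  obtain ⟨X, hXe, hXd⟩ := exists_dual_pair hli'
  have hli'' : LinearIndependent ℝ ![d, e] := by
    rw [LinearIndependent.pair_iff] at hli' ⊢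
    intro s t hst
    have := hli' t s (by rw [add_comm]; exact hst)
    exact ⟨this.2, this.1⟩
  obtain ⟨Y, hYd, hYe⟩ := exists_dual_pair hli''
  have hmW : m ∈ W := hm ▸ hac
  clear hm he hd
  subst ea eb ec
  obtain ⟨δ₁, hδ₁, hsub⟩ := nbd_subset_open (X := X) (Y := Y) hW hc hmW hb ha hcc
  have hdisj : ∃ δ > 0, Disjoint (segs L) (nbd m e d X Y δ) := by
    clear hsub
    induction L with
    | nil => exact ⟨1, one_pos, by simp [segs]⟩
    | cons s L ih =>
      have hsplit : segs (s :: L) = segment ℝ s.1 s.2 ∪ segs L := by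
        ext x; simp [segs]
      rw [hsplit] at hL ⊢
      obtain ⟨δ, h0, h1⟩ := ih (fun x hx => hL ⟨hx.1, Or.inr hx.2⟩)
      obtain ⟨δ', h0', h1'⟩ := nbd_disj_seg (X := X) (Y := Y) hXe hYe s.1 s.2
        (fun x hx => hL ⟨hx.1, Or.inl hx.2⟩)
      refine ⟨min δ δ', lt_min h0 h0', ?_⟩
      rw [disjoint_union_left]
      exact ⟨h1'.mono_right (nbd_mono (lt_min h0 h0') (min_le_right _ _)),
        h1.mono_right (nbd_mono (lt_min h0 h0') (min_le_left _ _))⟩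
  obtain ⟨δ₂, hδ₂, hdis⟩ := hdisj
  have hmin := lt_min hδ₁ hδ₂
  have := delta_core (m := m) hXe hYe hXd hYd hmin
  refine (this.union (hdis.mono_right (nbd_mono hmin (min_le_right _ _)))).mono ?_
  exact (nbd_mono hmin (min_le_left _ _)).trans hsub

/-- Polygonal path through a list of vertices. -/
def poly : List V3 → Set V3
  | [] => ∅
  | [a] => {a}
  | a :: b :: l => segment ℝ a b ∪ poly (b :: l)

/-- The path is embedded (consecutive duplicates allowed). -/
def Arc : List V3 → Prop
  | [] => True
  | [_] => True
  | a :: b :: l => segment ℝ a b ∩ poly (b :: l) ⊆ {b} ∧ Arc (b :: l)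

theorem head_mem_poly (a : V3) (l : List V3) : a ∈ poly (a :: l) := by
  cases l with
  | nil => simp [poly]
  | cons b l => exact Or.inl (left_mem_segment ℝ a b)

theorem poly_append (l1 : List V3) (a : V3) (l2 : List V3) :
    poly (l1 ++ a :: l2) = poly (l1 ++ [a]) ∪ poly (a :: l2) := by
  induction l1 with
  | nil =>
    have := head_mem_poly a l2
    simp [poly, this]
  | cons x l1 ih =>
    cases l1 with
    | nil =>
      have := head_mem_poly a l2
      simp only [List.cons_append, List.nil_append, poly, union_assoc]
      rw [union_eq_self_of_subset_left (singleton_subset_iff.2 this)]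
    | cons y l1 =>
      simp only [List.cons_append, poly] at ih ⊢
      rw [ih, union_assoc]

theorem mem_poly {x : V3} {l : List V3} (h : x ∈ l) : x ∈ poly l := by
  obtain ⟨l1, l2, rfl⟩ := List.append_of_mem h
  rw [poly_append]
  exact Or.inr (head_mem_poly _ _)

theorem last_mem_poly (l : List V3) (a : V3) : a ∈ poly (l ++ [a]) := mem_poly (by simp)

theorem poly_cons (a b : V3) (l : List V3) :
    poly (a :: b :: l) = segment ℝ a b ∪ poly (b :: l) := rfl

theorem arc_cons (a b : V3) (l : List V3) :
    Arc (a :: b :: l) ↔ segment ℝ a b ∩ poly (b :: l) ⊆ {b} ∧ Arc (b :: l) := Iff.rfl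

theorem poly_subset {S : Set V3} (hS : Convex ℝ S) {l : List V3} (h : ∀ x ∈ l, x ∈ S) :
    poly l ⊆ S := by
  induction l with
  | nil => simp [poly]
  | cons a l ih =>
    cases l with
    | nil => simpa [poly] using h
    | cons b l =>
      rw [poly_cons]
      exact union_subset (hS.segment_subset (h a (by simp)) (h b (by simp)))
        (ih fun x hx => h x (by simp at hx ⊢; tauto))

theorem arc_append (l1 : List V3) (a : V3) (l2 : List V3) :
    Arc (l1 ++ a :: l2) ↔
      Arc (l1 ++ [a]) ∧ Arc (a :: l2) ∧ poly (l1 ++ [a]) ∩ poly (a :: l2) ⊆ {a} := by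
  induction l1 with
  | nil => simp [poly, Arc]
  | cons x l1 ih =>
    cases l1 with
    | nil =>
      simp only [List.cons_append, List.nil_append, arc_cons, poly_cons]
      simp only [poly, Arc, and_true, union_inter_distrib_right, union_subset_iff]
      simp
      tauto
    | cons y l1 =>
      simp only [List.cons_append] at ih ⊢
      rw [arc_cons, ih, arc_cons, poly_cons]
      have hp := poly_append (y :: l1) a l2
      simp only [List.cons_append] at hp
      rw [hp]
      have hy : y ∈ poly (y :: (l1 ++ [a])) := head_mem_poly _ _
      have ha : a ∈ poly (y :: (l1 ++ [a])) := mem_poly (by simp)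
      constructor
      · rintro ⟨h1, h2, h3, h4⟩
        refine ⟨⟨fun z hz => h1 ⟨hz.1, Or.inl hz.2⟩, h2⟩, h3, ?_⟩
        rintro z ⟨hz | hz, hz'⟩
        · have hzy : z = y := h1 ⟨hz, Or.inr hz'⟩
          subst hzy
          exact h4 ⟨hy, hz'⟩
        · exact h4 ⟨hz, hz'⟩
      · rintro ⟨⟨h1, h2⟩, h3, h4⟩
        refine ⟨?_, h2, h3, fun z hz => h4 ⟨Or.inr hz.1, hz.2⟩⟩
        rintro z ⟨hz, hz' | hz'⟩
        · exact h1 ⟨hz, hz'⟩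
        · have hza : z = a := h4 ⟨Or.inl hz, hz'⟩
          subst hza
          exact h1 ⟨hz, ha⟩

theorem poly_reverse (l : List V3) : poly l.reverse = poly l := by
  induction l with
  | nil => rfl
  | cons a l ih =>
    cases l with
    | nil => rfl
    | cons b l =>
      rw [List.reverse_cons, List.reverse_cons, List.append_assoc, List.singleton_append,
        poly_append, ← List.reverse_cons, ih, poly_cons, poly_cons, segment_symm, union_comm]
      have := head_mem_poly b l
      have h2 : b ∈ segment ℝ a b := right_mem_segment ℝ a b
      ext z
      simp only [poly, mem_union, mem_singleton_iff]
      constructor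
      · rintro ((h | rfl) | h)
        · tauto
        · left; exact left_mem_segment ℝ _ _
        · tauto
      · tauto

theorem arc_pair (a b : V3) : Arc [a, b] := by
  simp [Arc, poly]

theorem arc_rev {l : List V3} (h : Arc l) : Arc l.reverse := by
  induction l with
  | nil => exact h
  | cons a l ih =>
    cases l with
    | nil => exact h
    | cons b l =>
      rw [List.reverse_cons, List.reverse_cons, List.append_assoc, List.singleton_append,
        arc_append, ← List.reverse_cons]
      rw [arc_cons] at h
      refine ⟨ih h.2, arc_pair _ _, ?_⟩
      rw [poly_reverse]
      have := head_mem_poly b l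
      rintro z ⟨hz, hz' | hz'⟩
      · rw [segment_symm] at hz'
        exact h.1 ⟨hz', hz⟩
      · have : z = a := hz'
        subst this
        exact h.1 ⟨left_mem_segment _ _ _, hz⟩

theorem exists_segs (l : List V3) : ∃ L, segs L = poly l := by
  induction l with
  | nil => exact ⟨[], by simp [segs, poly]⟩
  | cons a l ih =>
    cases l with
    | nil => exact ⟨[(a, a)], by ext x; simp [segs, poly]⟩
    | cons b l =>
      obtain ⟨L, hL⟩ := ih
      refine ⟨(a, b) :: L, ?_⟩
      rw [poly_cons, ← hL]
      ext x; simp [segs]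

theorem segs_append (L L' : List (V3 × V3)) : segs (L ++ L') = segs L ∪ segs L' := by
  ext x; simp only [segs, List.mem_append, mem_union, mem_ofPred_eq]
  constructor
  · rintro ⟨s, h | h, hs⟩
    · exact Or.inl ⟨s, h, hs⟩
    · exact Or.inr ⟨s, h, hs⟩
  · rintro (⟨s, h, hs⟩ | ⟨s, h, hs⟩)
    · exact ⟨s, Or.inl h, hs⟩
    · exact ⟨s, Or.inr h, hs⟩

theorem segment_subset_tri_ac (a b c : V3) : segment ℝ a c ⊆ tri a b c :=
  (tri_convex _ _ _).segment_subset (left_mem_tri _ _ _) (right_mem_tri _ _ _)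
theorem segment_subset_tri_ab (a b c : V3) : segment ℝ a b ⊆ tri a b c :=
  (tri_convex _ _ _).segment_subset (left_mem_tri _ _ _) (mid_mem_tri _ _ _)
theorem segment_subset_tri_bc (a b c : V3) : segment ℝ b c ⊆ tri a b c :=
  (tri_convex _ _ _).segment_subset (mid_mem_tri _ _ _) (right_mem_tri _ _ _)

/-- In an arc `a,b,c` with dependent directions, `b` is between `a` and `c`. -/
theorem mem_segment_of_dep {a b c : V3} (h : segment ℝ a b ∩ segment ℝ b c ⊆ {b})
    (hd : ¬ LinearIndependent ℝ ![c - a, b - a]) : b ∈ segment ℝ a c := by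
  rw [LinearIndependent.pair_iff] at hd
  push Not at hd
  obtain ⟨s, t, hst, hne⟩ := hd
  by_cases ht : t = 0
  · subst ht
    have hs : s ≠ 0 := fun h => hne h rfl
    have : c = a := by
      simp only [zero_smul, add_zero, smul_eq_zero, hs, false_or] at hst
      exact sub_eq_zero.1 hst
    subst this
    have : c = b := h ⟨left_mem_segment _ _ _, right_mem_segment _ _ _⟩
    subst this; simp
  · obtain ⟨r, hr⟩ : ∃ r : ℝ, b = a + r • (c - a) := by
      refine ⟨-s / t, ?_⟩
      have : t • (b - a) = (-s) • (c - a) := by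
        rw [neg_smul]; exact eq_neg_of_add_eq_zero_right hst
      rw [div_eq_inv_mul, mul_smul, ← this, smul_smul, inv_mul_cancel₀ ht, one_smul]
      abel
    rcases lt_or_ge r 0 with h0 | h0
    · have hm : a ∈ segment ℝ b c := by
        refine ⟨1 / (1 - r), -r / (1 - r), by apply div_nonneg <;> linarith,
          by apply div_nonneg <;> linarith, ?_, ?_⟩
        · have h1 : (1 - r) ≠ 0 := by linarith
          field_simp; ring
        have h1 : (1 - r) ≠ 0 := by linarith
        have e1 : 1 / (1 - r) * r = -(-r / (1 - r)) := by ring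
        have e2 : 1 / (1 - r) = 1 - (-r / (1 - r)) := by field_simp; ring
        rw [hr, smul_add, smul_smul, e1, e2]; module
      have : a = b := h ⟨left_mem_segment _ _ _, hm⟩
      rw [← this]; exact left_mem_segment _ _ _
    · rcases le_or_gt r 1 with h1 | h1
      · rw [hr, segment_eq_image']; exact ⟨r, ⟨h0, h1⟩, rfl⟩
      · have hm : c ∈ segment ℝ a b := by
          refine ⟨1 - 1 / r, 1 / r, by rw [sub_nonneg, div_le_one (by linarith)]; exact h1.le,
            by positivity, by ring, ?_⟩
          have e1 : 1 / r * r = 1 := by field_simp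
          rw [hr, smul_add, smul_smul, e1]; module
        have : c = b := h ⟨hm, right_mem_segment _ _ _⟩
        rw [← this]; exact right_mem_segment _ _ _

/-- Equivalence of arcs by an isotopy supported in `W`. -/
def Eqv (W : Set V3) (A B : List V3) : Prop := Arc A ∧ Arc B ∧ Iso W (poly A) (poly B)

theorem Eqv.refl {W : Set V3} {A : List V3} (h : Arc A) : Eqv W A A := ⟨h, h, Iso.refl _ _⟩
theorem Eqv.symm {W : Set V3} {A B : List V3} (h : Eqv W A B) : Eqv W B A :=
  ⟨h.2.1, h.1, h.2.2.symm⟩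
theorem Eqv.trans {W : Set V3} {A B C : List V3} (h : Eqv W A B) (h' : Eqv W B C) : Eqv W A C :=
  ⟨h.1, h'.2.1, h.2.2.trans h'.2.2⟩
theorem Eqv.mono {W W' : Set V3} {A B : List V3} (h : Eqv W A B) (hW : W ⊆ W') : Eqv W' A B :=
  ⟨h.1, h.2.1, h.2.2.mono hW⟩
theorem Eqv.rev {W : Set V3} {A B : List V3} (h : Eqv W A B) : Eqv W A.reverse B.reverse :=
  ⟨arc_rev h.1, arc_rev h.2.1, by rw [poly_reverse, poly_reverse]; exact h.2.2⟩
theorem Eqv.rev_iff {W : Set V3} {A B : List V3} : Eqv W A.reverse B.reverse ↔ Eqv W A B :=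
  ⟨fun h => by simpa using h.rev, fun h => h.rev⟩

theorem poly_three (l1 : List V3) (a b c : V3) (l2 : List V3) :
    poly (l1 ++ a :: b :: c :: l2) =
      (segment ℝ a b ∪ segment ℝ b c) ∪ (poly (l1 ++ [a]) ∪ poly (c :: l2)) := by
  rw [poly_append, poly_cons, poly_cons]
  ext x; simp only [mem_union]; tauto

theorem poly_two (l1 : List V3) (a c : V3) (l2 : List V3) :
    poly (l1 ++ a :: c :: l2) =
      segment ℝ a c ∪ (poly (l1 ++ [a]) ∪ poly (c :: l2)) := by
  rw [poly_append, poly_cons]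
  ext x; simp only [mem_union]; tauto

theorem arc_two {l1 : List V3} {a c : V3} {l2 : List V3} (h1 : Arc (l1 ++ [a])) (h2 : Arc (c :: l2))
    (h3 : poly (l1 ++ [a]) ∩ segment ℝ a c ⊆ {a}) (h4 : segment ℝ a c ∩ poly (c :: l2) ⊆ {c})
    (h5 : poly (l1 ++ [a]) ∩ poly (c :: l2) ⊆ {a}) : Arc (l1 ++ a :: c :: l2) := by
  rw [arc_append, arc_cons, poly_cons]
  refine ⟨h1, ⟨h4, h2⟩, ?_⟩
  rw [inter_union_distrib_left]
  exact union_subset h3 h5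

theorem arc_three_iff {l1 : List V3} {a b c : V3} {l2 : List V3} :
    Arc (l1 ++ a :: b :: c :: l2) ↔ Arc (l1 ++ [a]) ∧ Arc (c :: l2) ∧
      segment ℝ a b ∩ segment ℝ b c ⊆ {b} ∧ segment ℝ a b ∩ poly (c :: l2) ⊆ {b} ∧
      segment ℝ b c ∩ poly (c :: l2) ⊆ {c} ∧ poly (l1 ++ [a]) ∩ segment ℝ a b ⊆ {a} ∧
      poly (l1 ++ [a]) ∩ segment ℝ b c ⊆ {a} ∧ poly (l1 ++ [a]) ∩ poly (c :: l2) ⊆ {a} := by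
  rw [arc_append, arc_cons, arc_cons, poly_cons a b, poly_cons b c]
  simp only [inter_union_distrib_left, union_subset_iff]
  tauto

/-- Removal of a vertex `b` across the triangle `a b c`. -/
theorem remove_mid {W : Set V3} {l1 : List V3} {a b c : V3} {l2 : List V3}
    (hA : Arc (l1 ++ a :: b :: c :: l2))
    (h1 : tri a b c ∩ poly (l1 ++ [a]) ⊆ {a}) (h2 : tri a b c ∩ poly (c :: l2) ⊆ {c})
    (hW : IsOpen W) (hc : Convex ℝ W) (hb : b ∈ W) (ha : a ∈ closure W) (hcc : c ∈ closure W)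
    (hac : (1/2 : ℝ) • (a + c) ∈ W) : Eqv W (l1 ++ a :: b :: c :: l2) (l1 ++ a :: c :: l2) := by
  have hA' := arc_three_iff.1 hA
  obtain ⟨k1, k2, k3, k4, k5, k6, k7, k8⟩ := hA'
  refine ⟨hA, ?_, ?_⟩
  · refine arc_two k1 k2 ?_ ?_ k8
    · exact fun x hx => h1 ⟨segment_subset_tri_ac _ _ _ hx.2, hx.1⟩
    · exact fun x hx => h2 ⟨segment_subset_tri_ac _ _ _ hx.1, hx.2⟩
  · rw [poly_three, poly_two]
    by_cases hli : LinearIndependent ℝ ![c - a, b - a]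
    · obtain ⟨L1, e1⟩ := exists_segs (l1 ++ [a])
      obtain ⟨L2, e2⟩ := exists_segs (c :: l2)
      rw [← e1, ← e2, ← segs_append]
      refine (delta hli hW hc hb ha hcc hac (L1 ++ L2) ?_).symm
      rw [segs_append, e1, e2, inter_union_distrib_left]
      refine union_subset (h1.trans ?_) (h2.trans ?_) <;> simp
    · have := mem_segment_of_dep k3 hli
      apply Iso.of_eq
      rw [segment_split this, segment_symm ℝ b a]

theorem combo_mem {W : Set V3} (hW : IsOpen W) (hc : Convex ℝ W) {a b : V3} (ha : a ∈ W)
    (hb : b ∈ closure W) {s t : ℝ} (hs : 0 < s) (ht : 0 ≤ t) (hst : s + t = 1) :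
    s • a + t • b ∈ W := by
  rw [← hW.interior_eq] at ha ⊢
  exact hc.combo_interior_closure_mem_interior ha hb hs ht hst

theorem mid_mem {W : Set V3} (hW : IsOpen W) (hc : Convex ℝ W) {a c : V3} (ha : a ∈ closure W)
    (hcc : c ∈ closure W) (hac : a ∈ W ∨ c ∈ W) : (1/2 : ℝ) • (a + c) ∈ W := by
  rcases hac with h | h
  · rw [smul_add]; exact combo_mem hW hc h hcc (by norm_num) (by norm_num) (by norm_num)
  · rw [add_comm, smul_add]; exact combo_mem hW hc h ha (by norm_num) (by norm_num) (by norm_num)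

theorem remove {W : Set V3} {l1 : List V3} {a b c : V3} {l2 : List V3}
    (hA : Arc (l1 ++ a :: b :: c :: l2))
    (h1 : tri a b c ∩ poly (l1 ++ [a]) ⊆ {a}) (h2 : tri a b c ∩ poly (c :: l2) ⊆ {c})
    (hW : IsOpen W) (hc : Convex ℝ W) (hb : b ∈ W) (ha : a ∈ closure W) (hcc : c ∈ closure W)
    (hac : a ∈ W ∨ c ∈ W) : Eqv W (l1 ++ a :: b :: c :: l2) (l1 ++ a :: c :: l2) :=
  remove_mid hA h1 h2 hW hc hb ha hcc (mid_mem hW hc ha hcc hac)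

theorem arc_insert_on {l1 : List V3} {a b c : V3} {l2 : List V3} (h : Arc (l1 ++ a :: c :: l2))
    (hb : b ∈ segment ℝ a c) : Arc (l1 ++ a :: b :: c :: l2) := by
  rw [arc_append, arc_cons, poly_cons, inter_union_distrib_left, union_subset_iff] at h
  obtain ⟨k1, ⟨k2, k3⟩, k4, k5⟩ := h
  have hs := segment_split hb
  have s1 : segment ℝ a b ⊆ segment ℝ a c := by rw [hs, segment_symm ℝ a b]; exact subset_union_left
  have s2 : segment ℝ b c ⊆ segment ℝ a c := by rw [hs]; exact subset_union_right
  have key : segment ℝ a b ∩ segment ℝ b c ⊆ {b} := by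
    rintro x ⟨hx1, hx2⟩
    rw [mem_singleton_iff]
    by_contra hne
    have hbet1 := (mem_segment_iff_wbtw.1 hx1)
    have hbet2 := (mem_segment_iff_wbtw.1 hx2)
    have hbet3 := (mem_segment_iff_wbtw.1 hb)
    have := (hbet3.trans_right_left hbet2)
    exact hne ((wbtw_swap_right_iff ℝ a).1 ⟨hbet1, this⟩)
  rw [arc_three_iff]
  refine ⟨k1, k3, key, ?_, ?_, ?_, ?_, k5⟩
  · intro x hx
    have hxc : x = c := k2 ⟨s1 hx.1, hx.2⟩
    subst hxc
    exact key ⟨hx.1, right_mem_segment _ _ _⟩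
  · exact fun x hx => k2 ⟨s2 hx.1, hx.2⟩
  · exact fun x hx => k4 ⟨hx.1, s1 hx.2⟩
  · exact fun x hx => k4 ⟨hx.1, s2 hx.2⟩

theorem poly_insert_on {l1 : List V3} {a b c : V3} {l2 : List V3} (hb : b ∈ segment ℝ a c) :
    poly (l1 ++ a :: b :: c :: l2) = poly (l1 ++ a :: c :: l2) := by
  rw [poly_three, poly_two, segment_split hb, segment_symm ℝ b a]

theorem arc_remove_on {l1 : List V3} {a b c : V3} {l2 : List V3}
    (h : Arc (l1 ++ a :: b :: c :: l2)) (hb : b ∈ segment ℝ a c) : Arc (l1 ++ a :: c :: l2) := by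
  obtain ⟨k1, k2, k3, k4, k5, k6, k7, k8⟩ := arc_three_iff.1 h
  have hs := segment_split hb
  rw [segment_symm ℝ b a] at hs
  refine arc_two k1 k2 ?_ ?_ k8
  · rw [hs, inter_union_distrib_left]; exact union_subset k6 k7
  · rw [hs, union_inter_distrib_right]
    refine union_subset ?_ k5
    intro x hx
    have hxb : x = b := k4 hx
    subst hxb
    exact k5 ⟨left_mem_segment _ _ _, hx.2⟩

theorem eqv_insert_on {W : Set V3} {l1 : List V3} {a b c : V3} {l2 : List V3}
    (h : Arc (l1 ++ a :: c :: l2)) (hb : b ∈ segment ℝ a c) :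
    Eqv W (l1 ++ a :: c :: l2) (l1 ++ a :: b :: c :: l2) :=
  ⟨h, arc_insert_on h hb, Iso.of_eq (poly_insert_on hb).symm⟩

theorem eqv_remove_on {W : Set V3} {l1 : List V3} {a b c : V3} {l2 : List V3}
    (h : Arc (l1 ++ a :: b :: c :: l2)) (hb : b ∈ segment ℝ a c) :
    Eqv W (l1 ++ a :: b :: c :: l2) (l1 ++ a :: c :: l2) :=
  ⟨h, arc_remove_on h hb, Iso.of_eq (poly_insert_on hb)⟩

/-- Insertion of a vertex `b` across the triangle `a b c`. -/
theorem insert_tri {W : Set V3} {l1 : List V3} {a b c : V3} {l2 : List V3}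
    (hA : Arc (l1 ++ a :: c :: l2)) (hli : segment ℝ a b ∩ segment ℝ b c ⊆ {b})
    (h1 : tri a b c ∩ poly (l1 ++ [a]) ⊆ {a}) (h2 : tri a b c ∩ poly (c :: l2) ⊆ {c})
    (hW : IsOpen W) (hc : Convex ℝ W) (hb : b ∈ W) (ha : a ∈ closure W) (hcc : c ∈ closure W)
    (hac : a ∈ W ∨ c ∈ W) : Eqv W (l1 ++ a :: c :: l2) (l1 ++ a :: b :: c :: l2) := by
  refine (remove ?_ h1 h2 hW hc hb ha hcc hac).symm
  rw [arc_append, arc_cons, poly_cons, inter_union_distrib_left, union_subset_iff] at hA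
  obtain ⟨k1, ⟨k2, k3⟩, k4, k5⟩ := hA
  rw [arc_three_iff]
  refine ⟨k1, k3, hli, ?_, ?_, ?_, ?_, k5⟩
  · intro x hx
    have hxc : x = c := h2 ⟨segment_subset_tri_ab _ _ _ hx.1, hx.2⟩
    subst hxc
    exact hli ⟨hx.1, right_mem_segment _ _ _⟩
  · exact fun x hx => h2 ⟨segment_subset_tri_bc _ _ _ hx.1, hx.2⟩
  · exact fun x hx => h1 ⟨segment_subset_tri_ab _ _ _ hx.2, hx.1⟩
  · exact fun x hx => h1 ⟨segment_subset_tri_bc _ _ _ hx.2, hx.1⟩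

theorem conv_le (f : V3 →L[ℝ] ℝ) (c : ℝ) : Convex ℝ {x | f x ≤ c} :=
  convex_halfSpace_le f.toLinearMap.isLinear c
theorem conv_ge (f : V3 →L[ℝ] ℝ) (c : ℝ) : Convex ℝ {x | c ≤ f x} :=
  convex_halfSpace_ge f.toLinearMap.isLinear c
theorem conv_lt (f : V3 →L[ℝ] ℝ) (c : ℝ) : Convex ℝ {x | f x < c} :=
  convex_halfSpace_lt f.toLinearMap.isLinear c
theorem conv_gt (f : V3 →L[ℝ] ℝ) (c : ℝ) : Convex ℝ {x | c < f x} :=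
  convex_halfSpace_gt f.toLinearMap.isLinear c

theorem open_gt (f : V3 →L[ℝ] ℝ) (c : ℝ) : IsOpen {x | c < f x} :=
  isOpen_lt continuous_const f.continuous

/-- The part of `W` above level `c`. -/
def up (W : Set V3) (f : V3 →L[ℝ] ℝ) (c : ℝ) : Set V3 := W ∩ {x | c < f x}

theorem up_open {W : Set V3} (hW : IsOpen W) (f : V3 →L[ℝ] ℝ) (c : ℝ) : IsOpen (up W f c) :=
  hW.inter (open_gt f c)
theorem up_convex {W : Set V3} (hc : Convex ℝ W) (f : V3 →L[ℝ] ℝ) (c : ℝ) : Convex ℝ (up W f c) :=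
  hc.inter (conv_gt f c)
theorem up_subset (W : Set V3) (f : V3 →L[ℝ] ℝ) (c : ℝ) : up W f c ⊆ W := inter_subset_left

theorem mem_closure_up {W : Set V3} (hW : IsOpen W) (hc : Convex ℝ W) {f : V3 →L[ℝ] ℝ} {c : ℝ}
    {x y : V3} (hx : x ∈ up W f c) (hy : y ∈ closure W) (hfy : c ≤ f y) :
    y ∈ closure (up W f c) := by
  have hsub : (fun t : ℝ => t • x + (1 - t) • y) '' Ioo 0 1 ⊆ up W f c := by
    rintro _ ⟨t, ⟨h0, h1⟩, rfl⟩
    refine ⟨combo_mem hW hc hx.1 hy h0 (by linarith) (by ring), ?_⟩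
    have h2 : c < f x := hx.2
    simp only [mem_ofPred_eq, map_add, map_smul, smul_eq_mul]
    nlinarith
  apply closure_mono hsub
  have hcont : Continuous (fun t : ℝ => t • x + (1 - t) • y) := by fun_prop
  have h0 : (0 : ℝ) ∈ closure (Ioo (0 : ℝ) 1) := by
    rw [closure_Ioo (by norm_num)]; simp
  have := image_closure_subset_closure_image hcont (mem_image_of_mem _ h0)
  simpa using this

theorem seg_subset_of_closure {W : Set V3} (hW : IsOpen W) (hc : Convex ℝ W) {a u : V3}
    (ha : a ∈ closure W) (hu : u ∈ W) {x : V3} (hx : x ∈ segment ℝ a u) : x ∈ W ∨ x = a := by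
  obtain ⟨s, t, hs, ht, hst, rfl⟩ := hx
  rcases ht.eq_or_lt with rfl | h
  · right
    have : s = 1 := by linarith
    simp [this]
  · left
    rw [add_comm]
    exact combo_mem hW hc hu ha h hs (by linarith)

theorem tri_low {f : V3 →L[ℝ] ℝ} {c : ℝ} {a b u x : V3} (ha : f a = c) (hb : f b = c)
    (hu : c < f u) (hx : x ∈ tri a b u) (hfx : f x ≤ c) : x ∈ segment ℝ a b := by
  obtain ⟨α, β, γ, h1, h2, h3, hs, rfl⟩ := hx
  simp only [map_add, map_smul, smul_eq_mul, ha, hb] at hfx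
  have : γ = 0 := by
    by_contra hne
    have : 0 < γ := lt_of_le_of_ne h3 (Ne.symm hne)
    have : α = 1 - β - γ := by linarith
    subst this
    nlinarith
  subst this
  exact ⟨α, β, h1, h2, by linarith, by simp⟩

theorem tri_cone {f : V3 →L[ℝ] ℝ} {c : ℝ} {a b u z x : V3} (ha : f a = c) (hb : f b = c)
    (hz : f z = c) (hu : c < f u) (hx : x ∈ tri a b u) (hx' : x ∈ segment ℝ u z) :
    x = u ∨ z ∈ segment ℝ a b := by
  obtain ⟨α, β, γ, h1, h2, h3, hs, rfl⟩ := hx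
  obtain ⟨σ, τ, g1, g2, gs, he⟩ := hx'
  have hf := congrArg f he
  simp only [map_add, map_smul, smul_eq_mul, ha, hb, hz] at hf
  have hγ : γ = σ := by
    have : (γ - σ) * (f u - c) = 0 := by
      have h4 : α = 1 - β - γ := by linarith
      have h5 : τ = 1 - σ := by linarith
      subst h4 h5
      linarith
    rcases mul_eq_zero.1 this with h | h <;> linarith
  subst hγ
  rcases g2.eq_or_lt with h | h
  · left
    rw [← he, ← h]
    have : γ = 1 := by linarith
    simp [this]
  · right
    refine ⟨α / τ, β / τ, by positivity, by positivity, by rw [← add_div]; rw [div_eq_one_iff_eq h.ne']; linarith, ?_⟩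
    have : τ • z = α • a + β • b := by
      have := he
      rw [add_comm] at this
      exact add_right_cancel this
    rw [div_eq_inv_mul, div_eq_inv_mul, mul_smul, mul_smul, ← smul_add, ← this, smul_smul,
      inv_mul_cancel₀ h.ne', one_smul]

/-- No alternation of length four. -/
def NoAlt (q : V3 → Prop) (l : List V3) : Prop :=
  ¬ List.Sublist [true, false, true, false] (l.map (fun x => decide (q x))) ∧
  ¬ List.Sublist [false, true, false, true] (l.map (fun x => decide (q x)))

/-- The finite version of `second hull is empty`. -/
def NoH2 (l : List V3) : Prop :=
  ∀ p, ∃ f : V3 →L[ℝ] ℝ, f ≠ 0 ∧ NoAlt (fun x => f p < f x) l ∧ NoAlt (fun x => f x < f p) l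

theorem NoAlt.sub {q : V3 → Prop} {l l' : List V3} (h : NoAlt q l) (hs : List.Sublist l' l) : NoAlt q l' :=
  ⟨fun h' => h.1 (h'.trans (hs.map _)), fun h' => h.2 (h'.trans (hs.map _))⟩

theorem NoH2.sub {l l' : List V3} (h : NoH2 l) (hs : List.Sublist l' l) : NoH2 l' := fun p => by
  obtain ⟨f, hf, h1, h2⟩ := h p
  exact ⟨f, hf, h1.sub hs, h2.sub hs⟩

theorem bool_dup {L s1 s2 : List Bool} {α : Bool} (hL : L.IsChain (· ≠ ·))
    (h : List.Sublist L (s1 ++ α :: α :: s2)) : List.Sublist L (s1 ++ α :: s2) := by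
  induction s1 generalizing L with
  | nil =>
    simp only [List.nil_append] at h ⊢
    rcases List.sublist_cons_iff.1 h with h1 | ⟨r, hr, h1⟩
    · exact h1
    · subst hr
      rcases List.sublist_cons_iff.1 h1 with h2 | ⟨r', hr', h2⟩
      · exact h2.cons_cons _
      · subst hr'
        simp at hL
  | cons x s1 ih =>
    simp only [List.cons_append] at h ⊢
    rcases List.sublist_cons_iff.1 h with h1 | ⟨r, hr, h1⟩
    · exact (ih hL h1).cons _
    · subst hr
      exact (ih (List.IsChain.tail hL) h1).cons_cons _

theorem NoAlt.insert {q : V3 → Prop} {l1 l2 : List V3} {a z b : V3} (h : NoAlt q (l1 ++ a :: b :: l2))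
    (hz : (q z ↔ q a) ∨ (q z ↔ q b)) : NoAlt q (l1 ++ a :: z :: b :: l2) := by
  have key : ∀ L : List Bool, L.IsChain (· ≠ ·) →
      List.Sublist L ((l1 ++ a :: z :: b :: l2).map (fun x => decide (q x))) →
      List.Sublist L ((l1 ++ a :: b :: l2).map (fun x => decide (q x))) := by
    intro L hL hs
    simp only [List.map_append, List.map_cons] at hs ⊢
    rcases hz with hz | hz
    · simp only [hz] at hs
      exact bool_dup hL hs
    · simp only [hz] at hs
      have := bool_dup (s1 := List.map (fun x => decide (q x)) l1 ++ [decide (q a)]) hL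
        (by simpa using hs)
      simpa using this
  exact ⟨fun h' => h.1 (key _ (by decide) h'), fun h' => h.2 (key _ (by decide) h')⟩

theorem NoH2.insert {l1 l2 : List V3} {a z b : V3} (h : NoH2 (l1 ++ a :: b :: l2))
    (hz : z ∈ segment ℝ a b) : NoH2 (l1 ++ a :: z :: b :: l2) := by
  intro p
  obtain ⟨f, hf, h1, h2⟩ := h p
  refine ⟨f, hf, h1.insert ?_, h2.insert ?_⟩
  · by_cases ha : f p < f a <;> by_cases hb : f p < f b
    · left; simp only [ha, iff_true]
      exact (conv_gt f (f p)).segment_subset ha hb hz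
    · tauto
    · tauto
    · left; simp only [ha, iff_false, not_lt]
      exact (conv_le f (f p)).segment_subset (not_lt.1 ha) (not_lt.1 hb) hz
  · by_cases ha : f a < f p <;> by_cases hb : f b < f p
    · left; simp only [ha, iff_true]
      exact (conv_lt f (f p)).segment_subset ha hb hz
    · tauto
    · tauto
    · left; simp only [ha, iff_false, not_lt]
      exact (conv_ge f (f p)).segment_subset (not_lt.1 ha) (not_lt.1 hb) hz

theorem NoAlt.rev {q : V3 → Prop} {l : List V3} (h : NoAlt q l) : NoAlt q l.reverse := by
  constructor
  · intro h'
    rw [List.map_reverse] at h'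
    have := h'.reverse
    rw [List.reverse_reverse] at this
    exact h.2 (by simpa using this)
  · intro h'
    rw [List.map_reverse] at h'
    have := h'.reverse
    rw [List.reverse_reverse] at this
    exact h.1 (by simpa using this)

theorem NoH2.rev {l : List V3} (h : NoH2 l) : NoH2 l.reverse := fun p => by
  obtain ⟨f, hf, h1, h2⟩ := h p
  exact ⟨f, hf, h1.rev, h2.rev⟩

/-- Inductive claim: arcs with at most `k` interior vertices and no second hull point are
trivial in `W`. -/
def Claim (k : ℕ) : Prop := ∀ (W : Set V3) (v0 : V3) (mid : List V3) (w : V3), IsOpen W →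
  Convex ℝ W → mid ≠ [] → mid.length ≤ k → (∀ x ∈ mid, x ∈ W) → v0 ∈ closure W → w ∈ closure W →
  Arc (v0 :: (mid ++ [w])) → NoH2 (v0 :: (mid ++ [w])) →
  ∃ u ∈ W, Eqv W (v0 :: (mid ++ [w])) [v0, u, w]

theorem Claim.mono {k k' : ℕ} (h : Claim k) (hk : k' ≤ k) : Claim k' :=
  fun W v0 mid w h1 h2 h3 h4 => h W v0 mid w h1 h2 h3 (h4.trans hk)

theorem replace {W' : Set V3} {l1 M M' l2 : List V3} {a b : V3}
    (hA : Arc (l1 ++ a :: (M ++ b :: l2))) (he : Eqv W' (a :: (M ++ [b])) (a :: (M' ++ [b])))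
    (h1 : l1 = [] ∨ Disjoint (poly (l1 ++ [a])) W') (h2 : l2 = [] ∨ Disjoint (poly (b :: l2)) W')
    (hs : poly (a :: (M' ++ [b])) ⊆ W' ∪ {a, b}) :
    Eqv W' (l1 ++ a :: (M ++ b :: l2)) (l1 ++ a :: (M' ++ b :: l2)) := by
  have hA0 := hA
  have dec : ∀ N : List V3, poly (l1 ++ a :: (N ++ b :: l2)) =
      poly (l1 ++ [a]) ∪ (poly (a :: (N ++ [b])) ∪ poly (b :: l2)) := by
    intro N
    rw [poly_append]
    congr 1
    exact poly_append (a :: N) b l2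
  have hdecA : ∀ N : List V3, Arc (l1 ++ a :: (N ++ b :: l2)) ↔ Arc (l1 ++ [a]) ∧
      (Arc (a :: (N ++ [b])) ∧ Arc (b :: l2) ∧ poly (a :: (N ++ [b])) ∩ poly (b :: l2) ⊆ {b}) ∧
      poly (l1 ++ [a]) ∩ (poly (a :: (N ++ [b])) ∪ poly (b :: l2)) ⊆ {a} := by
    intro N
    rw [arc_append]
    have e1 := arc_append (a :: N) b l2
    have e2 := poly_append (a :: N) b l2
    simp only [List.cons_append] at e1 e2
    rw [e1, e2]
  rw [hdecA] at hA
  obtain ⟨k1, ⟨k2, k3, k4⟩, k5⟩ := hA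
  have hbm : b ∈ poly (b :: l2) := head_mem_poly _ _
  have ham : ∀ N : List V3, a ∈ poly (a :: (N ++ [b])) := fun N => head_mem_poly _ _
  have hbm' : ∀ N : List V3, b ∈ poly (a :: (N ++ [b])) := fun N => mem_poly (by simp)
  refine ⟨hA0, ?_, ?_⟩
  · rw [hdecA]
    refine ⟨k1, ⟨he.2.1, k3, ?_⟩, ?_⟩
    · rcases h2 with rfl | h2
      · intro x hx; simpa [poly] using hx.2
      · rintro x ⟨hx, hx'⟩
        rcases hs hx with h | rfl | rfl
        · exact absurd h (disjoint_left.1 h2 hx')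
        · exact k4 ⟨ham _, hx'⟩
        · rfl
    · rintro x ⟨hx, hx' | hx'⟩
      · rcases h1 with rfl | h1
        · simpa [poly] using hx
        · rcases hs hx' with h | rfl | rfl
          · exact absurd h (disjoint_left.1 h1 hx)
          · rfl
          · exact k5 ⟨hx, Or.inr hbm⟩
      · exact k5 ⟨hx, Or.inr hx'⟩
  · rw [dec, dec]
    have hl : ∀ N : List V3, l1 = [] →
        poly (l1 ++ [a]) ∪ (poly (a :: (N ++ [b])) ∪ poly (b :: l2)) =
          poly (a :: (N ++ [b])) ∪ poly (b :: l2) := by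
      rintro N rfl
      apply union_eq_self_of_subset_left
      simp only [List.nil_append, poly, singleton_subset_iff]
      exact Or.inl (ham N)
    have hr : ∀ N : List V3, l2 = [] →
        poly (a :: (N ++ [b])) ∪ poly (b :: l2) = poly (a :: (N ++ [b])) := by
      rintro N rfl
      apply union_eq_self_of_subset_right
      simp only [poly, singleton_subset_iff]
      exact hbm' N
    have step : Iso W' (poly (a :: (M ++ [b])) ∪ poly (b :: l2))
        (poly (a :: (M' ++ [b])) ∪ poly (b :: l2)) := by
      rcases h2 with h2 | h2
      · rw [hr _ h2, hr _ h2]; exact he.2.2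
      · exact he.2.2.union h2
    rcases h1 with h1 | h1
    · rw [hl _ h1, hl _ h1]; exact step
    · rw [union_comm, union_comm (poly (l1 ++ [a]))]
      exact step.union h1

theorem not_up_of_le {W : Set V3} {f : V3 →L[ℝ] ℝ} {c : ℝ} {l : List V3} (h : ∀ x ∈ l, f x ≤ c) :
    Disjoint (poly l) (up W f c) := by
  rw [disjoint_left]
  intro x hx hx'
  have h1 : f x ≤ c := poly_subset (conv_le f c) h hx
  have h2 : c < f x := hx'.2
  linarith

/-- Trivialize a subarc lying above level `c`. -/
theorem subarc {k : ℕ} (hk : Claim k) {W : Set V3} (hW : IsOpen W) (hc : Convex ℝ W)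
    {f : V3 →L[ℝ] ℝ} {c : ℝ} {l1 M l2 : List V3} {a b : V3}
    (hA : Arc (l1 ++ a :: (M ++ b :: l2))) (hM : M ≠ []) (hlen : M.length ≤ k)
    (hMW : ∀ x ∈ M, x ∈ W ∧ c < f x) (ha : a ∈ closure W) (hb : b ∈ closure W)
    (hfa : c ≤ f a) (hfb : c ≤ f b) (hN : NoH2 (a :: (M ++ [b])))
    (h1 : l1 = [] ∨ ∀ x ∈ l1 ++ [a], f x ≤ c) (h2 : l2 = [] ∨ ∀ x ∈ b :: l2, f x ≤ c) :
    ∃ u ∈ up W f c, Eqv (up W f c) (l1 ++ a :: (M ++ b :: l2)) (l1 ++ a :: u :: b :: l2) := by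
  obtain ⟨x0, hx0⟩ := List.exists_mem_of_ne_nil M hM
  have hx0u : x0 ∈ up W f c := hMW x0 hx0
  have ha' := mem_closure_up hW hc hx0u ha hfa
  have hb' := mem_closure_up hW hc hx0u hb hfb
  have hsub : Arc (a :: (M ++ [b])) := by
    have := ((arc_append _ _ _).1 hA).2.1
    have e1 := (arc_append (a :: M) b l2).1 this
    exact e1.1
  obtain ⟨u, hu, he⟩ := hk (up W f c) a M b (up_open hW f c) (up_convex hc f c) hM hlen hMW ha' hb'
    hsub hN
  refine ⟨u, hu, replace (M' := [u]) hA he (h1.imp id not_up_of_le) (h2.imp id not_up_of_le) ?_⟩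
  simp only [List.singleton_append, poly_cons]
  have s1 := fun x hx => seg_subset_of_closure (up_open hW f c) (up_convex hc f c) ha' hu (x := x) hx
  have s2 := fun x hx => seg_subset_of_closure (up_open hW f c) (up_convex hc f c) hb' hu (x := x) hx
  rintro x (hx | hx | hx)
  · rcases s1 x hx with h | h
    · exact Or.inl h
    · exact Or.inr (Or.inl h)
  · rw [segment_symm] at hx
    rcases s2 x hx with h | h
    · exact Or.inl h
    · exact Or.inr (Or.inr h)
  · exact Or.inr (Or.inr hx)

/-- Straighten a subarc lying above level `c`. -/
theorem straight {k : ℕ} (hk : Claim k) {W : Set V3} (hW : IsOpen W) (hc : Convex ℝ W)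
    {f : V3 →L[ℝ] ℝ} {c : ℝ} {l1 M l2 : List V3} {a b : V3}
    (hA : Arc (l1 ++ a :: (M ++ b :: l2))) (hlen : M.length ≤ k)
    (hMW : ∀ x ∈ M, x ∈ W ∧ c < f x) (ha : a ∈ closure W) (hb : b ∈ closure W)
    (hfa : c ≤ f a) (hfb : c ≤ f b) (hN : NoH2 (a :: (M ++ [b])))
    (h1 : l1 = [] ∨ ∀ x ∈ l1 ++ [a], f x ≤ c) (h2 : l2 = [] ∨ ∀ x ∈ b :: l2, f x ≤ c)
    (hab : a ∈ W ∨ b ∈ W) (hfab : c < f a ∨ c < f b) :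
    Eqv W (l1 ++ a :: (M ++ b :: l2)) (l1 ++ a :: b :: l2) := by
  by_cases hM : M = []
  · subst hM; exact Eqv.refl hA
  obtain ⟨x0, hx0⟩ := List.exists_mem_of_ne_nil M hM
  have hx0u : x0 ∈ up W f c := hMW x0 hx0
  have ha' := mem_closure_up hW hc hx0u ha hfa
  have hb' := mem_closure_up hW hc hx0u hb hfb
  obtain ⟨u, hu, he⟩ := subarc hk hW hc hA hM hlen hMW ha hb hfa hfb hN h1 h2
  refine (he.mono (up_subset W f c)).trans ?_
  have hA2 := he.2.1
  have hop : ∀ x ∈ segment ℝ a b, x ∈ up W f c ∪ {a, b} := by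
    rintro x hx
    obtain ⟨s, t, hs, ht, hst, rfl⟩ := hx
    rcases hs.eq_or_lt with rfl | hs
    · right; right
      have : t = 1 := by linarith
      simp [this]
    rcases ht.eq_or_lt with rfl | ht
    · right; left
      have : s = 1 := by linarith
      simp [this]
    left
    refine ⟨?_, ?_⟩
    · rcases hab with h | h
      · exact combo_mem hW hc h hb hs ht.le hst
      · rw [add_comm]; exact combo_mem hW hc h ha ht hs.le (by linarith)
    · simp only [mem_ofPred_eq, map_add, map_smul, smul_eq_mul]
      have : s = 1 - t := by linarith
      subst this
      rcases hfab with h | h <;> nlinarith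
  have hsub : Arc [a, u, b] := by
    have := ((arc_append _ _ _).1 hA2).2.1
    exact ((arc_append [a, u] b l2).1 this).1
  have hmid : (1/2 : ℝ) • (a + b) ∈ up W f c := by
    refine ⟨mid_mem hW hc ha hb hab, ?_⟩
    simp only [mem_ofPred_eq, map_smul, map_add, smul_eq_mul]
    rcases hfab with h | h <;> linarith
  have hr : Eqv (up W f c) [a, u, b] [a, b] := by
    refine remove_mid (l1 := []) (l2 := []) hsub ?_ ?_ (up_open hW f c) (up_convex hc f c) hu ha' hb' hmid
    · intro z hz; simpa [poly] using hz.2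
    · intro z hz; simpa [poly] using hz.2
  refine (replace (M := [u]) (M' := []) hA2 hr (h1.imp id not_up_of_le)
    (h2.imp id not_up_of_le) ?_).mono (up_subset W f c)
  simp only [List.nil_append, poly_cons]
  rintro x (hx | hx)
  · exact hop x hx
  · exact Or.inr (Or.inr hx)

theorem snoc_of_cons (v : V3) (N : List V3) : ∃ P a, v :: N = P ++ [a] ∧ ((a = v ∧ N = []) ∨ a ∈ N) := by
  rcases List.eq_nil_or_concat N with rfl | ⟨P, a, rfl⟩
  · exact ⟨[], v, by simp, Or.inl ⟨rfl, rfl⟩⟩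
  · exact ⟨v :: P, a, by simp, Or.inr (by simp)⟩

theorem cons_of_snoc (R : List V3) (w : V3) : ∃ b Q, R ++ [w] = b :: Q ∧ ((b = w ∧ R = []) ∨ b ∈ R) := by
  cases R with
  | nil => exact ⟨w, [], by simp, Or.inl ⟨rfl, rfl⟩⟩
  | cons r R => exact ⟨r, R ++ [w], by simp, Or.inr (by simp)⟩

/-- Split off a level-`c` arc part next to an apex above level `c`. -/
theorem fan {W : Set V3} (hW : IsOpen W) (hc : Convex ℝ W) {f : V3 →L[ℝ] ℝ} {c : ℝ} {Zs : List V3}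
    {l1 l2 : List V3} {a u : V3} (hA : Arc (l1 ++ a :: (Zs ++ u :: l2))) (h1 : ∀ x ∈ l1, f x ≤ c)
    (ha : f a = c) (hZ : ∀ x ∈ Zs, x ∈ W ∧ f x = c) (hu : c < f u)
    (h2 : l2 = [] ∨ ∃ z' l2', l2 = z' :: l2' ∧ f z' = c ∧ ∀ x ∈ l2', f x ≤ c)
    (haW : a ∈ closure W) (huW : u ∈ closure W) (hau : a ∈ W ∨ u ∈ W) :
    Eqv W (l1 ++ a :: (Zs ++ u :: l2)) (l1 ++ a :: u :: l2) := by
  induction Zs generalizing l1 a with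
  | nil => exact Eqv.refl hA
  | cons z Zs ih =>
    have hz := hZ z (by simp)
    have e1 : l1 ++ a :: (z :: Zs ++ u :: l2) = (l1 ++ [a]) ++ z :: (Zs ++ u :: l2) := by simp
    have e2 : (l1 ++ [a]) ++ z :: u :: l2 = l1 ++ a :: z :: u :: l2 := by simp
    have hi := ih (l1 := l1 ++ [a]) (a := z) (by rw [← e1]; exact hA)
      (by
        intro x hx
        rcases List.mem_append.1 hx with h | h
        · exact h1 x h
        · rw [List.mem_singleton.1 h, ha]) hz.2 (fun x hx => hZ x (by simp [hx]))
      (subset_closure hz.1) (Or.inl hz.1)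
    rw [← e1, e2] at hi
    refine hi.trans ?_
    have hA2 := hi.2.1
    obtain ⟨k1, k2, k3, k4, k5, k6, k7, k8⟩ := arc_three_iff.1 hA2
    have hzu : z ≠ u := by rintro rfl; linarith [hz.2]
    refine remove hA2 ?_ ?_ hW hc hz.1 haW huW hau
    · rintro x ⟨hx, hx'⟩
      have hfx : f x ≤ c := poly_subset (conv_le f c) (by
        intro y hy
        rcases List.mem_append.1 hy with h | h
        · exact h1 y h
        · rw [List.mem_singleton.1 h]; exact ha.le) hx'
      exact k6 ⟨hx', tri_low ha hz.2 hu hx hfx⟩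
    · have key : ∀ y ∈ poly (u :: l2), y ∉ segment ℝ a z := by
        intro y hy hy'
        have h := k4 ⟨hy', hy⟩
        rw [mem_singleton_iff] at h
        subst h
        exact hzu (k5 ⟨left_mem_segment ℝ _ _, hy⟩)
      rintro x ⟨hx, hx'⟩
      rcases h2 with rfl | ⟨z', l2', rfl, hz', hl⟩
      · simpa [poly] using hx'
      · have hx0 := hx'
        rw [poly_cons] at hx'
        rcases hx' with hx' | hx'
        · rcases tri_cone ha hz.2 hz' hu hx hx' with h | h
          · exact h
          · exact absurd h (key z' (mem_poly (by simp)))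
        · have hfx : f x ≤ c := poly_subset (conv_le f c) (by
            intro y hy
            rcases List.mem_cons.1 hy with rfl | h
            · exact hz'.le
            · exact hl y h) hx'
          exact absurd (tri_low ha hz.2 hu hx hfx) (key x hx0)

theorem fan_left {W : Set V3} (hW : IsOpen W) (hc : Convex ℝ W) {f : V3 →L[ℝ] ℝ} {c : ℝ} {Zs : List V3}
    {l1 l2 : List V3} {b u : V3} (hA : Arc (l1 ++ u :: (Zs ++ b :: l2))) (h2 : ∀ x ∈ l2, f x ≤ c)
    (hb : f b = c) (hZ : ∀ x ∈ Zs, x ∈ W ∧ f x = c) (hu : c < f u)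
    (h1 : l1 = [] ∨ ∃ z' l1', l1 = l1' ++ [z'] ∧ f z' = c ∧ ∀ x ∈ l1', f x ≤ c)
    (hbW : b ∈ closure W) (huW : u ∈ closure W) (hbu : b ∈ W ∨ u ∈ W) :
    Eqv W (l1 ++ u :: (Zs ++ b :: l2)) (l1 ++ u :: b :: l2) := by
  rw [← Eqv.rev_iff]
  have hA' := arc_rev hA
  have e1 : (l1 ++ u :: (Zs ++ b :: l2)).reverse =
    l2.reverse ++ b :: (Zs.reverse ++ u :: l1.reverse) := by simp
  have e2 : (l1 ++ u :: b :: l2).reverse = l2.reverse ++ b :: u :: l1.reverse := by simp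
  rw [e1] at hA' ⊢
  rw [e2]
  refine fan hW hc hA' (by simpa using h2) hb (by simpa using hZ) hu ?_ hbW huW hbu
  rcases h1 with rfl | ⟨z', l1', rfl, h, h'⟩
  · left; rfl
  · right; exact ⟨z', l1'.reverse, by simp, h, by simpa using h'⟩

theorem arc_eq_ends {a b : V3} {l : List V3} (h : Arc (a :: (l ++ [b]))) (hab : a = b) : ∀ x ∈ l, x = a := by
  induction l generalizing a with
  | nil => simp
  | cons y l ih =>
    have h' := (arc_cons a y (l ++ [b])).1 h
    have : a = y := h'.1 ⟨left_mem_segment ℝ _ _, mem_poly (by simp [hab])⟩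
    subst this
    intro x hx
    rcases List.mem_cons.1 hx with rfl | hx
    · rfl
    · exact ih h'.2 hab x hx

theorem split2 {q : V3 → Prop} {l : List V3} (h : ¬ List.Sublist [true, false] (l.map (fun x => decide (q x)))) :
    ∃ l1 l2, l = l1 ++ l2 ∧ (∀ x ∈ l1, ¬ q x) ∧ (∀ x ∈ l2, q x) := by
  induction l with
  | nil => exact ⟨[], [], by simp⟩
  | cons a l ih =>
    by_cases ha : q a
    · refine ⟨[], a :: l, by simp, by simp, ?_⟩
      intro x hx
      rcases List.mem_cons.1 hx with rfl | hx
      · exact ha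
      · by_contra hn
        apply h
        simp only [List.map_cons, ha, decide_true]
        refine List.Sublist.cons_cons _ ?_
        rw [List.singleton_sublist, List.mem_map]
        exact ⟨x, hx, by simp [hn]⟩
    · obtain ⟨l1, l2, rfl, h1, h2⟩ := ih (fun h' => h (by rw [List.map_cons]; exact h'.cons _))
      refine ⟨a :: l1, l2, by simp, ?_, h2⟩
      intro x hx
      rcases List.mem_cons.1 hx with rfl | hx
      · exact ha
      · exact h1 x hx

theorem split2' {q : V3 → Prop} {l : List V3} (h : ¬ List.Sublist [false, true] (l.map (fun x => decide (q x)))) :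
    ∃ l1 l2, l = l1 ++ l2 ∧ (∀ x ∈ l1, q x) ∧ (∀ x ∈ l2, ¬ q x) := by
  have e : [false, true] = [true, false].map (!·) := rfl
  obtain ⟨l1, l2, h0, h1, h2⟩ := split2 (q := fun x => ¬ q x) (l := l) (by
    intro h'
    apply h
    have := h'.map (!·)
    rw [List.map_map] at this
    simpa [Function.comp_def] using this)
  exact ⟨l1, l2, h0, fun x hx => not_not.1 (h1 x hx), h2⟩

theorem split3 {q : V3 → Prop} {l : List V3}
    (h : ¬ List.Sublist [true, false, true] (l.map (fun x => decide (q x)))) :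
    ∃ l1 l2 l3, l = l1 ++ (l2 ++ l3) ∧ (∀ x ∈ l1, ¬ q x) ∧ (∀ x ∈ l2, q x) ∧ (∀ x ∈ l3, ¬ q x) := by
  induction l with
  | nil => exact ⟨[], [], [], by simp⟩
  | cons a l ih =>
    by_cases ha : q a
    · have h' : ¬ List.Sublist [false, true] (l.map (fun x => decide (q x))) := by
        intro h'
        apply h
        simp only [List.map_cons, ha, decide_true]
        exact h'.cons_cons _
      obtain ⟨l1, l2, rfl, h1, h2⟩ := split2' h'
      refine ⟨[], a :: l1, l2, by simp, by simp, ?_, h2⟩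
      intro x hx
      rcases List.mem_cons.1 hx with rfl | hx
      · exact ha
      · exact h1 x hx
    · obtain ⟨l1, l2, l3, rfl, h1, h2, h3⟩ := ih (fun h' => h (by rw [List.map_cons]; exact h'.cons _))
      refine ⟨a :: l1, l2, l3, by simp, ?_, h2, h3⟩
      intro x hx
      rcases List.mem_cons.1 hx with rfl | hx
      · exact ha
      · exact h1 x hx

theorem split3' {q : V3 → Prop} {l : List V3}
    (h : ¬ List.Sublist [false, true, false] (l.map (fun x => decide (q x)))) :
    ∃ l1 l2 l3, l = l1 ++ (l2 ++ l3) ∧ (∀ x ∈ l1, q x) ∧ (∀ x ∈ l2, ¬ q x) ∧ (∀ x ∈ l3, q x) := by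
  obtain ⟨l1, l2, l3, h0, h1, h2, h3⟩ := split3 (q := fun x => ¬ q x) (l := l) (by
    intro h'
    apply h
    have := h'.map (!·)
    rw [List.map_map] at this
    simpa [Function.comp_def] using this)
  exact ⟨l1, l2, l3, h0, fun x hx => not_not.1 (h1 x hx), h2, fun x hx => not_not.1 (h3 x hx)⟩

/-- Few vertices satisfy `q`. -/
def Few (k : ℕ) (q : V3 → Prop) (l : List V3) : Prop :=
  ∀ M, List.Sublist M l → (∀ x ∈ M, q x) → M.length ≤ k

theorem Few.sub {k : ℕ} {q : V3 → Prop} {l l' : List V3} (h : Few k q l) (hs : List.Sublist l' l) :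
    Few k q l' := fun M hM hq => h M (hM.trans hs) hq

theorem few_of {k : ℕ} {q : V3 → Prop} {l : List V3} (hl : l.length ≤ k + 1) (hx : ∃ x ∈ l, ¬ q x) :
    Few k q l := by
  intro M hM hq
  by_contra hlt
  push Not at hlt
  have : M = l := hM.eq_of_length_le (by omega)
  subst this
  obtain ⟨x, hx, hx'⟩ := hx
  exact hx' (hq x hx)

theorem split_ne {W : Set V3} {Zs : List V3} {z1 z2 : V3} (hne : z1 ≠ z2) (hZ : Zs ≠ [])
    (hW : ∀ x ∈ Zs, x ∈ W) : ∃ Za Zb P x y Q, Zs = Za ++ Zb ∧ z1 :: Za = P ++ [x] ∧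
      Zb ++ [z2] = y :: Q ∧ x ≠ y ∧ (x ∈ W ∨ y ∈ W) := by
  induction Zs generalizing z1 with
  | nil => exact absurd rfl hZ
  | cons s Z ih =>
    have hs : s ∈ W := hW s (by simp)
    by_cases h : z1 = s
    · by_cases hZ' : Z = []
      · subst hZ'
        exact ⟨[s], [], [z1], s, z2, [], by simp, by simp, by simp, h ▸ hne, Or.inl hs⟩
      · obtain ⟨Za, Zb, P, x, y, Q, rfl, e1, e2, e3, e4⟩ := ih (h ▸ hne) hZ' (fun x hx => hW x (by simp [hx]))
        exact ⟨s :: Za, Zb, z1 :: P, x, y, Q, by simp, by simp [e1], e2, e3, e4⟩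
    · exact ⟨[], s :: Z, [], z1, s, Z ++ [z2], by simp, by simp, by simp, h, Or.inr hs⟩

theorem exists_up {W : Set V3} (hW : IsOpen W) {f : V3 →L[ℝ] ℝ} (hf : f ≠ 0) {c : ℝ} {x : V3} (hx : x ∈ W)
    (hfx : f x = c) : ∃ u ∈ W, c < f u := by
  obtain ⟨g, hg⟩ : ∃ g, 0 < f g := by
    by_contra hn
    push Not at hn
    apply hf
    ext g
    have h1 := hn g
    have h2 := hn (-g)
    rw [map_neg] at h2
    simp only [ContinuousLinearMap.zero_apply]
    linarith
  have hcont : Continuous (fun t : ℝ => x + t • g) := by fun_prop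
  have h0 : (fun t : ℝ => x + t • g) ⁻¹' W ∈ nhds (0 : ℝ) :=
    hcont.continuousAt.preimage_mem_nhds (by simpa using hW.mem_nhds hx)
  obtain ⟨ε, hε, hb⟩ := Metric.mem_nhds_iff.1 h0
  refine ⟨x + (ε / 2) • g, hb ?_, ?_⟩
  · rw [Metric.mem_ball, Real.dist_eq, sub_zero, abs_of_pos (by linarith)]; linarith
  · rw [map_add, map_smul, smul_eq_mul, hfx]
    have : 0 < ε / 2 * f g := by positivity
    linarith

theorem tri_swap {a b u x : V3} (h : x ∈ tri a u b) : x ∈ tri a b u := by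
  obtain ⟨α, β, γ, h1, h2, h3, hs, rfl⟩ := h
  exact ⟨α, γ, β, h1, h3, h2, by linarith, by abel⟩

/-- The cap lemma. -/
theorem cap {k : ℕ} (hk : Claim k) {W : Set V3} (hW : IsOpen W) (hc : Convex ℝ W) {f : V3 →L[ℝ] ℝ}
    (hf : f ≠ 0) {c : ℝ} {l1 inner l2 : List V3} {z1 z2 : V3}
    (hA : Arc (l1 ++ z1 :: (inner ++ z2 :: l2))) (hN : NoH2 (z1 :: (inner ++ [z2])))
    (hNA : NoAlt (fun x => c < f x) (z1 :: (inner ++ [z2]))) (hne : z1 ≠ z2) (hin : inner ≠ [])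
    (hinW : ∀ x ∈ inner, x ∈ W ∧ c ≤ f x) (hfew : Few k (fun x => c < f x) inner)
    (h1 : ∀ x ∈ l1, f x ≤ c) (h2 : ∀ x ∈ l2, f x ≤ c) (hz1 : f z1 = c) (hz2 : f z2 = c)
    (hz1W : z1 ∈ closure W) (hz2W : z2 ∈ closure W) :
    ∃ u ∈ W, c < f u ∧ Eqv W (l1 ++ z1 :: (inner ++ z2 :: l2)) (l1 ++ z1 :: u :: z2 :: l2) := by
  have hnp : ¬ List.Sublist [true, false, true] (inner.map (fun x => decide (c < f x))) := by
    intro h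
    apply hNA.2
    simp only [List.map_cons, hz1, lt_irrefl, decide_false, List.map_append]
    exact (h.trans (List.sublist_append_left _ _)).cons_cons _
  obtain ⟨Za, M, Zb, rfl, hZa, hM, hZb⟩ := split3 hnp
  -- main reduction
  suffices h : ∃ Za' Zb' u, u ∈ W ∧ c < f u ∧ (∀ x ∈ Za', x ∈ W ∧ f x = c) ∧ (∀ x ∈ Zb', x ∈ W ∧ f x = c) ∧
      Eqv W (l1 ++ z1 :: ((Za ++ (M ++ Zb)) ++ z2 :: l2)) (l1 ++ z1 :: (Za' ++ u :: (Zb' ++ z2 :: l2))) by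
    obtain ⟨Za', Zb', u, huW, hu, ha, hb, he⟩ := h
    refine ⟨u, huW, hu, he.trans ?_⟩
    have s1 := fan hW hc he.2.1 h1 hz1 ha hu (by
      right
      cases Zb' with
      | nil => exact ⟨z2, l2, by simp, hz2, h2⟩
      | cons b Zb' =>
        refine ⟨b, Zb' ++ z2 :: l2, by simp, (hb b (by simp)).2, ?_⟩
        intro x hx
        rcases List.mem_append.1 hx with hx | hx
        · exact (hb x (by simp [hx])).2.le
        · rcases List.mem_cons.1 hx with rfl | hx
          · exact hz2.le
          · exact h2 x hx) hz1W (subset_closure huW) (Or.inr huW)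
    refine s1.trans ?_
    have e1 : l1 ++ z1 :: u :: (Zb' ++ z2 :: l2) = (l1 ++ [z1]) ++ u :: (Zb' ++ z2 :: l2) := by simp
    have e2 : l1 ++ z1 :: u :: z2 :: l2 = (l1 ++ [z1]) ++ u :: z2 :: l2 := by simp
    have hA3 := s1.2.1
    rw [e1] at hA3 ⊢
    rw [e2]
    exact fan_left hW hc hA3 h2 hz2 hb hu (Or.inr ⟨z1, l1, rfl, hz1, h1⟩) hz2W (subset_closure huW) (Or.inr huW)
  have hZa' : ∀ x ∈ Za, x ∈ W ∧ f x = c := fun x hx =>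
    ⟨(hinW x (by simp [hx])).1, le_antisymm (not_lt.1 (hZa x hx)) (hinW x (by simp [hx])).2⟩
  have hZb' : ∀ x ∈ Zb, x ∈ W ∧ f x = c := fun x hx =>
    ⟨(hinW x (by simp [hx])).1, le_antisymm (not_lt.1 (hZb x hx)) (hinW x (by simp [hx])).2⟩
  by_cases hM0 : M = []
  · subst hM0
    obtain ⟨x0, hx0⟩ := List.exists_mem_of_ne_nil _ hin
    have hall : ∀ x ∈ Za ++ ([] ++ Zb), x ∈ W ∧ f x = c := by
      intro x hx
      simp only [List.nil_append, List.mem_append] at hx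
      rcases hx with hx | hx
      · exact hZa' x hx
      · exact hZb' x hx
    obtain ⟨u, huW, hu⟩ := exists_up hW hf (hall x0 hx0).1 (hall x0 hx0).2
    generalize hZs : Za ++ ([] ++ Zb) = Zs at *
    obtain ⟨Xa, Xb, P, x, y, Q, rfl, e1, e2, hxy, hxyW⟩ := split_ne hne hin (fun x hx => (hall x hx).1)
    refine ⟨Xa, Xb, u, huW, hu, fun x hx => hall x (by simp [hx]), fun x hx => hall x (by simp [hx]), ?_⟩
    have g1 : l1 ++ z1 :: ((Xa ++ Xb) ++ z2 :: l2) = (l1 ++ P) ++ x :: y :: (Q ++ l2) := by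
      have : z1 :: ((Xa ++ Xb) ++ z2 :: l2) = (z1 :: Xa) ++ ((Xb ++ [z2]) ++ l2) := by simp
      rw [this, e1, e2]; simp
    have g2 : l1 ++ z1 :: (Xa ++ u :: (Xb ++ z2 :: l2)) = (l1 ++ P) ++ x :: u :: y :: (Q ++ l2) := by
      have : z1 :: (Xa ++ u :: (Xb ++ z2 :: l2)) = (z1 :: Xa) ++ u :: ((Xb ++ [z2]) ++ l2) := by simp
      rw [this, e1, e2]; simp
    rw [g1] at hA ⊢
    rw [g2]
    have lev1 : ∀ t ∈ z1 :: Xa, f t = c ∧ t ∈ closure W := by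
      intro t ht
      rcases List.mem_cons.1 ht with rfl | ht
      · exact ⟨hz1, hz1W⟩
      · exact ⟨(hall t (by simp [ht])).2, subset_closure (hall t (by simp [ht])).1⟩
    have lev2 : ∀ t ∈ Xb ++ [z2], f t = c ∧ t ∈ closure W := by
      intro t ht
      rcases List.mem_append.1 ht with ht | ht
      · exact ⟨(hall t (by simp [ht])).2, subset_closure (hall t (by simp [ht])).1⟩
      · rw [List.mem_singleton.1 ht]; exact ⟨hz2, hz2W⟩
    rw [e1] at lev1
    rw [e2] at lev2
    have hx := lev1 x (by simp)
    have hy := lev2 y (by simp)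
    have hA' := hA
    rw [arc_append, arc_cons, poly_cons, inter_union_distrib_left, union_subset_iff] at hA'
    obtain ⟨k1, ⟨k2, k3⟩, k4, k5⟩ := hA'
    refine insert_tri hA ?_ ?_ ?_ hW hc huW hx.2 hy.2 hxyW
    · rintro p ⟨hp, hp'⟩
      rcases tri_cone hx.1 hx.1 hy.1 hu (segment_subset_tri_bc x x u hp) hp' with h | h
      · exact h
      · rw [segment_same] at h
        exact absurd h.symm hxy
    · rintro p ⟨hp, hp'⟩
      have hfp : f p ≤ c := poly_subset (conv_le f c) (by
        intro t ht
        simp only [List.mem_append] at ht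
        rcases ht with (h | h) | h
        · exact h1 t h
        · exact (lev1 t (by simp [h])).1.le
        · exact (lev1 t (by simp [List.mem_singleton.1 h])).1.le) hp'
      exact k4 ⟨hp', tri_low hx.1 hy.1 hu (tri_swap hp) hfp⟩
    · rintro p ⟨hp, hp'⟩
      have hfp : f p ≤ c := poly_subset (conv_le f c) (by
        intro t ht
        rcases List.mem_cons.1 ht with rfl | ht
        · exact hy.1.le
        · rcases List.mem_append.1 ht with h | h
          · exact (lev2 t (by simp [h])).1.le
          · exact h2 t h) hp'
      exact k2 ⟨tri_low hx.1 hy.1 hu (tri_swap hp) hfp, hp'⟩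
  · obtain ⟨P, a, e1, ha⟩ := snoc_of_cons z1 Za
    obtain ⟨b, Q, e2, hb⟩ := cons_of_snoc Zb z2
    have ha' : f a = c ∧ a ∈ closure W := by
      rcases ha with ⟨rfl, _⟩ | h
      · exact ⟨hz1, hz1W⟩
      · exact ⟨(hZa' a h).2, subset_closure (hZa' a h).1⟩
    have hb' : f b = c ∧ b ∈ closure W := by
      rcases hb with ⟨rfl, _⟩ | h
      · exact ⟨hz2, hz2W⟩
      · exact ⟨(hZb' b h).2, subset_closure (hZb' b h).1⟩
    have g1 : l1 ++ z1 :: ((Za ++ (M ++ Zb)) ++ z2 :: l2) = (l1 ++ P) ++ a :: (M ++ b :: (Q ++ l2)) := by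
      have : z1 :: ((Za ++ (M ++ Zb)) ++ z2 :: l2) = (z1 :: Za) ++ (M ++ ((Zb ++ [z2]) ++ l2)) := by simp
      rw [this, e1, e2]; simp
    have g2 : ∀ u, l1 ++ z1 :: (Za ++ u :: (Zb ++ z2 :: l2)) = (l1 ++ P) ++ a :: u :: b :: (Q ++ l2) := by
      intro u
      have : z1 :: (Za ++ u :: (Zb ++ z2 :: l2)) = (z1 :: Za) ++ u :: ((Zb ++ [z2]) ++ l2) := by simp
      rw [this, e1, e2]; simp
    have g3 : z1 :: ((Za ++ (M ++ Zb)) ++ [z2]) = P ++ (a :: (M ++ [b]) ++ Q) := by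
      have : z1 :: ((Za ++ (M ++ Zb)) ++ [z2]) = (z1 :: Za) ++ (M ++ (Zb ++ [z2])) := by simp
      rw [this, e1, e2]; simp
    rw [g1] at hA
    obtain ⟨u, hu, he⟩ := subarc hk hW hc hA hM0
      (hfew M ((List.sublist_append_left _ _).trans (List.sublist_append_right _ _)) hM)
      (fun x hx => ⟨(hinW x (by simp [hx])).1, hM x hx⟩) ha'.2 hb'.2 ha'.1.ge hb'.1.ge
      (hN.sub (by
        rw [g3]
        exact (List.sublist_append_left _ _).trans (List.sublist_append_right _ _)))
      (Or.inr (by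
        intro t ht
        have : t ∈ l1 ++ (z1 :: Za) := by rw [e1]; simpa using ht
        simp only [List.mem_append, List.mem_cons] at this
        rcases this with h | rfl | h
        · exact h1 t h
        · exact hz1.le
        · exact (hZa' t h).2.le))
      (Or.inr (by
        intro t ht
        have : t ∈ (Zb ++ [z2]) ++ l2 := by rw [e2]; simpa using ht
        simp only [List.mem_append, List.mem_singleton] at this
        rcases this with (h | rfl) | h
        · exact (hZb' t h).2.le
        · exact hz2.le
        · exact h2 t h))
    refine ⟨Za, Zb, u, hu.1, hu.2, hZa', hZb', ?_⟩
    rw [g1, g2]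
    exact he.mono (up_subset W f c)

/-- Half cap. -/
theorem halfcap {k : ℕ} (hk : Claim k) {W : Set V3} (hW : IsOpen W) (hc : Convex ℝ W) {f : V3 →L[ℝ] ℝ}
    {c : ℝ} {l1 inner : List V3} {z w : V3}
    (hA : Arc (l1 ++ z :: (inner ++ [w]))) (hN : NoH2 (z :: (inner ++ [w])))
    (hNA : NoAlt (fun x => c < f x) (z :: (inner ++ [w])))
    (hinW : ∀ x ∈ inner, x ∈ W ∧ c ≤ f x) (hfew : Few k (fun x => c < f x) inner)
    (h1 : ∀ x ∈ l1, f x ≤ c) (hz : f z = c) (hw : c < f w) (hzW : z ∈ W) (hwW : w ∈ closure W) :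
    Eqv W (l1 ++ z :: (inner ++ [w])) (l1 ++ [z, w]) := by
  have hnp : ¬ List.Sublist [true, false] (inner.map (fun x => decide (c < f x))) := by
    intro h
    apply hNA.2
    simp only [List.map_cons, hz, lt_irrefl, decide_false, List.map_append, hw, decide_true, List.map_nil]
    exact List.Sublist.cons_cons _ (h.append (List.Sublist.refl [true]))
  obtain ⟨Zs, M, rfl, hZ, hM⟩ := split2 hnp
  have hZ' : ∀ x ∈ Zs, x ∈ W ∧ f x = c := fun x hx =>
    ⟨(hinW x (by simp [hx])).1, le_antisymm (not_lt.1 (hZ x hx)) (hinW x (by simp [hx])).2⟩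
  obtain ⟨P, a, e1, ha⟩ := snoc_of_cons z Zs
  have ha' : f a = c ∧ a ∈ W := by
    rcases ha with ⟨rfl, _⟩ | h
    · exact ⟨hz, hzW⟩
    · exact ⟨(hZ' a h).2, (hZ' a h).1⟩
  have g1 : l1 ++ z :: ((Zs ++ M) ++ [w]) = (l1 ++ P) ++ a :: (M ++ w :: []) := by
    have : z :: ((Zs ++ M) ++ [w]) = (z :: Zs) ++ (M ++ [w]) := by simp
    rw [this, e1]; simp
  have g2 : l1 ++ z :: (Zs ++ w :: []) = (l1 ++ P) ++ a :: w :: [] := by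
    have : z :: (Zs ++ [w]) = (z :: Zs) ++ [w] := by simp
    rw [this, e1]; simp
  have g3 : z :: ((Zs ++ M) ++ [w]) = P ++ a :: (M ++ [w]) := by
    have : z :: ((Zs ++ M) ++ [w]) = (z :: Zs) ++ (M ++ [w]) := by simp
    rw [this, e1]; simp
  rw [g1] at hA
  have s1 := straight hk hW hc hA (hfew M (List.sublist_append_right _ _) hM)
    (fun x hx => ⟨(hinW x (by simp [hx])).1, hM x hx⟩) (subset_closure ha'.2) hwW ha'.1.ge hw.le
    (hN.sub (by rw [g3]; exact List.sublist_append_right _ _))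
    (Or.inr (by
        intro t ht
        have : t ∈ l1 ++ (z :: Zs) := by rw [e1]; simpa using ht
        simp only [List.mem_append, List.mem_cons] at this
        rcases this with h | rfl | h
        · exact h1 t h
        · exact hz.le
        · exact (hZ' t h).2.le)) (Or.inl rfl) (Or.inl ha'.2) (Or.inr hw)
  rw [← g1, ← g2] at s1
  exact s1.trans (fan hW hc s1.2.1 h1 hz hZ' hw (Or.inl rfl) (subset_closure hzW) hwW (Or.inl hzW))

theorem NoAlt.ins_gt {l1 l2 : List V3} {a z b : V3} {f : V3 →L[ℝ] ℝ} {c : ℝ}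
    (h : NoAlt (fun x => c < f x) (l1 ++ a :: b :: l2))
    (hz : z ∈ segment ℝ a b) : NoAlt (fun x => c < f x) (l1 ++ a :: z :: b :: l2) := by
  refine h.insert ?_
  by_cases ha : c < f a <;> by_cases hb : c < f b
  · left; simp only [ha, iff_true]
    exact (conv_gt f c).segment_subset ha hb hz
  · tauto
  · tauto
  · left; simp only [ha, iff_false, not_lt]
    exact (conv_le f c).segment_subset (not_lt.1 ha) (not_lt.1 hb) hz

theorem neg_q (f : V3 →L[ℝ] ℝ) (c : ℝ) : (fun x => -c < (-f) x) = (fun x => f x < c) := by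
  funext x; simp

theorem neg_q' (f : V3 →L[ℝ] ℝ) (c : ℝ) : (fun x => (-f) x < -c) = (fun x => c < f x) := by
  funext x; simp

theorem NoAlt.ins_lt {l1 l2 : List V3} {a z b : V3} {f : V3 →L[ℝ] ℝ} {c : ℝ}
    (h : NoAlt (fun x => f x < c) (l1 ++ a :: b :: l2))
    (hz : z ∈ segment ℝ a b) : NoAlt (fun x => f x < c) (l1 ++ a :: z :: b :: l2) := by
  rw [← neg_q] at h ⊢
  exact h.ins_gt hz

/-- An arc in position for the inductive claim. -/
structure Dat (W : Set V3) (v0 : V3) (mid : List V3) (w : V3) : Prop where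
  hW : IsOpen W
  hc : Convex ℝ W
  ne : mid ≠ []
  inW : ∀ x ∈ mid, x ∈ W
  cl0 : v0 ∈ closure W
  clw : w ∈ closure W
  arc : Arc (v0 :: (mid ++ [w]))
  noh : NoH2 (v0 :: (mid ++ [w]))

/-- A plane with few intersections. -/
structure Pl (f : V3 →L[ℝ] ℝ) (c : ℝ) (v0 : V3) (mid : List V3) (w : V3) : Prop where
  hf : f ≠ 0
  gt : NoAlt (fun x => c < f x) (v0 :: (mid ++ [w]))
  lt : NoAlt (fun x => f x < c) (v0 :: (mid ++ [w]))
  ex1 : ∃ x ∈ mid, f x ≤ c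
  ex2 : ∃ x ∈ mid, c ≤ f x

/-- Triviality. -/
def Tv (W : Set V3) (v0 : V3) (mid : List V3) (w : V3) : Prop :=
  ∃ u ∈ W, Eqv W (v0 :: (mid ++ [w])) [v0, u, w]

theorem rev_form (v0 : V3) (mid : List V3) (w : V3) :
    (v0 :: (mid ++ [w])).reverse = w :: (mid.reverse ++ [v0]) := by simp

theorem Dat.rev {W : Set V3} {v0 : V3} {mid : List V3} {w : V3} (h : Dat W v0 mid w) :
    Dat W w mid.reverse v0 :=
  ⟨h.hW, h.hc, by simpa using h.ne, by simpa using h.inW, h.clw, h.cl0,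
    by rw [← rev_form]; exact arc_rev h.arc, by rw [← rev_form]; exact h.noh.rev⟩

theorem Pl.rev {f : V3 →L[ℝ] ℝ} {c : ℝ} {v0 : V3} {mid : List V3} {w : V3} (h : Pl f c v0 mid w) :
    Pl f c w mid.reverse v0 :=
  ⟨h.hf, by rw [← rev_form]; exact h.gt.rev, by rw [← rev_form]; exact h.lt.rev,
    by simpa using h.ex1, by simpa using h.ex2⟩

theorem Pl.neg {f : V3 →L[ℝ] ℝ} {c : ℝ} {v0 : V3} {mid : List V3} {w : V3} (h : Pl f c v0 mid w) :
    Pl (-f) (-c) v0 mid w :=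
  ⟨by simpa using h.hf, by rw [neg_q]; exact h.lt, by rw [neg_q']; exact h.gt,
    by simpa using h.ex2, by simpa using h.ex1⟩

theorem Tv.rev {W : Set V3} {v0 : V3} {mid : List V3} {w : V3} (h : Tv W w mid.reverse v0) :
    Tv W v0 mid w := by
  obtain ⟨u, hu, he⟩ := h
  refine ⟨u, hu, ?_⟩
  rw [← Eqv.rev_iff, rev_form]
  exact he

theorem Pl.few_gt {k : ℕ} {f : V3 →L[ℝ] ℝ} {c : ℝ} {v0 : V3} {mid : List V3} {w : V3} (h : Pl f c v0 mid w)
    (hk : mid.length ≤ k + 1) : Few k (fun x => c < f x) mid :=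
  few_of hk (by obtain ⟨x, hx, hx'⟩ := h.ex1; exact ⟨x, hx, not_lt.2 hx'⟩)

theorem Pl.few_lt {k : ℕ} {f : V3 →L[ℝ] ℝ} {c : ℝ} {v0 : V3} {mid : List V3} {w : V3} (h : Pl f c v0 mid w)
    (hk : mid.length ≤ k + 1) : Few k (fun x => -c < (-f) x) mid :=
  h.neg.few_gt hk

theorem exists_level {f : V3 →L[ℝ] ℝ} {c : ℝ} {a b : V3} (ha : f a ≤ c) (hb : c ≤ f b) :
    ∃ z ∈ segment ℝ a b, f z = c := by
  rcases ha.eq_or_lt with h | h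
  · exact ⟨a, left_mem_segment ℝ _ _, h⟩
  · have hpos : 0 < f b - f a := by linarith
    refine ⟨(1 - (c - f a) / (f b - f a)) • a + ((c - f a) / (f b - f a)) • b, ⟨_, _, ?_, ?_, by ring, rfl⟩, ?_⟩
    · rw [sub_nonneg, div_le_one hpos]; linarith
    · exact div_nonneg (by linarith) hpos.le
    · simp only [map_add, map_smul, smul_eq_mul]
      field_simp
      ring

theorem ins_pt {W : Set V3} {X Y P Q : List V3} {a b z : V3} (hX : X = P ++ [a]) (hY : Y = b :: Q)
    (hz : z ∈ segment ℝ a b) : (Arc (X ++ Y) → Eqv W (X ++ Y) (X ++ z :: Y)) ∧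
      (NoH2 (X ++ Y) → NoH2 (X ++ z :: Y)) ∧
      (∀ (f : V3 →L[ℝ] ℝ) (c : ℝ), NoAlt (fun x => c < f x) (X ++ Y) → NoAlt (fun x => c < f x) (X ++ z :: Y)) ∧
      (∀ (f : V3 →L[ℝ] ℝ) (c : ℝ), NoAlt (fun x => f x < c) (X ++ Y) → NoAlt (fun x => f x < c) (X ++ z :: Y)) := by
  subst hX hY
  have e1 : (P ++ [a]) ++ b :: Q = P ++ a :: b :: Q := by simp
  have e2 : (P ++ [a]) ++ z :: b :: Q = P ++ a :: z :: b :: Q := by simp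
  rw [e1, e2]
  exact ⟨fun h => eqv_insert_on h hz, fun h => h.insert hz, fun f c h => h.ins_gt hz, fun f c h => h.ins_lt hz⟩

theorem arc_mid {l1 M l2 : List V3} {a b : V3} (h : Arc (l1 ++ a :: (M ++ b :: l2))) : Arc (a :: (M ++ [b])) :=
  ((arc_append (a :: M) b l2).1 ((arc_append _ _ _).1 h).2.1).1

theorem ne_of_first {a b x : V3} {l : List V3} (h : Arc (a :: ((x :: l) ++ [b]))) (hax : a ≠ x) : a ≠ b := by
  intro hab
  exact hax (arc_eq_ends h hab x (by simp)).symm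

theorem ne_of_last {a b x : V3} {l : List V3} (h : Arc (a :: ((l ++ [x]) ++ [b]))) (hax : x ≠ b) : a ≠ b := by
  intro hab
  exact hax ((arc_eq_ends h hab x (by simp)).trans hab)

/-- Case `v0 < c < w`. -/
theorem nonx_a {k : ℕ} (hk : Claim k) {W : Set V3} {f : V3 →L[ℝ] ℝ} {c : ℝ} {v0 : V3} {mid : List V3} {w : V3}
    (hD : Dat W v0 mid w) (hP : Pl f c v0 mid w) (hlen : mid.length ≤ k + 1) (h0 : f v0 < c) (hw : c < f w) :
    Tv W v0 mid w := by
  have hfew1 := hP.few_gt hlen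
  have hfew2 := hP.few_lt hlen
  have hnp : ¬ List.Sublist [false, true] (mid.map (fun x => decide (f x < c))) := by
    intro h
    apply hP.lt.1
    have hw' : ¬ f w < c := not_lt.2 hw.le
    simp only [List.map_cons, h0, decide_true, List.map_append, hw', decide_false, List.map_nil]
    exact List.Sublist.cons_cons _ (h.append (List.Sublist.refl [false]))
  obtain ⟨N, R, rfl, hN, hR⟩ := split2' hnp
  obtain ⟨P, a, e1, ha⟩ := snoc_of_cons v0 N
  obtain ⟨b, Q, e2, hb⟩ := cons_of_snoc R w
  have hfa : f a < c := by
    rcases ha with ⟨rfl, _⟩ | h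
    · exact h0
    · exact hN a h
  have hfb : c ≤ f b := by
    rcases hb with ⟨rfl, _⟩ | h
    · exact hw.le
    · exact not_lt.1 (hR b h)
  obtain ⟨z, hz, hfz⟩ := exists_level hfa.le hfb
  have hzW : z ∈ W := by
    rcases ha with ⟨rfl, rfl⟩ | h
    · have hbW : b ∈ W := by
        rcases hb with ⟨rfl, rfl⟩ | h
        · exact absurd rfl hD.ne
        · exact hD.inW b (by simp [h])
      rcases seg_subset_of_closure hD.hW hD.hc hD.cl0 hbW hz with h | rfl
      · exact h
      · linarith
    · have haW : a ∈ W := hD.inW a (by simp [h])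
      rcases hb with ⟨rfl, rfl⟩ | h
      · rw [segment_symm] at hz
        rcases seg_subset_of_closure hD.hW hD.hc hD.clw haW hz with h | rfl
        · exact h
        · linarith
      · exact hD.hc.segment_subset haW (hD.inW b (by simp [h])) hz
  have g1 : v0 :: ((N ++ R) ++ [w]) = (v0 :: N) ++ (R ++ [w]) := by simp
  obtain ⟨i1, i2, i3, i4⟩ := ins_pt (W := W) e1 e2 hz
  have hA := hD.arc
  have hH := hD.noh
  have hgt := hP.gt
  rw [g1] at hA hH hgt
  have s1 := i1 hA
  have g2 : (v0 :: N) ++ z :: (R ++ [w]) = [] ++ v0 :: (N ++ z :: (R ++ [w])) := by simp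
  have hH2 := i2 hH
  have hgt2 := i3 _ _ hgt
  have s2 := straight (f := -f) (c := -c) hk hD.hW hD.hc (l1 := []) (a := v0) (M := N) (b := z) (l2 := R ++ [w])
    (by rw [← g2]; exact s1.2.1)
    (hfew2 N (List.sublist_append_left _ _) (by simpa using hN))
    (fun x hx => ⟨hD.inW x (by simp [hx]), by simpa using hN x hx⟩)
    hD.cl0 (subset_closure hzW) (by simpa using h0.le) (by simpa using hfz.le)
    (hH2.sub (by
      have : (v0 :: N) ++ z :: (R ++ [w]) = (v0 :: (N ++ [z])) ++ (R ++ [w]) := by simp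
      rw [this]; exact List.sublist_append_left _ _))
    (Or.inl rfl) (Or.inr (by
      intro x hx
      simp only [List.mem_cons, List.mem_append, List.not_mem_nil, or_false] at hx
      simp only [ContinuousLinearMap.neg_apply, neg_le_neg_iff]
      rcases hx with rfl | h | rfl
      · exact hfz.ge
      · exact not_lt.1 (hR x h)
      · exact hw.le)) (Or.inr hzW) (Or.inl (by simpa using h0))
  have s3 := halfcap hk hD.hW hD.hc (f := f) (c := c) (l1 := [v0]) (z := z) (inner := R) (w := w)
    s2.2.1 (hH2.sub (List.sublist_append_right _ _)) (hgt2.sub (List.sublist_append_right _ _))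
    (fun x hx => ⟨hD.inW x (by simp [hx]), not_lt.1 (hR x hx)⟩)
    (hfew1.sub (List.sublist_append_right _ _)) (by simpa using h0.le) hfz hw hzW hD.clw
  refine ⟨z, hzW, ?_⟩
  rw [g1]
  refine s1.trans ?_
  rw [g2]
  exact s2.trans s3

theorem chain_first {v0 x w : V3} {l : List V3} (h : (v0 :: ((x :: l) ++ [w])).IsChain (· ≠ ·)) : v0 ≠ x := by
  simp only [List.cons_append, List.isChain_cons_cons] at h
  exact h.1

/-- Case `v0 = c < w`. -/
theorem nonx_b {k : ℕ} (hk : Claim k) {W : Set V3} {f : V3 →L[ℝ] ℝ} {c : ℝ} {v0 : V3} {mid : List V3} {w : V3}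
    (hD : Dat W v0 mid w) (hP : Pl f c v0 mid w) (hlen : mid.length ≤ k + 1)
    (hch : (v0 :: (mid ++ [w])).IsChain (· ≠ ·)) (h0 : f v0 = c) (hw : c < f w) :
    Tv W v0 mid w := by
  have hfew1 := hP.few_gt hlen
  have hfew2 := hP.few_lt hlen
  have hnp : ¬ List.Sublist [true, false] (mid.map (fun x => decide (c < f x))) := by
    intro h
    apply hP.gt.2
    simp only [List.map_cons, h0, lt_irrefl, decide_false, List.map_append, hw, decide_true, List.map_nil]
    exact List.Sublist.cons_cons _ (h.append (List.Sublist.refl [true]))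
  obtain ⟨X, M, rfl, hX, hM⟩ := split2 hnp
  cases X with
  | nil =>
    obtain ⟨x, hx, hx'⟩ := hP.ex1
    exact absurd (hM x (by simpa using hx)) (not_lt.2 hx')
  | cons x0 X =>
  have hv0x := chain_first hch
  obtain ⟨P, a, e1, ha⟩ := snoc_of_cons x0 X
  have haX : a ∈ x0 :: X := by rw [e1]; simp
  obtain ⟨b, Q, e2, hb⟩ := cons_of_snoc M w
  have hfa : f a ≤ c := not_lt.1 (hX a haX)
  have haW : a ∈ W := hD.inW a (List.mem_append_left _ haX)
  have hfb : c < f b := by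
    rcases hb with ⟨rfl, _⟩ | h
    · exact hw
    · exact hM b h
  have hbW : b ∈ closure W := by
    rcases hb with ⟨rfl, _⟩ | h
    · exact hD.clw
    · exact subset_closure (hD.inW b (List.mem_append_right _ h))
  obtain ⟨z, hz, hfz⟩ := exists_level hfa hfb.le
  have hzW : z ∈ W := by
    have hz' := hz
    rw [segment_symm] at hz'
    rcases seg_subset_of_closure hD.hW hD.hc hbW haW hz' with h | rfl
    · exact h
    · linarith
  have g1 : v0 :: ((x0 :: X ++ M) ++ [w]) = (v0 :: x0 :: X) ++ (M ++ [w]) := by simp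
  obtain ⟨i1, i2, i3, i4⟩ := ins_pt (W := W) (X := v0 :: x0 :: X) (P := v0 :: P) (by rw [e1]; simp) e2 hz
  have hA := hD.arc
  have hH := hD.noh
  have hlt := hP.lt
  rw [g1] at hA hH hlt
  have s1 := i1 hA
  have hH2 := i2 hH
  have hlt2 := i4 _ _ hlt
  have g2 : (v0 :: x0 :: X) ++ z :: (M ++ [w]) = [] ++ v0 :: ((x0 :: X) ++ z :: (M ++ [w])) := by simp
  have g3 : (v0 :: x0 :: X) ++ z :: (M ++ [w]) = (v0 :: ((x0 :: X) ++ [z])) ++ (M ++ [w]) := by simp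
  have hsub : List.Sublist (v0 :: ((x0 :: X) ++ [z])) ((v0 :: x0 :: X) ++ z :: (M ++ [w])) := by
    rw [g3]; exact List.sublist_append_left _ _
  have hA2 := s1.2.1
  rw [g2] at hA2
  obtain ⟨u, huW, hu, s2⟩ := cap (f := -f) (c := -c) hk hD.hW hD.hc (by simpa using hP.hf) hA2
    (hH2.sub hsub) (by rw [neg_q]; exact hlt2.sub hsub) (ne_of_first (arc_mid hA2) hv0x) (by simp)
    (fun x hx => ⟨hD.inW x (List.mem_append_left _ hx), by simpa using hX x hx⟩)
    (hfew2.sub (List.sublist_append_left _ _)) (by simp)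
    (by
      intro x hx
      simp only [ContinuousLinearMap.neg_apply, neg_le_neg_iff]
      rcases List.mem_append.1 hx with h | h
      · exact (hM x h).le
      · rw [List.mem_singleton.1 h]; exact hw.le) (by simp [h0]) (by simp [hfz]) hD.cl0 (subset_closure hzW)
  have hu' : f u < c := by simpa using hu
  have g4 : [] ++ v0 :: u :: z :: (M ++ [w]) = [v0, u] ++ z :: (M ++ w :: []) := by simp
  have hA3 := s2.2.1
  rw [g4] at hA3 s2
  have s3 := straight (f := f) (c := c) hk hD.hW hD.hc hA3 (hfew1 M (List.sublist_append_right _ _) hM)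
    (fun x hx => ⟨hD.inW x (List.mem_append_right _ hx), hM x hx⟩) (subset_closure hzW) hD.clw hfz.ge hw.le
    (hH2.sub (List.sublist_append_right _ _)) (Or.inr (by
      intro x hx
      simp only [List.cons_append, List.nil_append, List.mem_cons, List.not_mem_nil, or_false] at hx
      rcases hx with rfl | rfl | rfl
      · exact h0.le
      · exact hu'.le
      · exact hfz.le)) (Or.inl rfl) (Or.inl hzW) (Or.inr hw)
  have s4 : Eqv W ([] ++ v0 :: u :: z :: [w]) ([] ++ v0 :: z :: [w]) := by
    refine remove s3.2.1 ?_ ?_ hD.hW hD.hc huW hD.cl0 (subset_closure hzW) (Or.inr hzW)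
    · intro x hx; simpa [poly] using hx.2
    · rintro x ⟨hx, hx'⟩
      have h1 : f x ≤ c := by
        rw [tri_eq_hull] at hx
        refine convexHull_min ?_ (conv_le f c) hx
        rintro y (rfl | rfl | rfl)
        · exact h0.le
        · exact hu'.le
        · exact hfz.le
      have hx2 : x ∈ segment ℝ z w := by
        rw [poly_cons] at hx'
        rcases hx' with h | h
        · exact h
        · simp only [poly, mem_singleton_iff] at h; rw [h]; exact right_mem_segment ℝ _ _
      obtain ⟨s, t, hs, ht, hst, rfl⟩ := hx2
      simp only [map_add, map_smul, smul_eq_mul, hfz] at h1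
      have : s = 1 - t := by linarith
      subst this
      have : t = 0 := by nlinarith
      subst this
      simp
  refine ⟨z, hzW, ?_⟩
  rw [g1]
  refine s1.trans ?_
  rw [g2]
  exact s2.trans (s3.trans s4)

theorem tri_in {S : Set V3} (hS : Convex ℝ S) {a b c x : V3} (ha : a ∈ S) (hb : b ∈ S) (hc : c ∈ S)
    (hx : x ∈ tri a b c) : x ∈ S := by
  rw [tri_eq_hull] at hx
  refine convexHull_min ?_ hS hx
  rintro y (rfl | rfl | rfl) <;> assumption

theorem seg_low {f : V3 →L[ℝ] ℝ} {c : ℝ} {z w x : V3} (hz : f z = c) (hw : c < f w)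
    (hx : x ∈ segment ℝ z w) (h : f x ≤ c) : x = z := by
  obtain ⟨s, t, hs, ht, hst, rfl⟩ := hx
  simp only [map_add, map_smul, smul_eq_mul, hz] at h
  have : s = 1 - t := by linarith
  subst this
  have : t = 0 := by nlinarith
  subst this
  simp

theorem seg_high {f : V3 →L[ℝ] ℝ} {c : ℝ} {z w x : V3} (hz : f z = c) (hw : f w < c)
    (hx : x ∈ segment ℝ z w) (h : c ≤ f x) : x = z :=
  seg_low (f := -f) (c := -c) (by simp [hz]) (by simpa using hw) hx (by simpa using h)

theorem twocap {W : Set V3} (hW : IsOpen W) (hc : Convex ℝ W) {f : V3 →L[ℝ] ℝ} {c : ℝ}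
    {v0 u z u2 w : V3} (hA : Arc [v0, u, z, u2, w]) (h0 : f v0 = c) (hz : f z = c) (hw : f w = c)
    (hu : f u < c) (hu2 : c < f u2) (huW : u ∈ W) (hzW : z ∈ W) (hu2W : u2 ∈ W) (hcl : v0 ∈ closure W)
    (hn : w ∉ segment ℝ v0 z) : Eqv W [v0, u, z, u2, w] [v0, u2, w] := by
  have s1 : Eqv W ([] ++ v0 :: u :: z :: [u2, w]) ([] ++ v0 :: z :: [u2, w]) := by
    refine remove hA ?_ ?_ hW hc huW hcl (subset_closure hzW) (Or.inr hzW)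
    · intro x hx; simpa [poly] using hx.2
    · rintro x ⟨hx, hx'⟩
      have h1 : f x ≤ c := tri_in (conv_le f c) h0.le hu.le hz.le hx
      rw [poly_cons, poly_cons] at hx'
      rcases hx' with h | h | h
      · exact seg_low hz hu2 h h1
      · rw [segment_symm] at h
        have : x = w := seg_low hw hu2 h h1
        subst this
        refine absurd ?_ hn
        exact tri_low (f := -f) (c := -c) (by simp [h0]) (by simp [hz]) (by simpa using hu) (tri_swap hx)
          (by simpa using hw.ge)
      · simp only [poly, mem_singleton_iff] at h
        subst h
        refine absurd ?_ hn
        exact tri_low (f := -f) (c := -c) (by simp [h0]) (by simp [hz]) (by simpa using hu) (tri_swap hx)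
          (by simpa using hw.ge)
  refine s1.trans ?_
  exact fan hW hc (l1 := []) (Zs := [z]) (l2 := [w]) s1.2.1 (by simp) h0 (by simpa using ⟨hzW, hz⟩) hu2
    (Or.inr ⟨w, [], rfl, hw, by simp⟩) hcl (subset_closure hu2W) (Or.inr hu2W)

theorem eq_of_between {a b z : V3} (h1 : b ∈ segment ℝ a z) (h2 : a ∈ segment ℝ b z) : a = b := by
  have e1 := dist_add_dist_of_mem_segment h1
  have e2 := dist_add_dist_of_mem_segment h2
  rw [← dist_eq_zero]
  have : dist b a = dist a b := dist_comm _ _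
  have := dist_nonneg (x := a) (y := b)
  linarith

theorem chain_last {v0 y w : V3} {l : List V3} (h : (v0 :: ((l ++ [y]) ++ [w])).IsChain (· ≠ ·)) : y ≠ w := by
  have e : v0 :: ((l ++ [y]) ++ [w]) = (v0 :: l) ++ ([y] ++ [w]) := by simp
  rw [e, List.isChain_append] at h
  have := h.2.1
  simpa using this

/-- Case `v0 = c = w`, when the low part comes first. -/
theorem nonx_c1 {k : ℕ} (hk : Claim k) {W : Set V3} {f : V3 →L[ℝ] ℝ} {c : ℝ} {v0 : V3} {X Y : List V3} {w : V3}
    (hD : Dat W v0 (X ++ Y) w) (hP : Pl f c v0 (X ++ Y) w) (hlen : (X ++ Y).length ≤ k + 1)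
    (hch : (v0 :: ((X ++ Y) ++ [w])).IsChain (· ≠ ·)) (h0 : f v0 = c) (hw : f w = c)
    (hX : ∀ x ∈ X, f x ≤ c) (hY : ∀ x ∈ Y, c ≤ f x) :
    Tv W v0 (X ++ Y) w := by
  have hfew1 := hP.few_gt hlen
  have hfew2 := hP.few_lt hlen
  have hne : v0 ≠ w := by
    cases hm : X ++ Y with
    | nil => exact absurd hm hD.ne
    | cons x l =>
      have hA := hD.arc
      rw [hm] at hA hch
      exact ne_of_first hA (chain_first hch)
  by_cases hX0 : X = []
  · subst hX0
    obtain ⟨u, huW, -, he⟩ := cap (f := f) (c := c) hk hD.hW hD.hc hP.hf (l1 := []) (l2 := []) (inner := Y)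
      hD.arc hD.noh hP.gt hne hD.ne (fun x hx => ⟨hD.inW x hx, hY x hx⟩) hfew1 (by simp) (by simp) h0 hw
      hD.cl0 hD.clw
    exact ⟨u, huW, he⟩
  by_cases hY0 : Y = []
  · subst hY0
    rw [List.append_nil] at *
    obtain ⟨u, huW, -, he⟩ := cap (f := -f) (c := -c) hk hD.hW hD.hc hP.neg.hf (l1 := []) (l2 := []) (inner := X)
      hD.arc hD.noh hP.neg.gt hne hD.ne (fun x hx => ⟨hD.inW x hx, by simpa using hX x hx⟩) hfew2 (by simp) (by simp)
      (by simp [h0]) (by simp [hw]) hD.cl0 hD.clw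
    exact ⟨u, huW, he⟩
  obtain ⟨x0, X', rfl⟩ := List.exists_cons_of_ne_nil hX0
  have hv0x := chain_first (l := X' ++ Y) hch
  obtain ⟨P, a, e1, ha⟩ := snoc_of_cons x0 X'
  obtain ⟨b, Q, rfl⟩ := List.exists_cons_of_ne_nil hY0
  have haX : a ∈ x0 :: X' := by rw [e1]; simp
  have haW : a ∈ W := hD.inW a (List.mem_append_left _ haX)
  have hbW : b ∈ W := hD.inW b (by simp)
  obtain ⟨z, hz, hfz⟩ := exists_level (hX a haX) (hY b (by simp))
  have hzW : z ∈ W := hD.hc.segment_subset haW hbW hz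
  obtain ⟨Y', y, hYl⟩ : ∃ Y' y, b :: Q = Y' ++ [y] := by
    obtain ⟨P, a, e, -⟩ := snoc_of_cons b Q
    exact ⟨P, a, e⟩
  have hyw : y ≠ w := by
    have e : v0 :: ((x0 :: X' ++ b :: Q) ++ [w]) = v0 :: (((x0 :: X' ++ Y') ++ [y]) ++ [w]) := by
      rw [hYl]; simp
    rw [e] at hch
    exact chain_last hch
  generalize hYY : b :: Q = Y at *
  have g1 : v0 :: ((x0 :: X' ++ Y) ++ [w]) = (v0 :: x0 :: X') ++ (Y ++ [w]) := by simp
  obtain ⟨i1, i2, i3, i4⟩ := ins_pt (W := W) (X := v0 :: x0 :: X') (P := v0 :: P) (Y := Y ++ [w]) (b := b)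
    (Q := Q ++ [w]) (by rw [e1]; simp) (by rw [← hYY]; simp) hz
  have hA := hD.arc
  have hH := hD.noh
  have hlt := hP.lt
  have hgt := hP.gt
  rw [g1] at hA hH hlt hgt
  have s1 := i1 hA
  have hH2 := i2 hH
  have hlt2 := i4 _ _ hlt
  have hgt2 := i3 _ _ hgt
  have g2 : (v0 :: x0 :: X') ++ z :: (Y ++ [w]) = [] ++ v0 :: ((x0 :: X') ++ z :: (Y ++ [w])) := by simp
  have g3 : (v0 :: x0 :: X') ++ z :: (Y ++ [w]) = (v0 :: ((x0 :: X') ++ [z])) ++ (Y ++ [w]) := by simp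
  have hsub : List.Sublist (v0 :: ((x0 :: X') ++ [z])) ((v0 :: x0 :: X') ++ z :: (Y ++ [w])) := by
    rw [g3]; exact List.sublist_append_left _ _
  have hA2 := s1.2.1
  rw [g2] at hA2
  obtain ⟨u, huW, hu, s2⟩ := cap (f := -f) (c := -c) hk hD.hW hD.hc (by simpa using hP.hf) hA2
    (hH2.sub hsub) (by rw [neg_q]; exact hlt2.sub hsub) (ne_of_first (arc_mid hA2) hv0x) (by simp)
    (fun x hx => ⟨hD.inW x (List.mem_append_left _ hx), by simpa using hX x hx⟩)
    (hfew2.sub (List.sublist_append_left _ _)) (by simp)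
    (by
      intro x hx
      rw [neg_apply, neg_le_neg_iff]
      rcases List.mem_append.1 hx with h | h
      · exact hY x h
      · rw [List.mem_singleton.1 h]; exact hw.ge) (by simp [h0]) (by simp [hfz]) hD.cl0 (subset_closure hzW)
  have hu' : f u < c := by simpa using hu
  have g4 : [] ++ v0 :: u :: z :: (Y ++ [w]) = [v0, u] ++ z :: (Y ++ w :: []) := by simp
  have hA3 := s2.2.1
  rw [g4] at hA3 s2
  have hAz := arc_mid hA3
  obtain ⟨u2, hu2W, hu2, s3⟩ := cap (f := f) (c := c) hk hD.hW hD.hc hP.hf hA3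
    (hH2.sub (List.sublist_append_right _ _)) (hgt2.sub (List.sublist_append_right _ _))
    (by rw [hYl] at hAz; exact ne_of_last hAz hyw) hY0
    (fun x hx => ⟨hD.inW x (List.mem_append_right _ hx), hY x hx⟩)
    (hfew1.sub (List.sublist_append_right _ _)) (by simp [h0, hu'.le]) (by simp) hfz hw
    (subset_closure hzW) hD.clw
  have s13 : Eqv W (v0 :: ((x0 :: X' ++ Y) ++ [w])) [v0, u, z, u2, w] := by
    rw [g1]
    refine s1.trans ?_
    rw [g2]
    exact s2.trans s3
  by_cases hwz : w ∈ segment ℝ v0 z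
  · have hvz : v0 ∉ segment ℝ w z := fun h => hne (eq_of_between hwz h)
    refine ⟨u, huW, s13.trans ?_⟩
    rw [← Eqv.rev_iff]
    have h5 := arc_rev s13.2.1
    exact twocap (f := -f) (c := -c) hD.hW hD.hc h5 (by simp [hw]) (by simp [hfz]) (by simp [h0])
      (by simpa using hu2) (by simpa using hu') hu2W hzW huW hD.clw hvz
  · exact ⟨u2, hu2W, s13.trans (twocap hD.hW hD.hc s13.2.1 h0 hfz hw hu' hu2 huW hzW hu2W hD.cl0 hwz)⟩

theorem nonx_c {k : ℕ} (hk : Claim k) {W : Set V3} {f : V3 →L[ℝ] ℝ} {c : ℝ} {v0 : V3} {mid : List V3} {w : V3}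
    (hD : Dat W v0 mid w) (hP : Pl f c v0 mid w) (hlen : mid.length ≤ k + 1)
    (hch : (v0 :: (mid ++ [w])).IsChain (· ≠ ·)) (h0 : f v0 = c) (hw : f w = c) :
    Tv W v0 mid w := by
  have hnp : ¬ List.Sublist [true, false, true] (mid.map (fun x => decide (c < f x))) := by
    intro h
    apply hP.gt.2
    simp only [List.map_cons, h0, lt_irrefl, decide_false, List.map_append]
    exact List.Sublist.cons_cons _ (h.trans (List.sublist_append_left _ _))
  have hnp2 : ¬ List.Sublist [true, false, true] (mid.map (fun x => decide (f x < c))) := by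
    intro h
    apply hP.lt.2
    simp only [List.map_cons, h0, lt_irrefl, decide_false, List.map_append]
    exact List.Sublist.cons_cons _ (h.trans (List.sublist_append_left _ _))
  obtain ⟨A1, M, A3, rfl, h1, h2, h3⟩ := split3 hnp
  by_cases hM : M = []
  · subst hM
    have e : A1 ++ ([] ++ A3) = (A1 ++ A3) ++ [] := by simp
    rw [e] at hD hP hlen hch ⊢
    refine nonx_c1 hk hD hP hlen hch h0 hw ?_ (by simp)
    intro x hx
    rcases List.mem_append.1 hx with h | h
    · exact not_lt.1 (h1 x h)
    · exact not_lt.1 (h3 x h)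
  obtain ⟨m, hm⟩ := List.exists_mem_of_ne_nil _ hM
  by_cases hA3 : ∀ x ∈ A3, c ≤ f x
  · refine nonx_c1 hk hD hP hlen hch h0 hw (fun x hx => not_lt.1 (h1 x hx)) ?_
    intro x hx
    rcases List.mem_append.1 hx with h | h
    · exact (h2 x h).le
    · exact hA3 x h
  · push Not at hA3
    obtain ⟨y, hy, hy'⟩ := hA3
    have hA1 : ∀ x ∈ A1, c ≤ f x := by
      intro x hx
      by_contra hn
      push Not at hn
      apply hnp2
      simp only [List.map_append]
      have e : [true, false, true] = [true] ++ ([false] ++ [true]) := rfl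
      rw [e]
      refine List.Sublist.append ?_ (List.Sublist.append ?_ ?_)
      · rw [List.singleton_sublist, List.mem_map]; exact ⟨x, hx, by simp [hn]⟩
      · rw [List.singleton_sublist, List.mem_map]; exact ⟨m, hm, by simp [(h2 m hm).le]⟩
      · rw [List.singleton_sublist, List.mem_map]; exact ⟨y, hy, by simp [hy']⟩
    rw [← List.append_assoc] at *
    refine nonx_c1 (f := -f) (c := -c) hk hD hP.neg hlen hch (by simp [h0]) (by simp [hw]) ?_ ?_
    · intro x hx
      rw [neg_apply, neg_le_neg_iff]
      rcases List.mem_append.1 hx with h | h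
      · exact hA1 x h
      · exact (h2 x h).le
    · intro x hx
      rw [neg_apply, neg_le_neg_iff]
      exact not_lt.1 (h3 x hx)

theorem chain_rev {l : List V3} (h : l.IsChain (· ≠ ·)) : l.reverse.IsChain (· ≠ ·) := by
  rw [List.isChain_reverse]
  exact h.imp (fun a b hab => hab.symm)

/-- The case where the ends are not strictly on one side. -/
theorem nonx {k : ℕ} (hk : Claim k) {W : Set V3} {f : V3 →L[ℝ] ℝ} {c : ℝ} {v0 : V3} {mid : List V3} {w : V3}
    (hD : Dat W v0 mid w) (hP : Pl f c v0 mid w) (hlen : mid.length ≤ k + 1)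
    (hch : (v0 :: (mid ++ [w])).IsChain (· ≠ ·)) (hn1 : ¬ (f v0 < c ∧ f w < c)) (hn2 : ¬ (c < f v0 ∧ c < f w)) :
    Tv W v0 mid w := by
  have hch' := chain_rev hch
  rw [rev_form] at hch'
  have hlen' : mid.reverse.length ≤ k + 1 := by simpa using hlen
  rcases lt_trichotomy (f v0) c with h0 | h0 | h0 <;> rcases lt_trichotomy (f w) c with hw | hw | hw
  · exact absurd ⟨h0, hw⟩ hn1
  · exact Tv.rev (nonx_b (f := -f) (c := -c) hk hD.rev hP.rev.neg hlen' hch' (by simp [hw]) (by simpa using h0))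
  · exact nonx_a hk hD hP hlen h0 hw
  · exact nonx_b (f := -f) (c := -c) hk hD hP.neg hlen hch (by simp [h0]) (by simpa using hw)
  · exact nonx_c hk hD hP hlen hch h0 hw
  · exact nonx_b hk hD hP hlen hch h0 hw
  · exact Tv.rev (nonx_a hk hD.rev hP.rev hlen' hw h0)
  · exact Tv.rev (nonx_b hk hD.rev hP.rev hlen' hch' hw h0)
  · exact absurd ⟨h0, hw⟩ hn2

theorem poly_touch {f : V3 →L[ℝ] ℝ} {c : ℝ} {l : List V3} {z x : V3} (hl : ∀ y ∈ l, f y < c) (hz : f z = c)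
    (hx : x ∈ poly (z :: l)) (hfx : f x = c) : x = z := by
  cases l with
  | nil => simpa [poly] using hx
  | cons a l =>
    rw [poly_cons] at hx
    rcases hx with h | h
    · exact seg_high hz (hl a (by simp)) h hfx.ge
    · have : f x < c := poly_subset (conv_lt f c) hl h
      linarith

theorem poly_touch' {f : V3 →L[ℝ] ℝ} {c : ℝ} {l : List V3} {z x : V3} (hl : ∀ y ∈ l, f y < c) (hz : f z = c)
    (hx : x ∈ poly (l ++ [z])) (hfx : f x = c) : x = z := by
  rw [← poly_reverse] at hx
  rw [List.reverse_append, List.reverse_singleton, List.singleton_append] at hx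
  exact poly_touch (by simpa using hl) hz hx hfx

theorem drop_dups {W : Set V3} {l1 inner l2 : List V3} {z : V3} (hA : Arc (l1 ++ z :: (inner ++ z :: l2)))
    (h : ∀ x ∈ inner, x = z) : Eqv W (l1 ++ z :: (inner ++ z :: l2)) (l1 ++ z :: z :: l2) := by
  induction inner with
  | nil => exact Eqv.refl hA
  | cons y inner ih =>
    have hy := h y (by simp)
    subst hy
    have hr : Eqv W (l1 ++ y :: (y :: inner ++ y :: l2)) (l1 ++ y :: (inner ++ y :: l2)) := by
      cases inner with
      | nil => exact eqv_remove_on hA (left_mem_segment ℝ _ _)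
      | cons t inner => exact eqv_remove_on hA (left_mem_segment ℝ _ _)
    exact hr.trans (ih hr.2.1 (fun x hx => h x (by simp [hx])))

/-- The case where both ends are strictly below. -/
theorem xcap {k : ℕ} (hk : Claim k) {W : Set V3} {f : V3 →L[ℝ] ℝ} {c : ℝ} {v0 : V3} {mid : List V3} {w : V3}
    (hD : Dat W v0 mid w) (hP : Pl f c v0 mid w) (hlen : mid.length ≤ k + 1) (h0 : f v0 < c) (hw : f w < c) :
    ∃ L inner R z1 z2 P1 a1 b1 Q1 P2 a2 b2 Q2, mid = L ++ (inner ++ R) ∧ inner ≠ [] ∧ (∀ x ∈ L, f x < c) ∧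
      (∀ x ∈ inner, c ≤ f x) ∧ (∀ x ∈ R, f x < c) ∧ v0 :: L = P1 ++ [a1] ∧ inner = b1 :: Q1 ∧
      inner = P2 ++ [a2] ∧ R ++ [w] = b2 :: Q2 ∧ z1 ∈ segment ℝ a1 b1 ∧ z2 ∈ segment ℝ a2 b2 ∧
      f z1 = c ∧ f z2 = c ∧ z1 ∈ W ∧ z2 ∈ W ∧
      Eqv W (v0 :: (mid ++ [w])) (v0 :: (L ++ z1 :: z2 :: (R ++ [w]))) ∧
      NoH2 (v0 :: (L ++ z1 :: z2 :: (R ++ [w]))) := by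
  have hfew1 := hP.few_gt hlen
  have hnp : ¬ List.Sublist [false, true, false] (mid.map (fun x => decide (f x < c))) := by
    intro h
    apply hP.lt.1
    simp only [List.map_cons, h0, decide_true, List.map_append]
    exact List.Sublist.cons_cons _ (h.trans (List.sublist_append_left _ _))
  obtain ⟨L, inner, R, rfl, hL, hI, hR⟩ := split3' hnp
  have hin : inner ≠ [] := by
    rintro rfl
    obtain ⟨x, hx, hx'⟩ := hP.ex2
    simp only [List.nil_append, List.mem_append] at hx
    rcases hx with h | h
    · linarith [hL x h]
    · linarith [hR x h]
  obtain ⟨P1, a1, e1, ha1⟩ := snoc_of_cons v0 L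
  obtain ⟨b1, Q1, e2⟩ := List.exists_cons_of_ne_nil hin
  obtain ⟨P2, a2, e3⟩ : ∃ P2 a2, inner = P2 ++ [a2] := by
    obtain ⟨P, a, e, -⟩ := snoc_of_cons b1 Q1
    exact ⟨P, a, e2.trans e⟩
  obtain ⟨b2, Q2, e4, hb2⟩ := cons_of_snoc R w
  have hI' : ∀ x ∈ inner, x ∈ W ∧ c ≤ f x := fun x hx => ⟨hD.inW x (by simp [hx]), not_lt.1 (hI x hx)⟩
  have hb1 := hI' b1 (by simp [e2])
  have ha2 := hI' a2 (by simp [e3])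
  have ha1' : f a1 < c ∧ a1 ∈ closure W := by
    rcases ha1 with ⟨rfl, _⟩ | h
    · exact ⟨h0, hD.cl0⟩
    · exact ⟨hL a1 h, subset_closure (hD.inW a1 (by simp [h]))⟩
  have hb2' : f b2 < c ∧ b2 ∈ closure W := by
    rcases hb2 with ⟨rfl, _⟩ | h
    · exact ⟨hw, hD.clw⟩
    · exact ⟨hR b2 h, subset_closure (hD.inW b2 (by simp [h]))⟩
  obtain ⟨z1, hz1, hfz1⟩ := exists_level ha1'.1.le hb1.2
  obtain ⟨z2, hz2, hfz2⟩ := exists_level hb2'.1.le ha2.2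
  have hz1W : z1 ∈ W := by
    rcases seg_subset_of_closure hD.hW hD.hc ha1'.2 hb1.1 hz1 with h | rfl
    · exact h
    · linarith
  have hz2W : z2 ∈ W := by
    rcases seg_subset_of_closure hD.hW hD.hc hb2'.2 ha2.1 hz2 with h | rfl
    · exact h
    · linarith
  rw [segment_symm] at hz2
  have g1 : v0 :: ((L ++ (inner ++ R)) ++ [w]) = (v0 :: L) ++ (inner ++ (R ++ [w])) := by simp
  obtain ⟨i1, i2, i3, -⟩ := ins_pt (W := W) (X := v0 :: L) (Y := inner ++ (R ++ [w])) (P := P1) (a := a1) (b := b1)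
    (Q := Q1 ++ (R ++ [w])) e1 (by rw [e2]; simp) hz1
  obtain ⟨j1, j2, j3, -⟩ := ins_pt (W := W) (X := (v0 :: L) ++ z1 :: inner) (Y := R ++ [w])
    (P := (v0 :: L) ++ z1 :: P2) (a := a2) (b := b2) (Q := Q2) (by rw [e3]; simp) e4 hz2
  have hA := hD.arc
  have hH := hD.noh
  have hgt := hP.gt
  rw [g1] at hA hH hgt
  have s1 := i1 hA
  have hH1 := i2 hH
  have hgt1 := i3 _ _ hgt
  have g2 : (v0 :: L) ++ z1 :: (inner ++ (R ++ [w])) = ((v0 :: L) ++ z1 :: inner) ++ (R ++ [w]) := by simp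
  have g3 : ((v0 :: L) ++ z1 :: inner) ++ z2 :: (R ++ [w]) = (v0 :: L) ++ z1 :: (inner ++ z2 :: (R ++ [w])) := by simp
  rw [g2] at s1 hH1 hgt1
  have s2 := j1 s1.2.1
  have hH2 := j2 hH1
  have hgt2 := j3 _ _ hgt1
  rw [g3] at s2 hH2 hgt2
  have hsub : List.Sublist (z1 :: (inner ++ [z2])) ((v0 :: L) ++ z1 :: (inner ++ z2 :: (R ++ [w]))) := by
    have : (v0 :: L) ++ z1 :: (inner ++ z2 :: (R ++ [w])) =
      (v0 :: L) ++ ((z1 :: (inner ++ [z2])) ++ (R ++ [w])) := by simp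
    rw [this]
    exact (List.sublist_append_left _ _).trans (List.sublist_append_right _ _)
  have hl1 : ∀ x ∈ v0 :: L, f x < c := by
    intro x hx
    rcases List.mem_cons.1 hx with rfl | h
    · exact h0
    · exact hL x h
  have hl2 : ∀ x ∈ R ++ [w], f x < c := by
    intro x hx
    rcases List.mem_append.1 hx with h | h
    · exact hR x h
    · rw [List.mem_singleton.1 h]; exact hw
  have s3 : Eqv W ((v0 :: L) ++ z1 :: (inner ++ z2 :: (R ++ [w]))) ((v0 :: L) ++ z1 :: z2 :: (R ++ [w])) := by
    by_cases hne : z1 = z2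
    · subst hne
      exact drop_dups s2.2.1 (arc_eq_ends (arc_mid s2.2.1) rfl)
    · obtain ⟨u, huW, hu, t1⟩ := cap hk hD.hW hD.hc hP.hf s2.2.1 (hH2.sub hsub) (hgt2.sub hsub) hne hin hI'
        (hfew1.sub ((List.sublist_append_left _ _).trans (List.sublist_append_right _ _)))
        (fun x hx => (hl1 x hx).le) (fun x hx => (hl2 x hx).le) hfz1 hfz2 (subset_closure hz1W) (subset_closure hz2W)
      refine t1.trans (remove t1.2.1 ?_ ?_ hD.hW hD.hc huW (subset_closure hz1W) (subset_closure hz2W) (Or.inl hz1W))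
      · rintro x ⟨hx, hx'⟩
        have hge : c ≤ f x := tri_in (conv_ge f c) hfz1.ge hu.le hfz2.ge hx
        have hle : f x ≤ c := poly_subset (conv_le f c) (by
          intro y hy
          rcases List.mem_append.1 hy with h | h
          · exact (hl1 y h).le
          · rw [List.mem_singleton.1 h]; exact hfz1.le) hx'
        exact poly_touch' hl1 hfz1 hx' (le_antisymm hle hge)
      · rintro x ⟨hx, hx'⟩
        have hge : c ≤ f x := tri_in (conv_ge f c) hfz1.ge hu.le hfz2.ge hx
        have hle : f x ≤ c := poly_subset (conv_le f c) (by
          intro y hy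
          rcases List.mem_cons.1 hy with h | h
          · rw [h]; exact hfz2.le
          · exact (hl2 y h).le) hx'
        exact poly_touch hl2 hfz2 hx' (le_antisymm hle hge)
  refine ⟨L, inner, R, z1, z2, P1, a1, b1, Q1, P2, a2, b2, Q2, rfl, hin, hL, fun x hx => (hI' x hx).2, hR, e1, e2,
    e3, e4, hz1, hz2, hfz1, hfz2, hz1W, hz2W, ?_, ?_⟩
  · rw [g1, ← List.cons_append]
    exact s1.trans (s2.trans s3)
  · rw [← List.cons_append]
    refine hH2.sub (List.Sublist.append (List.Sublist.refl _) (List.Sublist.cons_cons _ ?_))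
    exact List.sublist_append_right _ _

theorem claim0 : Claim 0 := by
  intro W v0 mid w _ _ hne hlen
  exact absurd (List.length_eq_zero_iff.1 (Nat.le_zero.1 hlen)) hne

theorem planar {W : Set V3} {f : V3 →L[ℝ] ℝ} (hf : f ≠ 0) {c : ℝ} {v0 : V3} {mid : List V3} {w : V3}
    (hD : Dat W v0 mid w) (hne : v0 ≠ w) (h : ∀ x ∈ v0 :: (mid ++ [w]), f x = c) : Tv W v0 mid w := by
  have hno : NoAlt (fun x => c < f x) (v0 :: (mid ++ [w])) := by
    have key : ∀ L : List Bool, true ∈ L →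
        ¬ List.Sublist L ((v0 :: (mid ++ [w])).map (fun x => decide (c < f x))) := by
      intro L hL hs
      obtain ⟨x, hx, hx'⟩ := List.mem_map.1 (hs.subset hL)
      simp [h x hx] at hx'
    exact ⟨key _ (by simp), key _ (by simp)⟩
  obtain ⟨u, huW, -, he⟩ := cap (f := f) (c := c) claim0 hD.hW hD.hc hf (l1 := []) (l2 := []) (inner := mid)
    hD.arc hD.noh hno hne hD.ne (fun x hx => ⟨hD.inW x hx, (h x (by simp [hx])).ge⟩)
    (by
      intro M hM hq
      cases M with
      | nil => simp
      | cons m M =>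
        have h1 := hq m (by simp)
        have h2 := h m (by simp [hM.subset (List.mem_cons_self)])
        simp only at h1
        linarith) (by simp) (by simp) (h v0 (by simp)) (h w (by simp)) hD.cl0 hD.clw
  exact ⟨u, huW, he⟩

theorem exists_plane (a b c : V3) : ∃ f : V3 →L[ℝ] ℝ, f ≠ 0 ∧ f b = f a ∧ f c = f a := by
  have hlt : Submodule.span ℝ ({b - a, c - a} : Set V3) < ⊤ := by
    rw [lt_top_iff_ne_top]
    intro htop
    have h1 := finrank_span_le_card (R := ℝ) ({b - a, c - a} : Set V3)
    rw [htop, finrank_top] at h1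
    have h2 : Module.finrank ℝ V3 = 3 := by simp
    rw [h2] at h1
    have h3 : ({b - a, c - a} : Set V3).toFinset.card ≤ 2 := by
      simpa using Finset.card_le_two (a := b - a) (b := c - a)
    omega
  obtain ⟨g, hg, hle⟩ := Submodule.exists_le_ker_of_lt_top _ hlt
  refine ⟨LinearMap.toContinuousLinearMap g, ?_, ?_, ?_⟩
  · intro h
    apply hg
    ext x
    have := congrArg (fun F : V3 →L[ℝ] ℝ => F x) h
    simpa using this
  · have : g (b - a) = 0 := hle (Submodule.subset_span (by simp))
    rw [map_sub, sub_eq_zero] at this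
    exact this
  · have : g (c - a) = 0 := hle (Submodule.subset_span (by simp))
    rw [map_sub, sub_eq_zero] at this
    exact this

theorem level_of_seg {f : V3 →L[ℝ] ℝ} {c : ℝ} {b w x : V3} (hb : f b = c) (hx : f x = c) (hne : x ≠ b)
    (hs : x ∈ segment ℝ b w) : f w = c := by
  obtain ⟨s, t, h1, h2, hst, rfl⟩ := hs
  have ht : t ≠ 0 := by
    rintro rfl
    apply hne
    have : s = 1 := by linarith
    simp [this]
  simp only [map_add, map_smul, smul_eq_mul, hb] at hx
  have : s = 1 - t := by linarith
  subst this
  have : t * (f w - c) = 0 := by linarith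
  rcases mul_eq_zero.1 this with h | h
  · exact absurd h ht
  · linarith

theorem tri_level {f : V3 →L[ℝ] ℝ} {c : ℝ} {a b d x : V3} (ha : f a = c) (hb : f b = c) (hd : f d = c)
    (hx : x ∈ tri a b d) : f x = c :=
  le_antisymm (tri_in (conv_le f c) ha.le hb.le hd.le hx) (tri_in (conv_ge f c) ha.ge hb.ge hd.ge hx)

theorem claim2 {W : Set V3} {v0 a b w : V3} (hD : Dat W v0 [a, b] w) : Tv W v0 [a, b] w := by
  have haW := hD.inW a (by simp)
  have hbW := hD.inW b (by simp)
  have hA : Arc ([] ++ v0 :: a :: b :: [w]) := hD.arc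
  by_cases h0 : v0 = a
  · subst h0
    exact ⟨b, hbW, eqv_remove_on hA (left_mem_segment ℝ _ _)⟩
  have hne : v0 ≠ w := ne_of_first (l := [b]) hA h0
  by_cases hT : tri v0 a b ∩ segment ℝ b w ⊆ {b}
  · refine ⟨b, hbW, remove hA ?_ ?_ hD.hW hD.hc haW hD.cl0 (subset_closure hbW) (Or.inr hbW)⟩
    · intro x hx; simpa [poly] using hx.2
    · rintro x ⟨hx, hx'⟩
      rw [poly_cons] at hx'
      rcases hx' with h | h
      · exact hT ⟨hx, h⟩
      · simp only [poly, mem_singleton_iff] at h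
        exact hT ⟨hx, h ▸ right_mem_segment ℝ _ _⟩
  · rw [not_subset] at hT
    obtain ⟨x, ⟨hx, hx'⟩, hxb⟩ := hT
    obtain ⟨f, hf, e1, e2⟩ := exists_plane v0 a b
    have hw := level_of_seg e2 (tri_level rfl e1 e2 hx) hxb hx'
    refine planar hf hD hne (c := f v0) ?_
    intro y hy
    simp only [List.cons_append, List.nil_append, List.mem_cons, List.not_mem_nil, or_false] at hy
    rcases hy with rfl | rfl | rfl | rfl
    · rfl
    · exact e1
    · exact e2
    · exact hw

theorem poly_pair (a b : V3) : poly [a, b] = segment ℝ a b := by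
  rw [poly_cons]
  apply union_eq_self_of_subset_right
  simp only [poly, singleton_subset_iff]
  exact right_mem_segment ℝ _ _

theorem dup {W : Set V3} {w : V3} {mid : List V3} : ∀ {l1 : List V3} {v0 : V3}, mid ≠ [] →
    ¬ (v0 :: (mid ++ [w])).IsChain (· ≠ ·) → Arc (l1 ++ v0 :: (mid ++ [w])) →
    ∃ mid', mid'.length + 1 = mid.length ∧ List.Sublist mid' mid ∧
      Eqv W (l1 ++ v0 :: (mid ++ [w])) (l1 ++ v0 :: (mid' ++ [w])) := by
  induction mid with
  | nil => intro l1 v0 h; exact absurd rfl h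
  | cons x m ih =>
    intro l1 v0 _ hch hA
    by_cases h0 : v0 = x
    · refine ⟨m, by simp, List.sublist_cons_self _ _, ?_⟩
      obtain ⟨t, r, e, -⟩ := cons_of_snoc m w
      rw [List.cons_append, e] at hA ⊢
      exact eqv_remove_on hA (h0 ▸ left_mem_segment ℝ _ _)
    · have hch' : ¬ (x :: (m ++ [w])).IsChain (· ≠ ·) := by
        intro h
        apply hch
        rw [List.cons_append, List.isChain_cons_cons]
        exact ⟨h0, h⟩
      by_cases hm : m = []
      · subst hm
        have hxw : x = w := by simpa using hch'
        refine ⟨[], by simp, by simp, ?_⟩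
        exact eqv_remove_on hA (hxw ▸ right_mem_segment ℝ _ _)
      · have e : ∀ m : List V3, l1 ++ v0 :: (x :: m ++ [w]) = (l1 ++ [v0]) ++ x :: (m ++ [w]) := by simp
        rw [e] at hA
        obtain ⟨m', h1, h2, h3⟩ := ih hm hch' hA
        refine ⟨x :: m', by simp [h1], h2.cons_cons _, ?_⟩
        rw [e, e]
        exact h3

theorem last_pt {S : Set V3} (hS : IsClosed S) {a b q : V3} (hq : q ∈ S) (hqs : q ∈ segment ℝ a b) (hqa : q ≠ a) :
    ∃ p ∈ S, p ∈ segment ℝ a b ∧ p ≠ a ∧ S ∩ segment ℝ p b ⊆ {p} := by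
  have hcomp : IsCompact (S ∩ segment ℝ a b) := (segment_compact a b).inter_left hS
  obtain ⟨p, ⟨hpS, hps⟩, hmax⟩ := hcomp.exists_isMaxOn ⟨q, hq, hqs⟩
    (f := fun x => dist a x) (by fun_prop)
  refine ⟨p, hpS, hps, ?_, ?_⟩
  · rintro rfl
    have := hmax ⟨hq, hqs⟩
    simp only [mem_ofPred_eq, dist_self] at this
    exact hqa (dist_le_zero.1 this).symm
  · rintro x ⟨hxS, hx⟩
    have hx' : x ∈ segment ℝ a b := by rw [segment_split hps]; exact Or.inr hx
    have h1 := hmax ⟨hxS, hx'⟩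
    simp only [mem_ofPred_eq] at h1
    have h2 := dist_add_dist_of_mem_segment hps
    have h3 := dist_add_dist_of_mem_segment hx
    have h4 := dist_triangle a x b
    have : dist p x = 0 := le_antisymm (by linarith) dist_nonneg
    exact (dist_eq_zero.1 this).symm

theorem first_pt {S : Set V3} (hS : IsClosed S) {a b q : V3} (hq : q ∈ S) (hqs : q ∈ segment ℝ a b) :
    ∃ p ∈ S, p ∈ segment ℝ a b ∧ S ∩ segment ℝ a p ⊆ {p} := by
  have hcomp : IsCompact (S ∩ segment ℝ a b) := (segment_compact a b).inter_left hS
  obtain ⟨p, ⟨hpS, hps⟩, hmin⟩ := hcomp.exists_isMinOn ⟨q, hq, hqs⟩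
    (f := fun x => dist a x) (by fun_prop)
  refine ⟨p, hpS, hps, ?_⟩
  rintro x ⟨hxS, hx⟩
  have hx' : x ∈ segment ℝ a b := by rw [segment_split hps]; left; rw [segment_symm]; exact hx
  have h1 := hmin ⟨hxS, hx'⟩
  simp only [mem_ofPred_eq] at h1
  have h3 := dist_add_dist_of_mem_segment hx
  have : dist x p = 0 := le_antisymm (by linarith) dist_nonneg
  exact dist_eq_zero.1 this

theorem lasthit {S : Set V3} (hS : IsClosed S) (l : List V3) : ∀ a, S ∩ poly (a :: l) ⊆ {a} ∨
    ∃ l1 x y l2 p, a :: l = l1 ++ x :: y :: l2 ∧ p ∈ segment ℝ x y ∧ p ∈ S ∧ p ≠ x ∧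
      S ∩ poly (p :: y :: l2) ⊆ {p} := by
  induction l with
  | nil => intro a; left; intro x hx; simpa [poly] using hx.2
  | cons b l ih =>
    intro a
    rcases ih b with h | ⟨l1, x, y, l2, p, e, h1, h2, h3, h4⟩
    · by_cases hq : ∃ q ∈ S, q ∈ segment ℝ a b ∧ q ≠ a
      · obtain ⟨q, hq1, hq2, hq3⟩ := hq
        obtain ⟨p, hp1, hp2, hp3, hp4⟩ := last_pt hS hq1 hq2 hq3
        refine Or.inr ⟨[], a, b, l, p, rfl, hp2, hp1, hp3, ?_⟩
        rw [poly_cons, inter_union_distrib_left]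
        refine union_subset hp4 ?_
        intro x hx
        have hxb : x = b := h hx
        subst hxb
        exact hp4 ⟨hx.1, right_mem_segment ℝ _ _⟩
      · push Not at hq
        left
        rintro x ⟨hx, hx'⟩
        rw [poly_cons] at hx'
        rcases hx' with h' | h'
        · exact hq x hx h'
        · have hxb : x = b := h ⟨hx, h'⟩
          subst hxb
          exact hq x hx (right_mem_segment ℝ _ _)
    · exact Or.inr ⟨a :: l1, x, y, l2, p, by rw [e]; rfl, h1, h2, h3, h4⟩

theorem Dat.claim {k : ℕ} (hk : Claim k) {W : Set V3} {v0 w : V3} {mid mid' : List V3} (hD : Dat W v0 mid w)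
    (he : Eqv W (v0 :: (mid ++ [w])) (v0 :: (mid' ++ [w]))) (hne : mid' ≠ []) (hW : ∀ x ∈ mid', x ∈ W)
    (hN : NoH2 (v0 :: (mid' ++ [w]))) (hlen : mid'.length ≤ k) : Tv W v0 mid w := by
  obtain ⟨u, hu, h⟩ := hk W v0 mid' w hD.hW hD.hc hne hlen hW hD.cl0 hD.clw he.2.1 hN
  exact ⟨u, hu, he.trans h⟩

theorem Dat.claim2 {W : Set V3} {v0 w a b : V3} {mid : List V3} (hD : Dat W v0 mid w)
    (he : Eqv W (v0 :: (mid ++ [w])) [v0, a, b, w]) (ha : a ∈ W) (hb : b ∈ W)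
    (hN : NoH2 [v0, a, b, w]) : Tv W v0 mid w := by
  obtain ⟨u, hu, h⟩ := _root_.claim2 (W := W) (v0 := v0) (a := a) (b := b) (w := w)
    ⟨hD.hW, hD.hc, by simp, by simp [ha, hb], hD.cl0, hD.clw, he.2.1, hN⟩
  exact ⟨u, hu, he.trans h⟩

theorem level_unique {f : V3 →L[ℝ] ℝ} {c : ℝ} {x y p z : V3} (hx : c ≤ f x) (hy : f y < c)
    (hp : p ∈ segment ℝ x y) (hz : z ∈ segment ℝ x y) (hfp : f p = c) (hfz : f z = c) : z = p := by
  obtain ⟨s, t, h1, h2, hst, rfl⟩ := hp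
  obtain ⟨s', t', h1', h2', hst', rfl⟩ := hz
  simp only [map_add, map_smul, smul_eq_mul] at hfp hfz
  have e1 : s = 1 - t := by linarith
  have e2 : s' = 1 - t' := by linarith
  subst e1 e2
  have : (t - t') * (f y - f x) = 0 := by linarith
  rcases mul_eq_zero.1 this with h | h
  · have : t = t' := by linarith
    subst this; rfl
  · linarith

/-- Removing the beginning of the path, when `p` is the last point in the triangle. -/
theorem cleanup {k : ℕ} (hk : Claim k) {W : Set V3} {f : V3 →L[ℝ] ℝ} {c : ℝ} {v0 w v1 v2 z1 p : V3}
    {mid L R : List V3} (hD : Dat W v0 mid w)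
    (he : Eqv W (v0 :: (mid ++ [w])) (v0 :: (L ++ z1 :: p :: (R ++ [w]))))
    (hN : NoH2 (v0 :: (L ++ z1 :: p :: (R ++ [w])))) (hlen : R.length + 1 ≤ k)
    (hRW : ∀ x ∈ R, x ∈ W) (hz1W : z1 ∈ W) (hpW : p ∈ W) (hpT : p ∈ tri v0 v1 v2)
    (hT : tri v0 v1 v2 ∩ poly (p :: (R ++ [w])) ⊆ {p}) (hfp : f p = c) (hfz : f z1 = c) (h0 : f v0 < c)
    (hL : (L = [] ∧ z1 ∈ segment ℝ v0 v1) ∨ (L = [v1] ∧ v1 ∈ W ∧ f v1 < c ∧ z1 ∈ segment ℝ v1 v2)) :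
    Tv W v0 mid w := by
  have hv0T := left_mem_tri v0 v1 v2
  have hv1T := mid_mem_tri v0 v1 v2
  have main : ∀ (he : Eqv W (v0 :: (mid ++ [w])) ([] ++ v0 :: z1 :: p :: (R ++ [w]))) (hz : z1 ∈ tri v0 v1 v2),
      Tv W v0 mid w := by
    intro he hz
    have s : Eqv W ([] ++ v0 :: z1 :: p :: (R ++ [w])) ([] ++ v0 :: p :: (R ++ [w])) := by
      refine remove he.2.1 ?_ ?_ hD.hW hD.hc hz1W hD.cl0 (subset_closure hpW) (Or.inr hpW)
      · intro x hx; simpa [poly] using hx.2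
      · rintro x ⟨hx, hx'⟩
        exact hT ⟨tri_in (tri_convex _ _ _) hv0T hz hpT hx, hx'⟩
    refine hD.claim hk (mid' := p :: R) (he.trans s) (by simp) ?_ (hN.sub ?_) (by simpa using hlen)
    · intro x hx
      rcases List.mem_cons.1 hx with rfl | h
      · exact hpW
      · exact hRW x h
    · refine List.Sublist.cons_cons _ ?_
      exact (List.sublist_cons_self _ _).trans (List.sublist_append_right _ _)
  rcases hL with ⟨rfl, hz⟩ | ⟨rfl, hv1W, hf1, hz⟩
  · exact main he (segment_subset_tri_ab _ _ _ hz)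
  · have hzT : z1 ∈ tri v0 v1 v2 := segment_subset_tri_bc _ _ _ hz
    have s : Eqv W ([] ++ v0 :: v1 :: z1 :: (p :: (R ++ [w]))) ([] ++ v0 :: z1 :: (p :: (R ++ [w]))) := by
      refine remove he.2.1 ?_ ?_ hD.hW hD.hc hv1W hD.cl0 (subset_closure hz1W) (Or.inr hz1W)
      · intro x hx; simpa [poly] using hx.2
      · have key : ∀ x ∈ tri v0 v1 z1, f x = c → x = z1 := by
          intro x hx hfx
          obtain ⟨α, β, γ, h1, h2, h3, hs, rfl⟩ := hx
          simp only [map_add, map_smul, smul_eq_mul, hfz] at hfx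
          have hγ : γ = 1 - α - β := by linarith
          subst hγ
          have e : α * (c - f v0) + β * (c - f v1) = 0 := by linarith
          have hα : α = 0 := by
            have := mul_nonneg h1 (sub_pos.2 h0).le
            have := mul_nonneg h2 (sub_pos.2 hf1).le
            have : α * (c - f v0) = 0 := by linarith
            rcases mul_eq_zero.1 this with h | h
            · exact h
            · linarith
          have hβ : β = 0 := by
            rw [hα] at e
            have : β * (c - f v1) = 0 := by linarith
            rcases mul_eq_zero.1 this with h | h
            · exact h
            · linarith
          simp [hα, hβ]
        rintro x ⟨hx, hx'⟩
        rw [poly_cons] at hx'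
        rcases hx' with h | h
        · exact key x hx (le_antisymm ((conv_le f c).segment_subset hfz.le hfp.le h)
            ((conv_ge f c).segment_subset hfz.ge hfp.ge h))
        · have : x = p := hT ⟨tri_in (tri_convex _ _ _) hv0T hv1T hzT hx, h⟩
          exact key x hx (this ▸ hfp)
    exact main (he.trans s) hzT

theorem phase1_x {k : ℕ} (hk : Claim k) {W : Set V3} {f : V3 →L[ℝ] ℝ} {c : ℝ} {v0 w v1 v2 : V3} {m : List V3}
    (hD : Dat W v0 (v1 :: v2 :: m) w) (hP : Pl f c v0 (v1 :: v2 :: m) w) (hlen : (v1 :: v2 :: m).length = k + 1)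
    {l1 l2 : List V3} {x y p : V3} (e : v2 :: m = l1 ++ x :: y :: l2) (hp : p ∈ segment ℝ x y)
    (hpT : p ∈ tri v0 v1 v2) (hpx : p ≠ x) (hpv : p ≠ v2)
    (hT : tri v0 v1 v2 ∩ poly (p :: y :: (l2 ++ [w])) ⊆ {p})
    (hfp : f p = c) (h0 : f v0 < c) (hw : f w < c) : Tv W v0 (v1 :: v2 :: m) w := by
  obtain ⟨L, inner, R, z1, z2, P1, a1, b1, Q1, P2, a2, b2, Q2, em, hin, hL, hI, hR, e1, e2, e3, e4, hz1, hz2, hfz1,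
    hfz2, hz1W, hz2W, he, hN⟩ := xcap hk hD hP hlen.le h0 hw
  have hRW : ∀ t ∈ R, t ∈ W := fun t ht => hD.inW t (by rw [em]; simp [ht])
  have hLW : ∀ t ∈ L, t ∈ W := fun t ht => hD.inW t (by rw [em]; simp [ht])
  have hlens : L.length + (inner.length + R.length) = k + 1 := by
    rw [← hlen, em]; simp
  by_cases h3 : 3 ≤ inner.length
  · refine hD.claim hk (mid' := L ++ z1 :: z2 :: R) (by simpa using he) (by simp) ?_ (by simpa using hN) ?_
    · intro t ht
      simp only [List.mem_append, List.mem_cons] at ht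
      rcases ht with h | rfl | rfl | h
      · exact hLW t h
      · exact hz1W
      · exact hz2W
      · exact hRW t h
    · simp only [List.length_append, List.length_cons]; omega
  have hxy : c ≤ f x ∨ c ≤ f y := by
    by_contra hn
    push Not at hn
    have : f p < c := (conv_lt f c).segment_subset hn.1 hn.2 hp
    linarith
  have hT12 : c ≤ f v1 ∨ c ≤ f v2 := by
    by_contra hn
    push Not at hn
    have : f p < c := tri_in (conv_lt f c) h0 hn.1 hn.2 hpT
    linarith
  have hz2p : ∀ r, z2 = p → tri v0 v1 v2 ∩ poly (p :: (R ++ [w])) ⊆ {p} →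
      ((L = [] ∧ r = v1) ∨ (L = [v1] ∧ r = v2)) → r = b1 → R.length + 1 ≤ k →
      Tv W v0 (v1 :: v2 :: m) w := by
    intro r hz hTT hLL hr hRl
    subst hz
    refine cleanup hk hD he hN hRl hRW hz1W hz2W hpT hTT hfp hfz1 h0 ?_
    rcases hLL with ⟨rfl, rfl⟩ | ⟨rfl, rfl⟩
    · left
      have : a1 = v0 := by
        cases P1 with
        | nil => simpa using e1.symm
        | cons t P1 => simp at e1
      rw [← hr, this] at hz1
      exact ⟨rfl, hz1⟩
    · right
      have : a1 = v1 := by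
        cases P1 with
        | nil => simp at e1
        | cons t P1 =>
          cases P1 with
          | nil => simp at e1; exact e1.2.symm
          | cons t P1 => simp at e1
      rw [← hr, this] at hz1
      exact ⟨rfl, hLW v1 (by simp), hL v1 (by simp), hz1⟩
  -- the case `x` is the last vertex of `inner` and `y` is the next vertex
  have case_lt : a2 = x → y = b2 → R = y :: l2 → f y < c → z2 = p ∧ tri v0 v1 v2 ∩ poly (p :: (R ++ [w])) ⊆ {p} := by
    intro h1 h2 h3 h4
    subst h1 h2 h3
    exact ⟨level_unique (hI a2 (by rw [e3]; simp)) h4 hp hz2 hfp hfz2, hT⟩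
  obtain ⟨i1, rfl⟩ | ⟨i1, i2, rfl⟩ : (∃ i1, inner = [i1]) ∨ (∃ i1 i2, inner = [i1, i2]) := by
    match inner, hin, h3 with
    | [], h, _ => exact absurd rfl h
    | [a], _, _ => exact Or.inl ⟨a, rfl⟩
    | [a, b], _, _ => exact Or.inr ⟨a, b, rfl⟩
    | a :: b :: d :: l, _, h => exact absurd (by simp) h
  · have ha2 : a2 = i1 := by
      cases P2 with
      | nil => simpa using e3.symm
      | cons t P => simp at e3
    have hb1 : b1 = i1 := by simp at e2; exact e2.1.symm
    match L, em with
    | [], em =>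
      simp only [List.nil_append, List.singleton_append, List.cons.injEq] at em
      obtain ⟨rfl, rfl⟩ := em
      rw [e] at hR
      rcases hxy with h | h
      · linarith [hR x (by simp)]
      · linarith [hR y (by simp)]
    | [t], em =>
      simp only [List.singleton_append, List.cons.injEq] at em
      obtain ⟨rfl, rfl, rfl⟩ := em
      cases l1 with
      | nil =>
        simp only [List.nil_append, List.cons.injEq] at e
        obtain ⟨rfl, rfl⟩ := e
        have hy : f y < c := hR y (by simp)
        have hb2 : y = b2 := by simp at e4; exact e4.1
        obtain ⟨q1, q2⟩ := case_lt ha2 hb2 rfl hy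
        refine hz2p v2 q1 q2 (Or.inr ⟨rfl, rfl⟩) hb1.symm ?_
        simp at hlens ⊢; omega
      | cons t' l1 =>
        simp only [List.cons_append, List.cons.injEq] at e
        rw [e.2] at hR
        rcases hxy with h | h
        · linarith [hR x (by simp)]
        · linarith [hR y (by simp)]
    | t :: t' :: L, em =>
      simp only [List.cons_append, List.cons.injEq] at em
      obtain ⟨rfl, rfl, -⟩ := em
      rcases hT12 with h | h
      · linarith [hL v1 (by simp)]
      · linarith [hL v2 (by simp)]
  · have ha2 : a2 = i2 := by
      cases P2 with
      | nil => simp at e3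
      | cons t P =>
        cases P with
        | nil => simp at e3; exact e3.2.symm
        | cons t P => simp at e3
    have hb1 : b1 = i1 := by simp at e2; exact e2.1.symm
    match L, em with
    | [], em =>
      simp only [List.nil_append, List.cons_append, List.cons.injEq] at em
      obtain ⟨rfl, rfl, rfl⟩ := em
      cases l1 with
      | nil =>
        simp only [List.nil_append, List.cons.injEq] at e
        obtain ⟨rfl, rfl⟩ := e
        have hy : f y < c := hR y (by simp)
        have hb2 : y = b2 := by simp at e4; exact e4.1
        obtain ⟨q1, q2⟩ := case_lt ha2 hb2 rfl hy
        refine hz2p v1 q1 q2 (Or.inl ⟨rfl, rfl⟩) hb1.symm ?_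
        simp at hlens ⊢; omega
      | cons t' l1 =>
        simp only [List.cons_append, List.cons.injEq] at e
        rw [e.2] at hR
        rcases hxy with h | h
        · linarith [hR x (by simp)]
        · linarith [hR y (by simp)]
    | [t], em =>
      simp only [List.cons_append, List.nil_append, List.cons.injEq] at em
      obtain ⟨rfl, rfl, rfl⟩ := em
      have hf1 : f v1 < c := hL v1 (by simp)
      have hf2 : c < f v2 := by
        rcases (hI v2 (by simp)).eq_or_lt with h | h
        · exfalso
          apply hpv
          obtain ⟨α, β, γ, h1, h2, h3, hs, rfl⟩ := hpT
          simp only [map_add, map_smul, smul_eq_mul, ← h] at hfp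
          have hγ : γ = 1 - α - β := by linarith
          subst hγ
          have e : α * (c - f v0) + β * (c - f v1) = 0 := by linarith
          have t1 := mul_nonneg h1 (sub_pos.2 h0).le
          have t2 := mul_nonneg h2 (sub_pos.2 hf1).le
          have hα : α = 0 := by
            have : α * (c - f v0) = 0 := by linarith
            rcases mul_eq_zero.1 this with h | h
            · exact h
            · linarith
          have hβ : β = 0 := by
            have : β * (c - f v1) = 0 := by linarith
            rcases mul_eq_zero.1 this with h | h
            · exact h
            · linarith
          simp [hα, hβ]
        · exact h
      have hRl : R.length + 1 ≤ k := by simp at hlens; omega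
      match l1, e with
      | [], e =>
        simp only [List.nil_append, List.cons.injEq] at e
        obtain ⟨rfl, rfl, rfl⟩ := e
        have hyc : c ≤ f i2 := hI i2 (by simp)
        have hpy : p = i2 := by
          have hfy : f i2 = c := by
            by_contra hne
            have hlt : c < f i2 := lt_of_le_of_ne hyc (Ne.symm hne)
            have : c < f p := (conv_gt f c).segment_subset hf2 hlt hp
            linarith
          rw [segment_symm] at hp
          exact seg_low hfy hf2 hp hfp.le
        subst hpy
        have hb2 : f b2 < c := by
          rcases List.mem_append.1 (show b2 ∈ R ++ [w] by rw [e4]; simp) with h | h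
          · exact hR b2 h
          · rw [List.mem_singleton.1 h]; exact hw
        rw [ha2] at hz2
        have hz : z2 = p := seg_high hfp hb2 hz2 hfz2.ge
        refine hz2p v2 hz ?_ (Or.inr ⟨rfl, rfl⟩) hb1.symm hRl
        intro t ht
        exact hT ⟨ht.1, Or.inr ht.2⟩
      | [t], e =>
        simp only [List.cons_append, List.nil_append, List.cons.injEq] at e
        obtain ⟨rfl, rfl, rfl⟩ := e
        have hy : f y < c := hR y (by simp)
        have hb2 : y = b2 := by simp at e4; exact e4.1
        obtain ⟨q1, q2⟩ := case_lt ha2 hb2 rfl hy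
        exact hz2p v2 q1 q2 (Or.inr ⟨rfl, rfl⟩) hb1.symm hRl
      | t :: t' :: l1, e =>
        simp only [List.cons_append, List.cons.injEq] at e
        rw [e.2.2] at hR
        rcases hxy with h | h
        · linarith [hR x (by simp)]
        · linarith [hR y (by simp)]
    | t :: t' :: L, em =>
      simp only [List.cons_append, List.cons.injEq] at em
      obtain ⟨rfl, rfl, -⟩ := em
      rcases hT12 with h | h
      · linarith [hL v1 (by simp)]
      · linarith [hL v2 (by simp)]

theorem ex_of_seg {f : V3 →L[ℝ] ℝ} {x y p : V3} {l : List V3} (hx : x ∈ l) (hy : y ∈ l)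
    (hp : p ∈ segment ℝ x y) : (∃ t ∈ l, f t ≤ f p) ∧ (∃ t ∈ l, f p ≤ f t) := by
  constructor
  · by_contra hn
    push Not at hn
    have : f p < f p := (conv_gt f (f p)).segment_subset (hn x hx) (hn y hy) hp
    linarith
  · by_contra hn
    push Not at hn
    have : f p < f p := (conv_lt f (f p)).segment_subset (hn x hx) (hn y hy) hp
    linarith

theorem phase1 {k : ℕ} (hk : Claim k) {W : Set V3} {v0 w v1 v2 vk : V3} {m P : List V3}
    (hD : Dat W v0 (v1 :: v2 :: m) w) (hlen : (v1 :: v2 :: m).length = k + 1)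
    (hch : (v0 :: ((v1 :: v2 :: m) ++ [w])).IsChain (· ≠ ·)) (el : v2 :: m = P ++ [vk])
    (hT : tri v0 v1 v2 ∩ segment ℝ vk w ⊆ {v2}) : Tv W v0 (v1 :: v2 :: m) w := by
  have hk1 : 1 ≤ k := by simp at hlen; omega
  have hv1W := hD.inW v1 (by simp)
  have hv2W := hD.inW v2 (by simp)
  have hA : Arc ([] ++ v0 :: v1 :: v2 :: (m ++ [w])) := hD.arc
  have hpoly : poly (v2 :: (m ++ [w])) = poly (v2 :: m) ∪ segment ℝ vk w := by
    have : v2 :: (m ++ [w]) = P ++ vk :: [w] := by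
      rw [← List.cons_append, el]; simp
    rw [this, poly_append, ← el, poly_pair]
  rcases lasthit (tri_compact v0 v1 v2).isClosed m v2 with h | ⟨l1, x, y, l2, p, e, hp, hpT, hpx, hl⟩
  · have s : Eqv W ([] ++ v0 :: v1 :: v2 :: (m ++ [w])) ([] ++ v0 :: v2 :: (m ++ [w])) := by
      refine remove hA ?_ ?_ hD.hW hD.hc hv1W hD.cl0 (subset_closure hv2W) (Or.inr hv2W)
      · intro t ht; simpa [poly] using ht.2
      · rw [hpoly, inter_union_distrib_left]
        exact union_subset h hT
    refine hD.claim hk (mid' := v2 :: m) s (by simp) (fun t ht => hD.inW t (by simp [List.mem_cons.1 ht]))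
      (hD.noh.sub ?_) (by simp at hlen ⊢; omega)
    exact List.Sublist.cons_cons _ (List.sublist_cons_self _ _)
  · have hA2 : Arc (l1 ++ x :: y :: (l2 ++ [w])) := by
      have h := (arc_append [v0, v1] v2 (m ++ [w])).1 hA
      have e' : v2 :: (m ++ [w]) = l1 ++ x :: y :: (l2 ++ [w]) := by
        rw [← List.cons_append, e]; simp
      rw [← e']; exact h.2.1
    have hA3 := (arc_append _ _ _).1 hA2
    have hv2l : v2 ∈ poly (l1 ++ [x]) := by
      cases l1 with
      | nil => simp at e; simp [poly, e.1]
      | cons t l1 => simp at e; rw [e.1]; exact head_mem_poly _ _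
    have hv2 : ∀ q ∈ poly (x :: y :: (l2 ++ [w])), q = v2 → q = x := by
      rintro q hq rfl
      exact hA3.2.2 ⟨hv2l, hq⟩
    have hpv : p ≠ v2 := fun h => hpx (hv2 p (Or.inl hp) h)
    have hT' : tri v0 v1 v2 ∩ poly (p :: y :: (l2 ++ [w])) ⊆ {p} := by
      have e5 : ∃ P', y :: l2 = P' ++ [vk] := by
        obtain ⟨P', a, h5, -⟩ := snoc_of_cons y l2
        refine ⟨P', ?_⟩
        rw [h5] at e
        have : P ++ [vk] = (l1 ++ x :: P') ++ [a] := by rw [← el, e]; simp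
        rw [h5, (List.append_inj' this rfl).2]
      obtain ⟨P', e5⟩ := e5
      have e6 : poly (p :: y :: (l2 ++ [w])) = poly (p :: y :: l2) ∪ segment ℝ vk w := by
        have : p :: y :: (l2 ++ [w]) = (p :: P') ++ vk :: [w] := by
          have h9 : p :: y :: (l2 ++ [w]) = p :: ((y :: l2) ++ [w]) := by simp
          rw [h9, e5]; simp
        rw [this, poly_append, poly_pair, List.cons_append, ← e5]
      have e7 : segment ℝ vk w ⊆ poly (y :: (l2 ++ [w])) := by
        rw [← List.cons_append, e5, List.append_assoc, List.singleton_append, poly_append, poly_pair]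
        exact subset_union_right
      rw [e6, inter_union_distrib_left]
      refine union_subset hl ?_
      intro q hq
      have hq2 : q = v2 := hT hq
      have hq3 := e7 hq.2
      have hqx := hv2 q (Or.inr hq3) hq2
      have hqy : x = y := by
        rw [hqx] at hq3
        exact hA3.2.1.1 ⟨left_mem_segment ℝ _ _, hq3⟩
      rw [← hqy, segment_same] at hp
      exact absurd hp hpx
    have hxm : x ∈ v1 :: v2 :: m := by rw [e]; simp
    have hym : y ∈ v1 :: v2 :: m := by rw [e]; simp
    obtain ⟨f, hf, hgt, hlt⟩ := hD.noh p
    obtain ⟨x1, x2⟩ := ex_of_seg (f := f) hxm hym hp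
    have hPl : Pl f (f p) v0 (v1 :: v2 :: m) w := ⟨hf, hgt, hlt, x1, x2⟩
    by_cases hc1 : f v0 < f p ∧ f w < f p
    · exact phase1_x hk hD hPl hlen e hp hpT hpx hpv hT' rfl hc1.1 hc1.2
    by_cases hc2 : f p < f v0 ∧ f p < f w
    · exact phase1_x hk hD hPl.neg hlen e hp hpT hpx hpv hT' rfl (by simpa using hc2.1) (by simpa using hc2.2)
    exact nonx hk hD hPl hlen.le hch hc1 hc2

theorem tri_lone {f : V3 →L[ℝ] ℝ} {c : ℝ} {x a b y : V3} (hx : f x = c) (ha : c < f a) (hb : c < f b)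
    (hy : y ∈ tri x a b) (hfy : f y ≤ c) : y = x := by
  obtain ⟨α, β, γ, h1, h2, h3, hs, rfl⟩ := hy
  simp only [map_add, map_smul, smul_eq_mul, hx] at hfy
  have hα : α = 1 - β - γ := by linarith
  subst hα
  have t1 := mul_nonneg h2 (sub_pos.2 ha).le
  have t2 := mul_nonneg h3 (sub_pos.2 hb).le
  have e1 : β * (f a - c) = 0 := by nlinarith
  have e2 : γ * (f b - c) = 0 := by nlinarith
  have hβ : β = 0 := by
    rcases mul_eq_zero.1 e1 with h | h
    · exact h
    · linarith
  have hγ : γ = 0 := by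
    rcases mul_eq_zero.1 e2 with h | h
    · exact h
    · linarith
  simp [hβ, hγ]

theorem phase2_bad {k : ℕ} (hk : Claim k) {W : Set V3} {f : V3 →L[ℝ] ℝ} {c : ℝ} {v0 w v1 v2 vk p : V3} {m P : List V3}
    (hD : Dat W v0 (v1 :: v2 :: m) w) (hlen : (v1 :: v2 :: m).length = k + 1)
    (hch : (v0 :: ((v1 :: v2 :: m) ++ [w])).IsChain (· ≠ ·)) (el : v2 :: m = P ++ [vk])
    (hpT : p ∈ tri v0 v1 v2) (hp : p ∈ segment ℝ vk w) (hT : tri v0 v1 v2 ∩ segment ℝ vk p ⊆ {p})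
    (hfp : f p = c) (hall : ∀ x ∈ v1 :: v2 :: m, c < f x) : Tv W v0 (v1 :: v2 :: m) w := by
  have hv1W := hD.inW v1 (by simp)
  have hf1 := hall v1 (by simp)
  have hf2 := hall v2 (by simp)
  have hvkm : vk ∈ v1 :: v2 :: m := by rw [el]; simp
  have hvkW := hD.inW vk hvkm
  have hfk := hall vk hvkm
  have hA : Arc ([] ++ v0 :: v1 :: v2 :: (m ++ [w])) := hD.arc
  have hpv : p ∉ segment ℝ v0 v1 := by
    intro h
    have h1 := ((arc_cons v0 v1 (v2 :: (m ++ [w]))).1 hA).1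
    have h2 : p ∈ poly (v1 :: v2 :: (m ++ [w])) := by
      have : v1 :: v2 :: (m ++ [w]) = (v1 :: P) ++ vk :: [w] := by
        rw [← List.cons_append (a := v2), el]; simp
      rw [this, poly_append, poly_pair]
      exact Or.inr hp
    have : p = v1 := h1 ⟨h, h2⟩
    rw [this] at hfp; linarith
  have hfw : f w ≤ c := by
    by_contra hn
    push Not at hn
    have : c < f p := (conv_gt f c).segment_subset hfk hn hp
    linarith
  have hpw : f w = c → p = w := by
    intro h
    rw [segment_symm] at hp
    exact seg_low h hfk hp hfp.le
  have hf0 : f v0 < c := by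
    by_contra hn
    push Not at hn
    rcases hn.eq_or_lt with h | h
    · have := tri_lone h.symm hf1 hf2 hpT hfp.le
      exact hpv (this ▸ left_mem_segment ℝ _ _)
    · have : c < f p := tri_in (conv_gt f c) h hf1 hf2 hpT
      linarith
  obtain ⟨x, hx, hfx⟩ := exists_level hf0.le hf1.le
  have hxW : x ∈ W := by
    rcases seg_subset_of_closure hD.hW hD.hc hD.cl0 hv1W hx with h | h
    · exact h
    · rw [h] at hfx; linarith
  have hpW : p ∈ W ∨ p = w := by
    rw [segment_symm] at hp
    exact seg_subset_of_closure hD.hW hD.hc hD.clw hvkW hp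
  have hpcl : p ∈ closure W := by
    rcases hpW with h | h
    · exact subset_closure h
    · rw [h]; exact hD.clw
  have s1 : Eqv W ([] ++ v0 :: v1 :: (v2 :: (m ++ [w]))) ([] ++ v0 :: x :: v1 :: (v2 :: (m ++ [w]))) :=
    eqv_insert_on hA hx
  have n1 : NoH2 ([] ++ v0 :: x :: v1 :: (v2 :: (m ++ [w]))) := NoH2.insert (l1 := []) hD.noh hx
  obtain ⟨i1, i2, -⟩ := ins_pt (W := W) (X := v0 :: x :: v1 :: v2 :: m) (Y := [w]) (P := v0 :: x :: v1 :: P) (Q := [])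
    (a := vk) (b := w) (z := p) (by rw [el]; simp) rfl hp
  have s2 := i1 (by simpa using s1.2.1)
  have n2 := i2 (by simpa using n1)
  have s3 : Eqv W (v0 :: (v1 :: v2 :: m ++ [w])) ([v0] ++ x :: ((v1 :: v2 :: m) ++ p :: [w])) := by
    have := s1.trans (by simpa using s2)
    simpa using this
  have n3 : NoH2 ([v0] ++ x :: ((v1 :: v2 :: m) ++ p :: [w])) := by simpa using n2
  have hv1u : v1 ∈ up W f c := ⟨hv1W, hf1⟩
  have hD' : Dat (up W f c) x (v1 :: v2 :: m) p := by
    refine ⟨hD.hW.inter (open_gt f c), hD.hc.inter (conv_gt f c), by simp, fun t ht => ⟨hD.inW t ht, hall t ht⟩, 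
      mem_closure_up hD.hW hD.hc hv1u (subset_closure hxW) hfx.ge, 
      mem_closure_up hD.hW hD.hc hv1u hpcl hfp.ge, arc_mid s3.2.1, n3.sub ?_⟩
    simp
  have hch' : (x :: ((v1 :: v2 :: m) ++ [p])).IsChain (· ≠ ·) := by
    rw [← List.cons_append, List.isChain_append]
    refine ⟨?_, by simp, ?_⟩
    · rw [← List.cons_append, List.isChain_append] at hch
      have h1 := hch.1
      rw [List.isChain_cons_cons] at h1 ⊢
      exact ⟨fun h => by rw [← h] at hf1; linarith, h1.2⟩
    · intro t ht t' ht'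
      rw [List.getLast?_cons_cons] at ht
      have h1 := hall t (List.mem_of_getLast? ht)
      simp at ht'
      intro h
      rw [h, ← ht'] at h1
      linarith
  obtain ⟨u, hu, he⟩ := phase1 hk hD' hlen hch' el (by
    rintro y ⟨hy, hy'⟩
    have hyT : y ∈ tri v0 v1 v2 :=
      tri_in (tri_convex _ _ _) (segment_subset_tri_ab _ _ _ hx) (mid_mem_tri _ _ _) (right_mem_tri _ _ _) hy
    have hyp : y = p := hT ⟨hyT, hy'⟩
    rw [hyp] at hy
    have := tri_lone hfx hf1 hf2 hy hfp.le
    exact absurd (this ▸ hx) hpv)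
  have s4 := replace (M' := [u]) (l1 := [v0]) (l2 := [w]) s3.2.1 he (Or.inr ?_) (Or.inr ?_) ?_
  · have s4' : Eqv W _ ([v0] ++ x :: u :: p :: [w]) := s4.mono inter_subset_left
    have s5 : Eqv W ([v0] ++ x :: u :: p :: [w]) ([v0] ++ x :: p :: [w]) := by
      refine remove s4'.2.1 ?_ ?_ hD.hW hD.hc hu.1 (subset_closure hxW) hpcl (Or.inl hxW)
      · rintro y ⟨hy, hy'⟩
        rw [List.singleton_append, poly_pair] at hy'
        have h1 : f y ≤ c := (conv_le f c).segment_subset hf0.le hfx.le hy'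
        have h2 := tri_low hfx hfp hu.2 (tri_swap hy) h1
        rw [segment_symm] at hy'
        exact seg_high hfx hf0 hy' ((conv_ge f c).segment_subset hfx.ge hfp.ge h2)
      · rintro y ⟨hy, hy'⟩
        rw [poly_pair] at hy'
        rcases hfw.eq_or_lt with h | h
        · rw [← hpw h, segment_same] at hy'; exact hy'
        · have h1 : f y ≤ c := (conv_le f c).segment_subset hfp.le hfw hy'
          have h2 := tri_low hfx hfp hu.2 (tri_swap hy) h1
          exact seg_high hfp h hy' ((conv_ge f c).segment_subset hfx.ge hfp.ge h2)
    have s6 : Eqv W (v0 :: (v1 :: v2 :: m ++ [w])) [v0, x, p, w] := s3.trans (s4'.trans s5)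
    rcases hpW with h | h
    · refine hD.claim2 s6 hxW h (n3.sub ?_)
      exact List.Sublist.cons_cons _ (List.Sublist.cons_cons _ (List.sublist_append_right _ _))
    · subst h
      refine ⟨x, hxW, s6.trans ?_⟩
      exact eqv_remove_on (l1 := [v0]) (l2 := []) s6.2.1 (right_mem_segment ℝ _ _)
  · rw [Set.disjoint_left]
    intro y hy hy'
    rw [List.singleton_append, poly_pair] at hy
    have h1 : f y ≤ c := (conv_le f c).segment_subset hf0.le hfx.le hy
    exact absurd hy'.2 (not_lt.2 h1)
  · rw [Set.disjoint_left]
    intro y hy hy'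
    rw [poly_pair] at hy
    have h1 : f y ≤ c := (conv_le f c).segment_subset hfp.le hfw hy
    exact absurd hy'.2 (not_lt.2 h1)
  · intro y hy
    have hy : y ∈ poly (x :: [u, p]) := hy
    rw [poly_cons, poly_pair] at hy
    rcases hy with h | h
    · rcases seg_subset_of_closure hD'.hW hD'.hc hD'.cl0 hu h with h | h
      · exact Or.inl h
      · right; left; exact h
    · rw [segment_symm] at h
      rcases seg_subset_of_closure hD'.hW hD'.hc hD'.clw hu h with h | h
      · exact Or.inl h
      · right; right; exact h

theorem phase2_x {k : ℕ} (hk : Claim k) {W : Set V3} {f : V3 →L[ℝ] ℝ} {c : ℝ} {v0 w v1 v2 vk p : V3} {m P : List V3}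
    (hD : Dat W v0 (v1 :: v2 :: m) w) (hP : Pl f c v0 (v1 :: v2 :: m) w) (hlen : (v1 :: v2 :: m).length = k + 1)
    (hch : (v0 :: ((v1 :: v2 :: m) ++ [w])).IsChain (· ≠ ·)) (el : v2 :: m = P ++ [vk])
    (hpT : p ∈ tri v0 v1 v2) (hp : p ∈ segment ℝ vk w) 
    (hfp : f p = c) (h0 : f v0 < c) (hw : f w < c) : Tv W v0 (v1 :: v2 :: m) w := by
  obtain ⟨L, inner, R, z1, z2, P1, a1, b1, Q1, P2, a2, b2, Q2, em, hin, hL, hI, hR, e1, e2, e3, e4, hz1, hz2, hfz1,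
    hfz2, hz1W, hz2W, he, hN⟩ := xcap hk hD hP hlen.le h0 hw
  have hfk : c ≤ f vk := by
    by_contra hn
    push Not at hn
    have : f p < c := (conv_lt f c).segment_subset hn hw hp
    linarith
  have hT12 : c ≤ f v1 ∨ c ≤ f v2 := by
    by_contra hn
    push Not at hn
    have : f p < c := tri_in (conv_lt f c) h0 hn.1 hn.2 hpT
    linarith
  have hRn : R = [] := by
    by_contra hn
    obtain ⟨R', r, rfl⟩ : ∃ R' r, R = R' ++ [r] := ⟨R.dropLast, R.getLast hn, (List.dropLast_append_getLast hn).symm⟩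
    have : (v1 :: P) ++ [vk] = (L ++ (inner ++ R')) ++ [r] := by
      rw [List.cons_append, ← el, em]; simp
    have h := (List.append_inj' this rfl).2
    simp at h
    have := hR r (by simp)
    rw [← h] at this; linarith
  subst hRn
  have ha2 : a2 = vk := by
    have : (v1 :: P) ++ [vk] = (L ++ P2) ++ [a2] := by
      rw [List.cons_append, ← el, em, e3]; simp
    have h := (List.append_inj' this rfl).2
    simp at h
    exact h.symm
  have hb2 : b2 = w := by simp at e4; exact e4.1.symm
  subst ha2 hb2
  have hz2p : z2 = p := level_unique hfk hw hp hz2 hfp hfz2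
  subst hz2p
  have hk1 : 1 ≤ k := by simp at hlen; omega
  match L, em with
  | [], em =>
    exact hD.claim2 he hz1W hz2W hN
  | [t], em =>
    have hv1 : v1 = t := by simp at em; exact em.1
    subst hv1
    have hb1 : b1 = v2 := by rw [e2] at em; simp at em; exact em.1.symm
    have ha1 : a1 = v1 := by
      cases P1 with
      | nil => simp at e1
      | cons t P1 =>
        cases P1 with
        | nil => simp at e1; exact e1.2.symm
        | cons t P1 => simp at e1
    subst ha1 hb1
    have hv1W := hD.inW a1 (by simp)
    by_cases hq : tri v0 a1 b1 ∩ segment ℝ z2 b2 ⊆ {z2}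
    · refine cleanup hk hD he hN (by simpa using hk1) (by simp) hz1W hz2W hpT ?_ hfp hfz1 h0
        (Or.inr ⟨rfl, hv1W, hL a1 (by simp), hz1⟩)
      rw [List.nil_append, poly_pair]; exact hq
    · obtain ⟨q, ⟨hqT, hqs⟩, hqz⟩ := Set.not_subset.1 hq
      obtain ⟨g, hg, hg1, hg2⟩ := exists_plane v0 a1 b1
      have lv : ∀ y ∈ tri v0 a1 b1, g y = g v0 := fun y hy => tri_level rfl hg1 hg2 hy
      have hgw : g b2 = g v0 := level_of_seg (lv _ hpT) (lv _ hqT) hqz hqs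
      obtain ⟨u, hu, h⟩ := planar (W := W) (v0 := v0) (mid := [a1, z1, z2]) (w := b2) hg (c := g v0)
        ⟨hD.hW, hD.hc, by simp, by simp [hv1W, hz1W, hz2W], hD.cl0, hD.clw, he.2.1, hN⟩
        (ne_of_first hD.arc (chain_first hch)) (by
          simp [hg1, hgw, lv _ hpT, lv _ (segment_subset_tri_bc _ _ _ hz1)])
      exact ⟨u, hu, he.trans h⟩
  | t :: t' :: L, em =>
    simp only [List.cons_append, List.cons.injEq] at em
    obtain ⟨rfl, rfl, -⟩ := em
    rcases hT12 with h | h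
    · linarith [hL v1 (by simp)]
    · linarith [hL v2 (by simp)]

theorem phase2 {k : ℕ} (hk : Claim k) {W : Set V3} {v0 w v1 v2 vk : V3} {m P : List V3}
    (hD : Dat W v0 (v1 :: v2 :: m) w) (hlen : (v1 :: v2 :: m).length = k + 1)
    (hch : (v0 :: ((v1 :: v2 :: m) ++ [w])).IsChain (· ≠ ·)) (el : v2 :: m = P ++ [vk])
    (hT : ¬ tri v0 v1 v2 ∩ segment ℝ vk w ⊆ {v2}) : Tv W v0 (v1 :: v2 :: m) w := by
  obtain ⟨q, ⟨hqT, hqs⟩, -⟩ := Set.not_subset.1 hT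
  obtain ⟨p, hpT, hp, hl⟩ := first_pt (tri_compact v0 v1 v2).isClosed hqT hqs
  obtain ⟨f, hf, hgt, hlt⟩ := hD.noh p
  by_cases b1 : ∀ x ∈ v1 :: v2 :: m, f p < f x
  · exact phase2_bad hk hD hlen hch el hpT hp hl rfl b1
  by_cases b2 : ∀ x ∈ v1 :: v2 :: m, f x < f p
  · exact phase2_bad (f := -f) hk hD hlen hch el hpT hp hl rfl (fun x hx => by simpa using b2 x hx)
  push Not at b1 b2
  have hPl : Pl f (f p) v0 (v1 :: v2 :: m) w := ⟨hf, hgt, hlt, b1, b2⟩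
  by_cases hc1 : f v0 < f p ∧ f w < f p
  · exact phase2_x hk hD hPl hlen hch el hpT hp rfl hc1.1 hc1.2
  by_cases hc2 : f p < f v0 ∧ f p < f w
  · exact phase2_x hk hD hPl.neg hlen hch el hpT hp rfl (by simpa using hc2.1) (by simpa using hc2.2)
  exact nonx hk hD hPl hlen.le hch hc1 hc2

theorem claim_all : ∀ k, Claim k := by
  intro k
  induction k with
  | zero => exact claim0
  | succ k hk =>
    intro W v0 mid w hW hc hne hlen hin h0 hw hA hN
    have hD : Dat W v0 mid w := ⟨hW, hc, hne, hin, h0, hw, hA, hN⟩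
    rcases hlen.lt_or_eq with hl | hl
    · exact hk W v0 mid w hW hc hne (by omega) hin h0 hw hA hN
    match mid, hD with
    | [], hD => exact absurd rfl hD.ne
    | [v1], hD => exact ⟨v1, hD.inW v1 (by simp), Eqv.refl hA⟩
    | v1 :: v2 :: m, hD =>
      by_cases hch : (v0 :: ((v1 :: v2 :: m) ++ [w])).IsChain (· ≠ ·)
      · obtain ⟨P, vk, el, -⟩ := snoc_of_cons v2 m
        by_cases hT : tri v0 v1 v2 ∩ segment ℝ vk w ⊆ {v2}
        · exact phase1 hk hD hl hch el hT
        · exact phase2 hk hD hl hch el hT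
      · obtain ⟨mid', h1, h2, h3⟩ := dup (W := W) (l1 := []) hne hch hA
        refine hD.claim hk h3 ?_ (fun x hx => hD.inW x (h2.subset hx)) (hN.sub ?_) (by omega)
        · rintro rfl; simp at h1
        · exact List.Sublist.cons_cons _ (h2.append_right _)

/-- Three points not on a line. -/
def Nd (a b c : V3) : Prop :=
  ∀ α β γ : ℝ, α + β + γ = 0 → α • a + β • b + γ • c = 0 → α = 0 ∧ β = 0 ∧ γ = 0

/-- The boundary of a triangle. -/
def bd (a b c : V3) : Set V3 := segment ℝ a b ∪ segment ℝ b c ∪ segment ℝ c a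

theorem bd_rot (a b c : V3) : bd a b c = bd c a b := by
  unfold bd
  ext x; simp only [mem_union]; tauto

theorem Nd.rot {a b c : V3} (h : Nd a b c) : Nd c a b := by
  intro α β γ hs h0
  obtain ⟨h1, h2, h3⟩ := h β γ α (by linarith) (by rw [← h0]; abel)
  exact ⟨h3, h1, h2⟩

theorem Nd.li {a b c : V3} (h : Nd a b c) : LinearIndependent ℝ ![c - a, b - a] := by
  rw [LinearIndependent.pair_iff]
  intro s t hst
  obtain ⟨h1, h2, h3⟩ := h (-(s + t)) t s (by ring) (by rw [← hst]; module)
  exact ⟨h3, h2⟩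

/-- two sides of a nondegenerate triangle meet only in the vertex -/
theorem Nd.inter {a b c : V3} (h : Nd a b c) : segment ℝ a b ∩ segment ℝ b c ⊆ {b} := by
  rintro x ⟨⟨s, t, h1, h2, hst, rfl⟩, ⟨s', t', h1', h2', hst', he⟩⟩
  obtain ⟨e1, e2, e3⟩ := h s (t - s') (-t') (by linarith) (by
    rw [show s • a + (t - s') • b + (-t') • c = (s • a + t • b) - (s' • b + t' • c) by module, he, sub_self])
  have : t = 1 := by linarith
  simp [e1, this]

theorem tri_zero {f : V3 →L[ℝ] ℝ} {c : ℝ} {a b u x : V3} (ha : f a = c) (hb : f b = c) (hu : f u ≠ c)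
    (hx : x ∈ tri a u b) (hfx : f x = c) : x ∈ segment ℝ a b := by
  obtain ⟨α, β, γ, h1, h2, h3, hs, rfl⟩ := hx
  simp only [map_add, map_smul, smul_eq_mul, ha, hb] at hfx
  have hα : α = 1 - β - γ := by linarith
  have : β * (f u - c) = 0 := by rw [hα] at hfx; linarith
  have hβ : β = 0 := by
    rcases mul_eq_zero.1 this with h | h
    · exact h
    · exact absurd (by linarith) hu
  exact ⟨α, γ, h1, h3, by linarith, by simp [hβ]⟩

theorem seg_level {f : V3 →L[ℝ] ℝ} {c : ℝ} {a b x : V3} (ha : f a = c) (hb : f b = c) (hx : x ∈ segment ℝ a b) :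
    f x = c := by
  obtain ⟨s, t, h1, h2, hst, rfl⟩ := hx
  simp only [map_add, map_smul, smul_eq_mul, ha, hb]
  rw [← add_mul, hst, one_mul]

theorem Nd.lift {f : V3 →L[ℝ] ℝ} {l : ℝ} {a b c d : V3} (h : Nd a b c) (ha : f a = l) (hb : f b = l) (hc : f c = l)
    (hd : f d ≠ l) {α β γ δ : ℝ} (hs : α + β + γ + δ = 0) (h0 : α • a + β • b + γ • c + δ • d = 0) :
    α = 0 ∧ β = 0 ∧ γ = 0 ∧ δ = 0 := by
  have h1 := congrArg f h0
  simp only [map_add, map_smul, smul_eq_mul, ha, hb, hc, map_zero] at h1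
  have : δ * (f d - l) = 0 := by
    have : α = - β - γ - δ := by linarith
    rw [this] at h1; linarith
  have hδ : δ = 0 := by
    rcases mul_eq_zero.1 this with h | h
    · exact h
    · exact absurd (by linarith) hd
  rw [hδ] at hs h0
  obtain ⟨e1, e2, e3⟩ := h α β γ (by linarith) (by simpa using h0)
  exact ⟨e1, e2, e3, hδ⟩

theorem bd_move {f : V3 →L[ℝ] ℝ} {l : ℝ} {a b c d : V3} (h : Nd a b c) (ha : f a = l) (hb : f b = l) (hc : f c = l)
    (hd : f d ≠ l) : Iso univ (bd a b c) (bd a b d) ∧ Nd a b d := by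
  have N1 : Nd a d c := by
    intro α β γ hs h0
    obtain ⟨e1, e2, e3, e4⟩ := h.lift ha hb hc hd (α := α) (β := 0) (γ := γ) (δ := β) (by linarith)
      (by rw [← h0]; module)
    exact ⟨e1, e4, e3⟩
  have N2 : Nd d c b := by
    intro α β γ hs h0
    obtain ⟨e1, e2, e3, e4⟩ := h.lift ha hb hc hd (α := 0) (β := γ) (γ := β) (δ := α) (by linarith)
      (by rw [← h0]; module)
    exact ⟨e4, e3, e2⟩
  have N3 : Nd a b d := by
    intro α β γ hs h0
    obtain ⟨e1, e2, e3, e4⟩ := h.lift ha hb hc hd (α := α) (β := β) (γ := 0) (δ := γ) (by linarith)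
      (by rw [← h0]; module)
    exact ⟨e1, e2, e4⟩
  refine ⟨?_, N3⟩
  obtain ⟨L1, hL1⟩ := exists_segs [a, b, c]
  obtain ⟨L2, hL2⟩ := exists_segs [b, a, d]
  have s1 : Iso univ (segment ℝ a c ∪ segs L1) (segment ℝ a d ∪ segment ℝ d c ∪ segs L1) := by
    refine delta N1.li isOpen_univ convex_univ (mem_univ _) (by simp) (by simp) (mem_univ _) L1 ?_
    rw [hL1, poly_cons, poly_pair]
    rintro x ⟨hx, hx' | hx'⟩
    · left
      have := tri_zero ha hc hd hx (seg_level ha hb hx')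
      rw [segment_symm] at this
      exact h.rot.inter ⟨this, hx'⟩
    · right
      have := tri_zero ha hc hd hx (seg_level hb hc hx')
      rw [segment_symm] at this
      exact h.rot.rot.inter ⟨hx', this⟩
  have s2 : Iso univ (segment ℝ d b ∪ segs L2) (segment ℝ d c ∪ segment ℝ c b ∪ segs L2) := by
    refine delta N2.li isOpen_univ convex_univ (mem_univ _) (by simp) (by simp) (mem_univ _) L2 ?_
    rw [hL2, poly_cons, poly_pair]
    rintro x ⟨hx, hx' | hx'⟩
    · right
      rw [segment_symm] at hx'
      have hx2 : x ∈ tri c d b := by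
        obtain ⟨α, β, γ, h1, h2, h3, hs, rfl⟩ := hx
        exact ⟨β, α, γ, h2, h1, h3, by linarith, by abel⟩
      have := tri_zero hc hb hd hx2 (seg_level ha hb hx')
      rw [segment_symm] at this
      exact h.inter ⟨hx', this⟩
    · left
      obtain ⟨α, β, γ, h1, h2, h3, hs, rfl⟩ := hx
      obtain ⟨s, t, h1', h2', hst, he⟩ := hx'
      obtain ⟨e1, e2, e3, e4⟩ := h.lift ha hb hc hd (α := s) (β := -γ) (γ := -β) (δ := t - α) (by linarith) (by
        rw [show s • a + -γ • b + -β • c + (t - α) • d = (s • a + t • d) - (α • d + β • c + γ • b) by module, he,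
          sub_self])
      have g1 : β = 0 := by linarith
      have g2 : γ = 0 := by linarith
      have g3 : α = 1 := by linarith
      simp [g1, g2, g3]
  have q1 : bd a b c = segment ℝ a c ∪ segs L1 := by
    rw [hL1, poly_cons, poly_pair, segment_symm ℝ a c]; unfold bd
    ext x; simp only [mem_union]; tauto
  have q2 : segment ℝ a d ∪ segment ℝ d c ∪ segs L1 = segment ℝ d c ∪ segment ℝ c b ∪ segs L2 := by
    rw [hL1, hL2, poly_cons, poly_pair, poly_cons, poly_pair, segment_symm ℝ c b, segment_symm ℝ b a]
    ext x; simp only [mem_union]; tauto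
  have q3 : segment ℝ d b ∪ segs L2 = bd a b d := by
    rw [hL2, poly_cons, poly_pair, segment_symm ℝ d b, segment_symm ℝ b a, segment_symm ℝ a d]; unfold bd
    ext x; simp only [mem_union]; tauto
  rw [q1, ← q3]
  rw [q2] at s1
  exact s1.trans s2.symm

theorem off_two {f g : V3 →L[ℝ] ℝ} (hf : f ≠ 0) (hg : g ≠ 0) (c d : ℝ) : ∃ x, f x ≠ c ∧ g x ≠ d := by
  have key : ∃ v, f v ≠ 0 ∧ g v ≠ 0 := by
    obtain ⟨u, hu⟩ : ∃ u, f u ≠ 0 := by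
      by_contra hn; push Not at hn; exact hf (ContinuousLinearMap.ext hn)
    obtain ⟨v, hv⟩ : ∃ v, g v ≠ 0 := by
      by_contra hn; push Not at hn; exact hg (ContinuousLinearMap.ext hn)
    by_cases h1 : g u = 0
    · by_cases h2 : f v = 0
      · exact ⟨u + v, by simpa [h2] using hu, by simpa [h1] using hv⟩
      · exact ⟨v, h2, hv⟩
    · exact ⟨u, hu, h1⟩
  obtain ⟨v, h1, h2⟩ := key
  obtain ⟨t, ht⟩ : ∃ t : ℝ, t ∉ ({c / f v, d / g v} : Finset ℝ) := Infinite.exists_notMem_finset _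
  simp only [Finset.mem_insert, Finset.mem_singleton, not_or] at ht
  refine ⟨t • v, ?_, ?_⟩
  · intro h; apply ht.1; rw [← h]; simp [h1]
  · intro h; apply ht.2; rw [← h]; simp [h2]

theorem bd_iso {a b c a' b' c' : V3} (h : Nd a b c) (h' : Nd a' b' c') : Iso univ (bd a b c) (bd a' b' c') := by
  obtain ⟨f1, hf1, e1, e2⟩ := exists_plane a b c
  obtain ⟨g1, hg1, e1', e2'⟩ := exists_plane a' b' c'
  obtain ⟨x, hx, hx'⟩ := off_two hf1 hg1 (f1 a) (g1 a')
  obtain ⟨s1, n1⟩ := bd_move h rfl e1 e2 hx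
  obtain ⟨s1', n1'⟩ := bd_move h' rfl e1' e2' hx'
  rw [bd_rot a b x] at s1
  rw [bd_rot a' b' x] at s1'
  have n2 := n1.rot
  have n2' := n1'.rot
  obtain ⟨f2, hf2, e3, e4⟩ := exists_plane x a b
  obtain ⟨g2, hg2, e3', e4'⟩ := exists_plane x a' b'
  obtain ⟨y, hy, hy'⟩ := off_two hf2 hg2 (f2 x) (g2 x)
  obtain ⟨s2, n3⟩ := bd_move n2 rfl e3 e4 hy
  obtain ⟨s2', n3'⟩ := bd_move n2' rfl e3' e4' hy'
  rw [bd_rot x a y] at s2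
  rw [bd_rot x a' y] at s2'
  have n4 := n3.rot
  have n4' := n3'.rot
  obtain ⟨f3, hf3, e5, e6⟩ := exists_plane y x a
  obtain ⟨g3, hg3, e5', e6'⟩ := exists_plane y x a'
  obtain ⟨z, hz, hz'⟩ := off_two hf3 hg3 (f3 y) (g3 y)
  obtain ⟨s3, n5⟩ := bd_move n4 rfl e5 e6 hz
  obtain ⟨s3', n5'⟩ := bd_move n4' rfl e5' e6' hz'
  exact (s1.trans (s2.trans s3)).trans (s1'.trans (s2'.trans s3')).symm

/-- Scaling of the horizontal coordinates. -/
def Sc (ρ : V3 → ℝ) (x : V3) : V3 := !₂[x 0 * ρ x, x 1 * ρ x, x 2]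

theorem ext3 {x y : V3} (h0 : x 0 = y 0) (h1 : x 1 = y 1) (h2 : x 2 = y 2) : x = y := by
  ext i
  fin_cases i
  · exact h0
  · exact h1
  · exact h2

theorem cont3 {X : Type*} [TopologicalSpace X] {g : X → V3} (h0 : Continuous fun x => g x 0)
    (h1 : Continuous fun x => g x 1) (h2 : Continuous fun x => g x 2) : Continuous g := by
  have : g = fun x => WithLp.toLp 2 (fun i => g x i) := by ext x i; rfl
  rw [this]
  refine (PiLp.continuous_toLp 2 _).comp (continuous_pi fun i => ?_)
  fin_cases i
  · exact h0
  · exact h1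
  · exact h2

theorem cont_c (i : Fin 3) : Continuous fun x : V3 => x i := by fun_prop

theorem Sc_cont {ρ : V3 → ℝ} {C : ℝ} (h1 : ∀ x : V3, ¬ (x 0 = 0 ∧ x 1 = 0) → ContinuousAt ρ x)
    (h2 : ∀ x : V3, ¬ (x 0 = 0 ∧ x 1 = 0) → |ρ x| ≤ C) : Continuous (Sc ρ) := by
  have key : ∀ i : Fin 3, (∀ x : V3, (x 0 = 0 ∧ x 1 = 0) → x i = 0) → Continuous fun x : V3 => x i * ρ x := by
    intro i hi
    rw [continuous_iff_continuousAt]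
    intro x
    by_cases hx : x 0 = 0 ∧ x 1 = 0
    · have h0 := hi x hx
      have e : x i * ρ x = 0 := by rw [h0, zero_mul]
      show Filter.Tendsto _ _ (nhds (x i * ρ x))
      rw [e]
      refine squeeze_zero_norm (a := fun y : V3 => C * |y i|) ?_ ?_
      · intro y
        by_cases hy : y 0 = 0 ∧ y 1 = 0
        · rw [hi y hy]; simp
        · rw [Real.norm_eq_abs, abs_mul, mul_comm]
          exact mul_le_mul_of_nonneg_right (h2 y hy) (abs_nonneg _)
      · have : Continuous fun y : V3 => C * |y i| := by fun_prop
        have := this.tendsto x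
        simpa [h0] using this
    · exact (cont_c i).continuousAt.mul (h1 x hx)
  refine cont3 ?_ ?_ ?_
  · exact key 0 (fun x h => h.1)
  · exact key 1 (fun x h => h.2)
  · exact cont_c 2

/-- The gauge of the standard triangle. -/
def gN (x : V3) : ℝ := max (max (-x 0) (-x 1)) (x 0 + x 1)

def rad (x : V3) : ℝ := √(x 0 ^ 2 + x 1 ^ 2)

theorem rad_sq (x : V3) : rad x ^ 2 = x 0 ^ 2 + x 1 ^ 2 := Real.sq_sqrt (by positivity)

theorem rad_pos {x : V3} (h : ¬ (x 0 = 0 ∧ x 1 = 0)) : 0 < rad x := by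
  apply Real.sqrt_pos.2
  by_contra hn
  push Not at hn
  apply h
  constructor <;> nlinarith [sq_nonneg (x 0), sq_nonneg (x 1)]

theorem abs_le_rad (x : V3) : |x 0| ≤ rad x ∧ |x 1| ≤ rad x := by
  constructor <;> apply Real.abs_le_sqrt <;> nlinarith [sq_nonneg (x 0), sq_nonneg (x 1)]

theorem gN_bd (x : V3) : rad x ≤ 4 * gN x ∧ gN x ≤ 2 * rad x := by
  have h1 : -x 0 ≤ gN x := (le_max_left _ _).trans (le_max_left _ _)
  have h2 : -x 1 ≤ gN x := (le_max_right _ _).trans (le_max_left _ _)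
  have h3 : x 0 + x 1 ≤ gN x := le_max_right _ _
  have hN : 0 ≤ gN x := by linarith
  constructor
  · apply Real.sqrt_le_iff.2
    refine ⟨by linarith, ?_⟩
    have : |x 0| ≤ 2 * gN x := abs_le.2 ⟨by linarith, by linarith⟩
    have : |x 1| ≤ 2 * gN x := abs_le.2 ⟨by linarith, by linarith⟩
    have e1 : x 0 ^ 2 ≤ (2 * gN x) ^ 2 := sq_le_sq' (by linarith) (by linarith)
    have e2 : x 1 ^ 2 ≤ (2 * gN x) ^ 2 := sq_le_sq' (by linarith) (by linarith)
    nlinarith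
  · obtain ⟨a1, a2⟩ := abs_le_rad x
    rw [abs_le] at a1 a2
    unfold gN
    have : 0 ≤ rad x := Real.sqrt_nonneg _
    refine max_le (max_le ?_ ?_) ?_ <;> linarith

theorem gN_scale {x : V3} {s : ℝ} (hs : 0 ≤ s) {y : V3} (h0 : y 0 = x 0 * s) (h1 : y 1 = x 1 * s) :
    gN y = gN x * s := by
  unfold gN
  rw [h0, h1, ← add_mul, ← neg_mul, ← neg_mul, max_mul_of_nonneg _ _ hs, max_mul_of_nonneg _ _ hs]

theorem rad_scale {x : V3} {s : ℝ} (hs : 0 ≤ s) {y : V3} (h0 : y 0 = x 0 * s) (h1 : y 1 = x 1 * s) :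
    rad y = rad x * s := by
  unfold rad
  rw [h0, h1, show (x 0 * s) ^ 2 + (x 1 * s) ^ 2 = (x 0 ^ 2 + x 1 ^ 2) * s ^ 2 by ring,
    Real.sqrt_mul (by positivity), Real.sqrt_sq hs]

def rho (τ : ℝ) (x : V3) : ℝ := (1 - τ) + τ * (gN x / rad x)

theorem rho_bd {τ : ℝ} (h0 : 0 ≤ τ) (h1 : τ ≤ 1) {x : V3} (hx : ¬ (x 0 = 0 ∧ x 1 = 0)) :
    1 / 4 ≤ rho τ x ∧ rho τ x ≤ 2 := by
  have hr := rad_pos hx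
  obtain ⟨g1, g2⟩ := gN_bd x
  have a1 : 1 / 4 ≤ gN x / rad x := by rw [le_div_iff₀ hr]; linarith
  have a2 : gN x / rad x ≤ 2 := by rw [div_le_iff₀ hr]; linarith
  unfold rho
  constructor <;> nlinarith

theorem rho_cont (τ : ℝ) {x : V3} (hx : ¬ (x 0 = 0 ∧ x 1 = 0)) : ContinuousAt (rho τ) x := by
  have hr := (rad_pos hx).ne'
  have c1 : Continuous gN := by unfold gN; fun_prop
  have c2 : Continuous rad := by unfold rad; fun_prop
  unfold rho
  exact continuousAt_const.add (continuousAt_const.mul (c1.continuousAt.div c2.continuousAt hr))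

theorem rho_scale (τ : ℝ) {x : V3} {s : ℝ} (hs : 0 < s) {y : V3} (h0 : y 0 = x 0 * s) (h1 : y 1 = x 1 * s) :
    rho τ y = rho τ x := by
  unfold rho
  rw [gN_scale hs.le h0 h1, rad_scale hs.le h0 h1, mul_div_mul_right _ _ hs.ne']

theorem Sc_planar {ρ : V3 → ℝ} {x : V3} (hx : x 0 = 0 ∧ x 1 = 0) : Sc ρ x = x := by
  apply ext3 <;> simp [Sc, hx.1, hx.2]

theorem Sc_inv {ρ σ : V3 → ℝ} {x : V3} (h : ¬ (x 0 = 0 ∧ x 1 = 0) → ρ x * σ (Sc ρ x) = 1) :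
    Sc σ (Sc ρ x) = x := by
  by_cases hx : x 0 = 0 ∧ x 1 = 0
  · rw [Sc_planar hx, Sc_planar hx]
  · have := h hx
    apply ext3
    · show x 0 * ρ x * σ (Sc ρ x) = x 0
      rw [mul_assoc, this, mul_one]
    · show x 1 * ρ x * σ (Sc ρ x) = x 1
      rw [mul_assoc, this, mul_one]
    · rfl

theorem Sc_homeo {τ : ℝ} (h0 : 0 ≤ τ) (h1 : τ ≤ 1) : IsHomeomorph (Sc (rho τ)) := by
  have c1 : Continuous (Sc (rho τ)) := Sc_cont (C := 2) (fun x hx => rho_cont τ hx) (fun x hx => by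
    obtain ⟨a, b⟩ := rho_bd h0 h1 hx
    rw [abs_le]; constructor <;> linarith)
  have c2 : Continuous (Sc (fun x => (rho τ x)⁻¹)) := Sc_cont (C := 4)
    (fun x hx => (rho_cont τ hx).inv₀ (by have := (rho_bd h0 h1 hx).1; linarith)) (fun x hx => by
    obtain ⟨a, b⟩ := rho_bd h0 h1 hx
    rw [abs_of_nonneg (inv_nonneg.2 (by linarith)), inv_le_comm₀ (by linarith) (by norm_num)]
    linarith)
  let e : V3 ≃ₜ V3 :=
    { toFun := Sc (rho τ)
      invFun := Sc (fun x => (rho τ x)⁻¹)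
      left_inv := fun x => Sc_inv (fun hx => by
        have hp : 0 < rho τ x := by linarith [(rho_bd h0 h1 hx).1]
        rw [rho_scale τ hp (x := x) (y := Sc (rho τ) x) rfl rfl]
        exact mul_inv_cancel₀ hp.ne')
      right_inv := fun x => Sc_inv (fun hx => by
        have hp : 0 < rho τ x := by linarith [(rho_bd h0 h1 hx).1]
        rw [rho_scale τ (inv_pos.2 hp) (x := x) (y := Sc (fun x => (rho τ x)⁻¹) x) rfl rfl]
        exact inv_mul_cancel₀ hp.ne')
      continuous_toFun := c1
      continuous_invFun := c2 }
  exact e.isHomeomorph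

def A0 : V3 := !₂[-1, -1, 0]
def B0 : V3 := !₂[2, -1, 0]
def C0 : V3 := !₂[-1, 2, 0]

theorem seg3 {a b x : V3} (t : ℝ) (h0 : 0 ≤ t) (h1 : t ≤ 1) (e0 : x 0 = (1 - t) * a 0 + t * b 0)
    (e1 : x 1 = (1 - t) * a 1 + t * b 1) (e2 : x 2 = (1 - t) * a 2 + t * b 2) : x ∈ segment ℝ a b := by
  refine ⟨1 - t, t, by linarith, h0, by ring, ?_⟩
  apply ext3 <;> simp [e0, e1, e2]

theorem std_eq : bd A0 B0 C0 = {x | gN x = 1 ∧ x 2 = 0} := by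
  ext x
  simp only [bd, mem_union, mem_setOf_eq]
  constructor
  · rintro ((⟨s, t, h1, h2, hst, rfl⟩ | ⟨s, t, h1, h2, hst, rfl⟩) | ⟨s, t, h1, h2, hst, rfl⟩)
    · constructor
      · apply le_antisymm
        · refine max_le (max_le ?_ ?_) ?_ <;> simp [A0, B0] <;> linarith
        · refine le_trans ?_ ((le_max_right _ _).trans (le_max_left _ _))
          simp [A0, B0]; linarith
      · simp [A0, B0]
    · constructor
      · apply le_antisymm
        · refine max_le (max_le ?_ ?_) ?_ <;> simp [C0, B0] <;> linarith
        · refine le_trans ?_ (le_max_right _ _)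
          simp [C0, B0]; linarith
      · simp [C0, B0]
    · constructor
      · apply le_antisymm
        · refine max_le (max_le ?_ ?_) ?_ <;> simp [C0, A0] <;> linarith
        · refine le_trans ?_ ((le_max_left _ _).trans (le_max_left _ _))
          simp [C0, A0]; linarith
      · simp [C0, A0]
  · rintro ⟨hN, h2⟩
    have h1 : -x 0 ≤ 1 := hN ▸ (le_max_left _ _).trans (le_max_left _ _)
    have h3 : -x 1 ≤ 1 := hN ▸ (le_max_right _ _).trans (le_max_left _ _)
    have h4 : x 0 + x 1 ≤ 1 := hN ▸ le_max_right _ _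
    have hcase : -x 0 = 1 ∨ -x 1 = 1 ∨ x 0 + x 1 = 1 := by
      unfold gN at hN
      rcases max_choice (max (-x 0) (-x 1)) (x 0 + x 1) with h | h
      · rcases max_choice (-x 0) (-x 1) with h' | h'
        · left; linarith
        · right; left; linarith
      · right; right; linarith
    rcases hcase with h | h | h
    · right
      refine seg3 ((2 - x 1) / 3) (by linarith) (by linarith) ?_ ?_ ?_ <;> simp [A0, C0] <;> linarith
    · left; left
      refine seg3 ((x 0 + 1) / 3) (by linarith) (by linarith) ?_ ?_ ?_ <;> simp [A0, B0] <;> linarith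
    · left; right
      refine seg3 ((2 - x 0) / 3) (by linarith) (by linarith) ?_ ?_ ?_ <;> simp [C0, B0] <;> linarith

theorem Sc_one (x : V3) : Sc (rho 1) x ∈ roundCircle ↔ gN x = 1 ∧ x 2 = 0 := by
  have h2 : (Sc (rho 1) x) 2 = x 2 := rfl
  have hN : 0 ≤ gN x := by
    have := (gN_bd x).1
    have : 0 ≤ rad x := Real.sqrt_nonneg _
    linarith
  have key : (Sc (rho 1) x) 0 ^ 2 + (Sc (rho 1) x) 1 ^ 2 = gN x ^ 2 := by
    by_cases hx : x 0 = 0 ∧ x 1 = 0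
    · rw [Sc_planar hx]
      simp [gN, hx.1, hx.2]
    · show (x 0 * rho 1 x) ^ 2 + (x 1 * rho 1 x) ^ 2 = gN x ^ 2
      have hr := rad_pos hx
      have e := rad_sq x
      rw [show (x 0 * rho 1 x) ^ 2 + (x 1 * rho 1 x) ^ 2 = (x 0 ^ 2 + x 1 ^ 2) * rho 1 x ^ 2 by ring, ← e]
      unfold rho
      field_simp
      ring
  show _ ∧ _ ↔ _
  rw [key, h2]
  constructor
  · rintro ⟨h, h'⟩
    exact ⟨by nlinarith, h'⟩
  · rintro ⟨h, h'⟩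
    exact ⟨by rw [h]; norm_num, h'⟩

theorem std_unknot : IsUnknot (bd A0 B0 C0) := by
  let cl : ℝ → ℝ := fun t => max 0 (min t 1)
  have cl0 : ∀ t, 0 ≤ cl t := fun t => le_max_left _ _
  have cl1 : ∀ t, cl t ≤ 1 := fun t => max_le zero_le_one (min_le_right _ _)
  refine ⟨fun t => Sc (rho (cl t)), ?_, fun t => Sc_homeo (cl0 t) (cl1 t), ?_, ?_⟩
  · have hc : Continuous (Sc (rho 1)) := (Sc_homeo zero_le_one le_rfl).continuous
    have hcl : Continuous cl := by fun_prop
    have : (fun q : ℝ × V3 => Sc (rho (cl q.1)) q.2) =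
        fun q => (1 - cl q.1) • q.2 + cl q.1 • Sc (rho 1) q.2 := by
      funext q
      apply ext3
      · simp [Sc, rho]; ring
      · simp [Sc, rho]; ring
      · simp [Sc]; ring
    rw [this]
    fun_prop
  · intro x
    apply ext3 <;> simp [Sc, rho, cl]
  · have e1 : cl 1 = 1 := by simp [cl]
    show Sc (rho (cl 1)) '' _ = _
    rw [e1, std_eq]
    ext y
    constructor
    · rintro ⟨x, hx, rfl⟩
      exact (Sc_one x).2 hx
    · intro hy
      obtain ⟨x, rfl⟩ := (Sc_homeo zero_le_one le_rfl).surjective y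
      exact ⟨x, (Sc_one x).1 hy, rfl⟩

theorem std_nd : Nd A0 B0 C0 := by
  intro α β γ hs h
  have h0 := congrArg (fun x : V3 => x 0) h
  have h1 := congrArg (fun x : V3 => x 1) h
  simp [A0, B0, C0] at h0 h1
  refine ⟨?_, ?_, ?_⟩ <;> linarith

theorem bd_unknot {a b c : V3} (h : Nd a b c) : IsUnknot (bd a b c) :=
  (bd_iso h std_nd).ambient std_unknot

theorem gap_zeros {g : ℝ → ℝ} (hg : Continuous g) {c τ1 τ2 τ3 : ℝ} (h12 : τ1 < τ2) (h23 : τ2 < τ3)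
    (h1 : c < g τ1) (h2 : g τ2 ≤ c) (h3 : c < g τ3) :
    ∃ a b, τ1 < a ∧ a ≤ b ∧ b < τ3 ∧ g a = c ∧ g b = c ∧ (∀ t ∈ Ico τ1 a, c < g t) ∧ (∀ t ∈ Ioc b τ3, c < g t) := by
  have hcl : IsClosed {t | g t ≤ c} := isClosed_le hg continuous_const
  obtain ⟨a, ⟨⟨ha1, ha2⟩, hac⟩, hal⟩ := (isCompact_Icc.inter_right hcl : IsCompact (Icc τ1 τ2 ∩ {t | g t ≤ c})).exists_isLeast
    ⟨τ2, ⟨h12.le, le_rfl⟩, h2⟩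
  obtain ⟨b, ⟨⟨hb1, hb2⟩, hbc⟩, hbl⟩ := (isCompact_Icc.inter_right hcl : IsCompact (Icc τ2 τ3 ∩ {t | g t ≤ c})).exists_isGreatest
    ⟨τ2, ⟨le_rfl, h23.le⟩, h2⟩
  have hac' : g a ≤ c := hac
  have hbc' : g b ≤ c := hbc
  have ha : g a = c := by
    obtain ⟨s, ⟨hs1, hs2⟩, hs⟩ := intermediate_value_Icc' ha1 hg.continuousOn ⟨hac', h1.le⟩
    have : a ≤ s := hal ⟨⟨hs1, hs2.trans ha2⟩, hs.le⟩
    rw [le_antisymm this hs2, hs]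
  have hb : g b = c := by
    obtain ⟨s, ⟨hs1, hs2⟩, hs⟩ := intermediate_value_Icc hb2 hg.continuousOn ⟨hbc', h3.le⟩
    have : s ≤ b := hbl ⟨⟨hb1.trans hs1, hs2⟩, hs.le⟩
    rw [← le_antisymm this hs1, hs]
  refine ⟨a, b, lt_of_le_of_ne ha1 ?_, ha2.trans hb1, lt_of_le_of_ne hb2 ?_, ha, hb, ?_, ?_⟩
  · intro h; rw [h] at h1; linarith
  · intro h; rw [← h] at h3; linarith
  · intro t ht
    by_contra hn
    push Not at hn
    have := hal ⟨⟨ht.1, ht.2.le.trans ha2⟩, hn⟩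
    linarith [ht.2]
  · intro t ht
    by_contra hn
    push Not at hn
    have := hbl ⟨⟨hb1.trans ht.1.le, ht.2⟩, hn⟩
    linarith [ht.1]

theorem comp_closed {Z : Set ℝ} (hZ : IsClosed Z) {a : ℝ} (ha : a ∈ Z) : IsClosed (connectedComponentIn Z a) := by
  apply isClosed_of_closure_subset
  refine IsPreconnected.subset_connectedComponentIn isPreconnected_connectedComponentIn.closure
    (subset_closure (mem_connectedComponentIn ha)) ?_
  exact closure_minimal (connectedComponentIn_subset _ _) hZ

theorem comp_bd {Z : Set ℝ} {a l r : ℝ} (ha : a ∈ Z) (hl : l ∉ Z) (hr : r ∉ Z) (h1 : l < a) (h2 : a < r) :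
    connectedComponentIn Z a ⊆ Ioo l r := by
  have hoc : (connectedComponentIn Z a).OrdConnected := isPreconnected_connectedComponentIn.ordConnected
  have ham := mem_connectedComponentIn ha
  intro s hs
  constructor
  · by_contra hn
    push Not at hn
    exact hl (connectedComponentIn_subset _ _ (hoc.out hs ham ⟨hn, h1.le⟩))
  · by_contra hn
    push Not at hn
    exact hr (connectedComponentIn_subset _ _ (hoc.out ham hs ⟨h2.le, hn⟩))

theorem gap_comp {g : ℝ → ℝ} (hg : Continuous g) {c l r a b : ℝ} (hla : l < a) (hab : a ≤ b) (hbr : b < r)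
    (ha : g a = c) (hb : g b = c)
    (h : ((∀ t ∈ Ico l a, c < g t) ∧ (∀ t ∈ Ioc b r, c < g t)) ∨
      ((∀ t ∈ Ico l a, g t < c) ∧ (∀ t ∈ Ioc b r, g t < c))) :
    ∃ x y, g x = c ∧ g y = c ∧ connectedComponentIn {t | g t = c} x ⊆ Ioo l r ∧
      connectedComponentIn {t | g t = c} y ⊆ Ioo l r ∧
      sInf (connectedComponentIn {t | g t = c} x) ∈ Ioo l r ∧
      sInf (connectedComponentIn {t | g t = c} y) ∈ Ioo l r ∧
      (sInf (connectedComponentIn {t | g t = c} x) ≠ sInf (connectedComponentIn {t | g t = c} y) ∨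
        IsGlancing g c (connectedComponentIn {t | g t = c} x)) := by
  set Z := {t | g t = c} with hZdef
  have hZ : IsClosed Z := isClosed_eq hg continuous_const
  have hlZ : ∀ t ∈ Ico l a, t ∉ Z := by
    intro t ht htz
    have htz : g t = c := htz
    rcases h with h | h
    · linarith [h.1 t ht]
    · linarith [h.1 t ht]
  have hrZ : ∀ t ∈ Ioc b r, t ∉ Z := by
    intro t ht htz
    have htz : g t = c := htz
    rcases h with h | h
    · linarith [h.2 t ht]
    · linarith [h.2 t ht]
  have haZ : a ∈ Z := ha
  have hbZ : b ∈ Z := hb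
  have ca := comp_bd haZ (hlZ l ⟨le_rfl, hla⟩) (hrZ r ⟨hbr, le_rfl⟩) hla (hab.trans_lt hbr)
  have cb := comp_bd hbZ (hlZ l ⟨le_rfl, hla⟩) (hrZ r ⟨hbr, le_rfl⟩) (hla.trans_le hab) hbr
  have inf_mem : ∀ {x}, x ∈ Z → connectedComponentIn Z x ⊆ Ioo l r →
      sInf (connectedComponentIn Z x) ∈ connectedComponentIn Z x := by
    intro x hx hs
    exact (comp_closed hZ hx).csInf_mem ⟨x, mem_connectedComponentIn hx⟩ (bddBelow_Ioo.mono hs)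
  have ia := inf_mem haZ ca
  have ib := inf_mem hbZ cb
  refine ⟨a, b, ha, hb, ca, cb, ca ia, cb ib, ?_⟩
  by_cases hne : sInf (connectedComponentIn Z a) = sInf (connectedComponentIn Z b)
  · right
    have hS : connectedComponentIn Z a = connectedComponentIn Z b := by
      rw [connectedComponentIn_eq ia, hne, ← connectedComponentIn_eq ib]
    have e1 : sInf (connectedComponentIn Z a) = a := by
      refine IsLeast.csInf_eq ⟨mem_connectedComponentIn haZ, fun s hs => ?_⟩
      by_contra hn
      push Not at hn
      exact hlZ s ⟨(ca hs).1.le, hn⟩ (connectedComponentIn_subset _ _ hs)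
    have e2 : sSup (connectedComponentIn Z a) = b := by
      rw [hS]
      refine IsGreatest.csSup_eq ⟨mem_connectedComponentIn hbZ, fun s hs => ?_⟩
      by_contra hn
      push Not at hn
      exact hrZ s ⟨hn, (cb hs).2.le⟩ (connectedComponentIn_subset _ _ hs)
    unfold IsGlancing AboveBefore AboveAfter
    rw [e1, e2]
    rcases h with h | h
    · refine iff_of_true ⟨a - l, by linarith, fun s hs => h.1 s ⟨by linarith [hs.1], hs.2⟩⟩
        ⟨r - b, by linarith, fun s hs => h.2 s ⟨hs.1, by linarith [hs.2]⟩⟩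
    · refine iff_of_false ?_ ?_
      · rintro ⟨ε, hε, hh⟩
        obtain ⟨s, hs1, hs2⟩ := exists_between (max_lt (sub_lt_self a hε) hla)
        have := hh s ⟨(le_max_left _ _).trans_lt hs1, hs2⟩
        have := h.1 s ⟨((le_max_right _ _).trans_lt hs1).le, hs2⟩
        linarith
      · rintro ⟨ε, hε, hh⟩
        obtain ⟨s, hs1, hs2⟩ := exists_between (lt_min (lt_add_of_pos_right b hε) hbr)
        have := hh s ⟨hs1, hs2.trans_le (min_le_left _ _)⟩
        have := h.2 s ⟨hs1, (hs2.trans_le (min_le_right _ _)).le⟩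
        linarith
  · exact Or.inl hne

theorem canon {g : ℝ → ℝ} (hp : Function.Periodic g 1) {c l r x : ℝ} (hx : g x = c)
    (hs : connectedComponentIn {t | g t = c} x ⊆ Ioo l r) :
    ∃ S' ∈ circComps {t | g t = c}, sInf S' = Int.fract (sInf (connectedComponentIn {t | g t = c} x)) ∧
      (IsGlancing g c (connectedComponentIn {t | g t = c} x) → IsGlancing g c S') := by
  set Z := {t | g t = c} with hZ
  set S := connectedComponentIn Z x with hS
  set n : ℤ := ⌊sInf S⌋ with hn
  have hxZ : x ∈ Z := hx
  have hgn : ∀ t, g (t + -(n : ℝ)) = g t := by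
    intro t
    have := hp.sub_zsmul_eq n (x := t)
    rw [← this]; congr 1; simp; ring
  let e : ℝ ≃ₜ ℝ := Homeomorph.addRight (-(n : ℝ))
  let o : ℝ ≃o ℝ := OrderIso.addRight (-(n : ℝ))
  have he : ∀ t, e t = t + -(n : ℝ) := fun t => rfl
  have heZ : e '' Z = Z := by
    ext t
    constructor
    · rintro ⟨s, hs, rfl⟩
      show g (s + -(n : ℝ)) = c
      rw [hgn]; exact hs
    · intro ht
      refine ⟨t + n, ?_, by rw [he]; ring⟩
      show g (t + n) = c
      rw [← hgn (t + n), add_neg_cancel_right]; exact ht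
  have h1 : e '' S = connectedComponentIn Z (e x) := by
    rw [hS, e.image_connectedComponentIn hxZ, heZ]
  have hne : S.Nonempty := ⟨x, mem_connectedComponentIn hxZ⟩
  have hoe : o '' S = connectedComponentIn Z (e x) := h1
  have hinf : sInf (connectedComponentIn Z (e x)) = sInf S + -(n : ℝ) := by
    rw [← hoe, ← o.map_csInf' hne (bddBelow_Ioo.mono hs)]; rfl
  have hsup : sSup (connectedComponentIn Z (e x)) = sSup S + -(n : ℝ) := by
    rw [← hoe, ← o.map_csSup' hne (bddAbove_Ioo.mono hs)]; rfl
  have hfr : sInf S + -(n : ℝ) = Int.fract (sInf S) := by rw [hn, Int.fract]; ring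
  refine ⟨connectedComponentIn Z (e x), ⟨e x, ?_, rfl, ?_⟩, by rw [hinf, hfr], ?_⟩
  · show g (x + -(n : ℝ)) = c
    rw [hgn]; exact hx
  · rw [hinf, hfr]; exact ⟨Int.fract_nonneg _, Int.fract_lt_one _⟩
  · unfold IsGlancing AboveBefore AboveAfter
    rw [hinf, hsup]
    intro h
    have t1 : (∃ ε > 0, ∀ s ∈ Ioo (sInf S + -(n : ℝ) - ε) (sInf S + -(n : ℝ)), c < g s) ↔
        ∃ ε > 0, ∀ s ∈ Ioo (sInf S - ε) (sInf S), c < g s := by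
      constructor
      · rintro ⟨ε, hε, hh⟩
        refine ⟨ε, hε, fun s hs => ?_⟩
        rw [← hgn]
        exact hh _ ⟨by linarith [hs.1], by linarith [hs.2]⟩
      · rintro ⟨ε, hε, hh⟩
        refine ⟨ε, hε, fun s hs => ?_⟩
        have := hh (s + n) ⟨by linarith [hs.1], by linarith [hs.2]⟩
        rw [← hgn, add_neg_cancel_right] at this
        exact this
    have t2 : (∃ ε > 0, ∀ s ∈ Ioo (sSup S + -(n : ℝ)) (sSup S + -(n : ℝ) + ε), c < g s) ↔
        ∃ ε > 0, ∀ s ∈ Ioo (sSup S) (sSup S + ε), c < g s := by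
      constructor
      · rintro ⟨ε, hε, hh⟩
        refine ⟨ε, hε, fun s hs => ?_⟩
        rw [← hgn]
        exact hh _ ⟨by linarith [hs.1], by linarith [hs.2]⟩
      · rintro ⟨ε, hε, hh⟩
        refine ⟨ε, hε, fun s hs => ?_⟩
        have := hh (s + n) ⟨by linarith [hs.1], by linarith [hs.2]⟩
        rw [← hgn, add_neg_cancel_right] at this
        exact this
    rw [t1, t2]
    exact h

theorem four_le {α β : Type} (z1 z2 z3 z4 : α ⊕ β) (h12 : z1 ≠ z2) (h13 : z1 ≠ z3) (h14 : z1 ≠ z4) (h23 : z2 ≠ z3)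
    (h24 : z2 ≠ z4) (h34 : z3 ≠ z4) : ((2 * 2 : ℕ) : Cardinal) ≤ Cardinal.mk α + Cardinal.mk β := by
  have hinj : Function.Injective ![z1, z2, z3, z4] := by
    intro i j h
    fin_cases i <;> fin_cases j <;> simp_all
  have := Cardinal.mk_le_of_injective hinj
  simpa using this

theorem fract_inj {l x y : ℝ} (hx : x ∈ Ioo l (l + 1)) (hy : y ∈ Ioo l (l + 1)) (h : Int.fract x = Int.fract y) :
    x = y := by
  obtain ⟨z, hz⟩ := Int.fract_eq_fract.1 h
  have h1 : (z : ℝ) < 1 := by linarith [hx.2, hy.1]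
  have h2 : (-1 : ℝ) < z := by linarith [hx.1, hy.2]
  have h3 : z < 1 := by exact_mod_cast h1
  have h4 : -1 < z := by exact_mod_cast h2
  have : z = 0 := by omega
  rw [this] at hz
  simp at hz; linarith

/-- Abstract counting lemma, for two gaps. -/
theorem count4 {g : ℝ → ℝ} (hp : Function.Periodic g 1) {c l m r : ℝ} (hr : r = l + 1) (hlm : l < m) (hmr : m < r)
    (G : ∀ p q : ℝ, (p = l ∧ q = m) ∨ (p = m ∧ q = r) →
      ∃ x y, g x = c ∧ g y = c ∧ connectedComponentIn {t | g t = c} x ⊆ Ioo p q ∧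
      connectedComponentIn {t | g t = c} y ⊆ Ioo p q ∧
      sInf (connectedComponentIn {t | g t = c} x) ∈ Ioo p q ∧
      sInf (connectedComponentIn {t | g t = c} y) ∈ Ioo p q ∧
      (sInf (connectedComponentIn {t | g t = c} x) ≠ sInf (connectedComponentIn {t | g t = c} y) ∨
        IsGlancing g c (connectedComponentIn {t | g t = c} x))) :
    ((2 * 2 : ℕ) : Cardinal) ≤ Cardinal.mk (circComps {t : ℝ | g t = c})
      + Cardinal.mk ({S ∈ circComps {t : ℝ | g t = c} | IsGlancing g c S}) := by
  obtain ⟨x1, y1, gx1, gy1, sx1, sy1, ix1, iy1, d1⟩ := G l m (Or.inl ⟨rfl, rfl⟩)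
  obtain ⟨x2, y2, gx2, gy2, sx2, sy2, ix2, iy2, d2⟩ := G m r (Or.inr ⟨rfl, rfl⟩)
  obtain ⟨X1, X1m, X1i, X1g⟩ := canon hp gx1 sx1
  obtain ⟨Y1, Y1m, Y1i, -⟩ := canon hp gy1 sy1
  obtain ⟨X2, X2m, X2i, X2g⟩ := canon hp gx2 sx2
  obtain ⟨Y2, Y2m, Y2i, -⟩ := canon hp gy2 sy2
  set a1 := sInf (connectedComponentIn {t | g t = c} x1)
  set b1 := sInf (connectedComponentIn {t | g t = c} y1)
  set a2 := sInf (connectedComponentIn {t | g t = c} x2)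
  set b2 := sInf (connectedComponentIn {t | g t = c} y2)
  have wide : ∀ {t}, (t ∈ Ioo l m ∨ t ∈ Ioo m r) → t ∈ Ioo l (l + 1) := by
    rintro t (h | h)
    · exact ⟨h.1, by linarith [h.2]⟩
    · exact ⟨by linarith [h.1], by linarith [h.2]⟩
  have sep : ∀ {S T : Set ℝ} {s t : ℝ}, sInf S = Int.fract s → sInf T = Int.fract t → (s ∈ Ioo l m ∨ s ∈ Ioo m r) →
      (t ∈ Ioo l m ∨ t ∈ Ioo m r) → s ≠ t → S ≠ T := by
    rintro S T s t h1 h2 h3 h4 h5 rfl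
    exact h5 (fract_inj (wide h3) (wide h4) (by rw [← h1, ← h2]))
  have lt12 : ∀ {s t}, s ∈ Ioo l m → t ∈ Ioo m r → s ≠ t := by
    rintro s t h1 h2 rfl
    linarith [h1.2, h2.1]
  have nX : X1 ≠ X2 := sep X1i X2i (Or.inl ix1) (Or.inr ix2) (lt12 ix1 ix2)
  have nXY : X1 ≠ Y2 := sep X1i Y2i (Or.inl ix1) (Or.inr iy2) (lt12 ix1 iy2)
  have nYX : X2 ≠ Y1 := (sep Y1i X2i (Or.inl iy1) (Or.inr ix2) (lt12 iy1 ix2)).symm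
  have nY : Y1 ≠ Y2 := sep Y1i Y2i (Or.inl iy1) (Or.inr iy2) (lt12 iy1 iy2)
  rcases d1 with d1 | d1
  · have n1 : X1 ≠ Y1 := sep X1i Y1i (Or.inl ix1) (Or.inl iy1) d1
    rcases d2 with d2 | d2
    · have n2 : X2 ≠ Y2 := sep X2i Y2i (Or.inr ix2) (Or.inr iy2) d2
      refine four_le (Sum.inl ⟨X1, X1m⟩) (Sum.inl ⟨X2, X2m⟩) (Sum.inl ⟨Y1, Y1m⟩) (Sum.inl ⟨Y2, Y2m⟩) ?_ ?_ ?_ ?_ ?_ ?_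
        <;> simp [*]
    · refine four_le (Sum.inl ⟨X1, X1m⟩) (Sum.inl ⟨X2, X2m⟩) (Sum.inl ⟨Y1, Y1m⟩) (Sum.inr ⟨X2, X2m, X2g d2⟩) 
        ?_ ?_ ?_ ?_ ?_ ?_ <;> simp [*]
  · rcases d2 with d2 | d2
    · have n2 : X2 ≠ Y2 := sep X2i Y2i (Or.inr ix2) (Or.inr iy2) d2
      refine four_le (Sum.inl ⟨X1, X1m⟩) (Sum.inl ⟨X2, X2m⟩) (Sum.inr ⟨X1, X1m, X1g d1⟩) (Sum.inl ⟨Y2, Y2m⟩)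
        ?_ ?_ ?_ ?_ ?_ ?_ <;> simp [*]
    · refine four_le (Sum.inl ⟨X1, X1m⟩) (Sum.inl ⟨X2, X2m⟩) (Sum.inr ⟨X1, X1m, X1g d1⟩) 
        (Sum.inr ⟨X2, X2m, X2g d2⟩) ?_ ?_ ?_ ?_ ?_ ?_ <;> simp [*]

theorem cut_gt {K : ℝ → V3} (hK : Continuous K) (hper : Function.Periodic K 1) {f : V3 →L[ℝ] ℝ} {c τ1 τ2 τ3 τ4 : ℝ}
    (h12 : τ1 < τ2) (h23 : τ2 < τ3) (h34 : τ3 < τ4) (h41 : τ4 < τ1 + 1)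
    (h : (c < f (K τ1) ∧ f (K τ2) ≤ c ∧ c < f (K τ3) ∧ f (K τ4) ≤ c) ∨
      (f (K τ1) < c ∧ c ≤ f (K τ2) ∧ f (K τ3) < c ∧ c ≤ f (K τ4))) : CutsAtLeast K f c (2 * 2) := by
  have hg : Continuous fun t => f (K t) := f.continuous.comp hK
  have hp : Function.Periodic (fun t => f (K t)) 1 := fun t => by simp only [hper t]
  unfold CutsAtLeast cutCount
  have hZ : {t : ℝ | f (K t) = c} ≠ univ := by
    intro hu
    have : τ1 ∈ {t : ℝ | f (K t) = c} := by rw [hu]; trivial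
    have : f (K τ1) = c := this
    rcases h with h | h <;> linarith [h.1]
  rw [if_neg hZ]
  refine count4 hp (l := τ1) (m := τ3) (r := τ1 + 1) rfl (h12.trans h23) (h34.trans h41) ?_
  have e1 := hper τ1
  rcases h with ⟨g1, g2, g3, g4⟩ | ⟨g1, g2, g3, g4⟩
  · rintro p q (⟨rfl, rfl⟩ | ⟨rfl, rfl⟩)
    · obtain ⟨a, b, q1, q2, q3, q4, q5, q6, q7⟩ := gap_zeros hg h12 h23 g1 g2 g3
      exact gap_comp hg q1 q2 q3 q4 q5 (Or.inl ⟨q6, q7⟩)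
    · obtain ⟨a, b, q1, q2, q3, q4, q5, q6, q7⟩ := gap_zeros hg h34 h41 g3 g4 (by simpa only [e1] using g1)
      exact gap_comp hg q1 q2 q3 q4 q5 (Or.inl ⟨q6, q7⟩)
  · rintro p q (⟨rfl, rfl⟩ | ⟨rfl, rfl⟩)
    · obtain ⟨a, b, q1, q2, q3, q4, q5, q6, q7⟩ := gap_zeros hg.neg (c := -c) h12 h23 (by simpa using g1)
        (by simpa using g2) (by simpa using g3)
      exact gap_comp hg q1 q2 q3 (neg_injective q4) (neg_injective q5)
        (Or.inr ⟨fun t ht => neg_lt_neg_iff.1 (q6 t ht), fun t ht => neg_lt_neg_iff.1 (q7 t ht)⟩)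
    · obtain ⟨a, b, q1, q2, q3, q4, q5, q6, q7⟩ := gap_zeros hg.neg (c := -c) h34 h41 (by simpa using g3)
        (by simpa using g4) (by simpa [e1] using g1)
      exact gap_comp hg q1 q2 q3 (neg_injective q4) (neg_injective q5)
        (Or.inr ⟨fun t ht => neg_lt_neg_iff.1 (q6 t ht), fun t ht => neg_lt_neg_iff.1 (q7 t ht)⟩)

theorem closed_unknot {f : V3 →L[ℝ] ℝ} {c : ℝ} {a b d : V3} {mid l1 l2 : List V3}
    (e1 : mid = b :: l1) (e2 : mid = l2 ++ [d]) (hfa : c < f a) (hmid : ∀ x ∈ mid, f x < c)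
    (hA : Arc (a :: mid)) (hda : segment ℝ d a ∩ poly (a :: mid) ⊆ {d, a})
    (hN : NoH2 (a :: (mid ++ [a]))) : IsUnknot (poly (a :: (mid ++ [a]))) := by
  have hb : f b < c := hmid b (by simp [e1])
  have hd : f d < c := hmid d (by simp [e2])
  obtain ⟨x, hx, hfx⟩ := exists_level hb.le hfa.le
  obtain ⟨y, hy, hfy⟩ := exists_level hd.le hfa.le
  have hx' : x ∈ segment ℝ a b := by rw [segment_symm]; exact hx
  have hpx : poly (a :: x :: mid) = poly (a :: mid) := by
    rw [e1]; exact poly_insert_on (l1 := []) hx'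
  have hxm : poly (x :: mid) ⊆ poly (a :: mid) := by
    rw [← hpx, poly_cons]; exact subset_union_right
  have hAx : Arc (x :: mid) := by
    have : Arc (a :: x :: b :: l1) := arc_insert_on (l1 := []) (by simpa [e1] using hA) hx'
    rw [e1]; exact ((arc_cons _ _ _).1 this).2
  have hxy : x ≠ y := by
    rintro rfl
    have := hda ⟨hy, hxm (head_mem_poly _ _)⟩
    rcases this with h | h
    · rw [h] at hfx; linarith
    · rw [mem_singleton_iff.1 h] at hfx; linarith
  have hAy : Arc (x :: (mid ++ [y])) := by
    have h0 : Arc ((x :: l2) ++ d :: [y]) := by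
      rw [arc_append]
      refine ⟨by simpa [e2] using hAx, arc_pair _ _, ?_⟩
      rintro z ⟨hz1, hz2⟩
      have hz1' : z ∈ poly (a :: mid) := hxm (by simpa [e2] using hz1)
      have hz3 : z ∈ segment ℝ d y := by
        rcases hz2 with h | h
        · exact h
        · rw [mem_singleton_iff.1 h]; exact right_mem_segment ℝ _ _
      have hz4 : z ∈ segment ℝ d a :=
        (convex_segment d a).segment_subset (left_mem_segment ℝ _ _) hy hz3
      rcases hda ⟨hz4, hz1'⟩ with h | h
      · exact h
      · have : f z ≤ c := (conv_le f c).segment_subset (show f d ≤ c from hd.le) hfy.le hz3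
        rw [mem_singleton_iff.1 h] at this
        linarith
    rw [e2]; simpa using h0
  have hNy : NoH2 (x :: (mid ++ [y])) := by
    have h1 : NoH2 (a :: x :: (mid ++ [a])) := by
      rw [e1]
      exact NoH2.insert (l1 := []) (l2 := l1 ++ [a]) (by simpa [e1] using hN) hx'
    have h2 : NoH2 ((a :: x :: l2) ++ d :: y :: [a]) :=
      NoH2.insert (by simpa [e2] using h1) hy
    refine h2.sub ?_
    have e : (a :: x :: l2) ++ d :: y :: [a] = a :: ((x :: (mid ++ [y])) ++ [a]) := by
      rw [e2]; simp
    rw [e]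
    exact (List.sublist_append_left _ _).trans (List.sublist_cons_self _ _)
  have hclosed : poly (a :: (mid ++ [a])) =
      poly (x :: (mid ++ [y])) ∪ segs [(y, a), (a, x)] := by
    have h1 : poly (a :: (mid ++ [a])) = poly (a :: x :: (mid ++ [a])) := by
      rw [e1]; exact (poly_insert_on (l1 := []) (l2 := l1 ++ [a]) hx').symm
    have h2 : poly (a :: x :: (mid ++ [a])) = poly ((a :: x :: l2) ++ d :: y :: [a]) := by
      rw [poly_insert_on hy, e2]; simp
    have e : (a :: x :: l2) ++ d :: y :: [a] = (a :: x :: mid) ++ y :: [a] := by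
      rw [e2]; simp
    rw [h1, h2, e, poly_append]
    have h3 : (a :: x :: mid) ++ [y] = a :: x :: (mid ++ [y]) := by simp
    rw [h3, poly_cons]
    ext z
    have h4 : z = a → z ∈ segment ℝ y a := by rintro rfl; exact right_mem_segment ℝ _ _
    simp only [mem_union, segs, poly, List.mem_cons, List.not_mem_nil, or_false, mem_ofPred_eq,
      mem_singleton_iff, exists_eq_or_imp, exists_eq_left]
    tauto
  rw [hclosed]
  have hW : ∀ z, z ∈ up univ (-f) (-c) ↔ f z < c := by
    intro z; simp [up]
  have hbW : b ∈ up univ (-f) (-c) := (hW b).2 hb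
  obtain ⟨u, hu, hE⟩ := claim_all mid.length (up univ (-f) (-c)) x mid y
    (up_open isOpen_univ _ _) (up_convex convex_univ _ _) (by simp [e1]) le_rfl
    (fun z hz => (hW z).2 (hmid z hz))
    (mem_closure_up isOpen_univ convex_univ hbW (by simp) (by simp [hfx]))
    (mem_closure_up isOpen_univ convex_univ hbW (by simp) (by simp [hfy])) hAy hNy
  have hfu : f u < c := (hW u).1 hu
  have hR : segs [(y, a), (a, x)] = segment ℝ y a ∪ segment ℝ a x := by
    ext z
    simp [segs]
  have hRge : ∀ z ∈ segs [(y, a), (a, x)], c ≤ f z := by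
    intro z hz
    rw [hR] at hz
    rcases hz with h | h
    · exact (conv_ge f c).segment_subset (show c ≤ f y from hfy.ge) hfa.le h
    · exact (conv_ge f c).segment_subset (show c ≤ f a from hfa.le) hfx.ge h
  have i1 : Iso (up univ (-f) (-c)) (poly (x :: (mid ++ [y])) ∪ segs [(y, a), (a, x)])
      (poly [x, u, y] ∪ segs [(y, a), (a, x)]) := by
    apply hE.2.2.union
    rw [disjoint_left]
    intro z hz hz2
    have := hRge z hz
    have := (hW z).1 hz2
    linarith
  refine i1.ambient ?_
  have hli : LinearIndependent ℝ ![y - x, u - x] := by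
    rw [LinearIndependent.pair_iff]
    intro s t hst
    have h1 := congrArg f hst
    simp only [map_add, map_smul, map_sub, smul_eq_mul, hfx, hfy, map_zero] at h1
    have ht : t = 0 := by
      have h2 : t * (f u - c) = 0 := by linarith
      rcases mul_eq_zero.1 h2 with h | h
      · exact h
      · linarith
    subst ht
    rw [zero_smul, add_zero, smul_eq_zero] at hst
    rcases hst with h | h
    · exact ⟨h, rfl⟩
    · exact absurd (sub_eq_zero.1 h).symm hxy
  have hL : tri x u y ∩ segs [(y, a), (a, x)] ⊆ {x, y} := by
    rintro z ⟨hz1, hz2⟩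
    have h1 := hRge z hz2
    have h2 : f z ≤ c := tri_subset (conv_le f c) hfx.le hfu.le hfy.le hz1
    rw [hR] at hz2
    rcases hz2 with h | h
    · right; exact seg_low hfy hfa h h2
    · left; rw [segment_symm] at h; exact seg_low hfx hfa h h2
  have i2 := delta hli isOpen_univ convex_univ (mem_univ _) (by simp) (by simp) (mem_univ _) _ hL
  have e3 : poly [x, u, y] ∪ segs [(y, a), (a, x)] =
      (segment ℝ x u ∪ segment ℝ u y) ∪ segs [(y, a), (a, x)] := by
    ext z
    have h4 : z = y → z ∈ segment ℝ u y := by rintro rfl; exact right_mem_segment ℝ _ _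
    simp only [mem_union, poly, mem_singleton_iff]
    tauto
  rw [e3]
  refine i2.symm.ambient ?_
  have e4 : segment ℝ x y ∪ segs [(y, a), (a, x)] = bd x y a := by
    rw [hR, bd, union_assoc]
  rw [e4]
  apply bd_unknot
  intro α β γ hs h0
  have h1 := congrArg f h0
  simp only [map_add, map_smul, smul_eq_mul, hfx, hfy, map_zero] at h1
  have hγ : γ = 0 := by
    have h2 : γ * (f a - c) = 0 := by
      have : α = -β - γ := by linarith
      subst this; linarith
    rcases mul_eq_zero.1 h2 with h | h
    · exact h
    · linarith
  subst hγ
  have hβ : β = -α := by linarith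
  subst hβ
  have h3 : α • (x - y) = 0 := by rw [← h0]; module
  rcases smul_eq_zero.1 h3 with h | h
  · simp [h]
  · exact absurd (sub_eq_zero.1 h) hxy

/-- Point of the `i`-th edge at parameter `u`. -/
def PP (q : ℕ → V3) (i : ℕ) (u : ℝ) : V3 := q i + u • (q (i + 1) - q i)

/-- The list of `l` consecutive vertices starting at index `k`. -/
def sl (q : ℕ → V3) (k l : ℕ) : List V3 := (List.range' k l).map q

theorem sl_succ (q : ℕ → V3) (k l : ℕ) : sl q k (l + 1) = q k :: sl q (k + 1) l := by
  simp [sl, List.range'_succ]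

theorem sl_last (q : ℕ → V3) (k l : ℕ) : sl q k (l + 1) = sl q k l ++ [q (k + l)] := by
  simp [sl, List.range'_concat]

theorem PP_zero (q : ℕ → V3) (i : ℕ) : PP q i 0 = q i := by simp [PP]

theorem PP_mem (q : ℕ → V3) (i : ℕ) {u : ℝ} (h0 : 0 ≤ u) (h1 : u ≤ 1) :
    PP q i u ∈ segment ℝ (q i) (q (i + 1)) :=
  ⟨1 - u, u, by linarith, h0, by ring, by unfold PP; module⟩

theorem mem_seg_PP {q : ℕ → V3} {i : ℕ} {x : V3} (h : x ∈ segment ℝ (q i) (q (i + 1))) :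
    x = q (i + 1) ∨ ∃ u : ℝ, 0 ≤ u ∧ u < 1 ∧ x = PP q i u := by
  obtain ⟨s, t, hs, ht, hst, rfl⟩ := h
  have hs' : s = 1 - t := by linarith
  subst hs'
  rcases (show t ≤ 1 by linarith).eq_or_lt with h | h
  · left; subst h; simp
  · right; exact ⟨t, ht, h, by unfold PP; module⟩

theorem mem_sl {q : ℕ → V3} {x : V3} (l : ℕ) : ∀ k, x ∈ poly (sl q k (l + 1)) →
    ∃ i u, k ≤ i ∧ i ≤ k + l ∧ 0 ≤ u ∧ u < 1 ∧ (i = k + l → u = 0) ∧ x = PP q i u := by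
  induction l with
  | zero =>
    intro k h
    refine ⟨k, 0, le_rfl, le_rfl, le_rfl, one_pos, fun _ => rfl, ?_⟩
    rw [PP_zero]
    simpa [sl, poly] using h
  | succ l ih =>
    intro k h
    rw [sl_succ, sl_succ, poly_cons, ← sl_succ] at h
    have key : x ∈ poly (sl q (k + 1) (l + 1)) → ∃ i u, k ≤ i ∧ i ≤ k + (l + 1) ∧ 0 ≤ u ∧ u < 1 ∧
        (i = k + (l + 1) → u = 0) ∧ x = PP q i u := by
      intro h
      obtain ⟨i, u, h1, h2, h3, h4, h5, h6⟩ := ih (k + 1) h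
      exact ⟨i, u, by omega, by omega, h3, h4, fun h => h5 (by omega), h6⟩
    rcases h with h | h
    · rcases mem_seg_PP h with rfl | ⟨u, h0, h1, hx⟩
      · apply key
        rw [sl_succ]; exact head_mem_poly _ _
      · exact ⟨k, u, le_rfl, by omega, h0, h1, fun h => by omega, hx⟩
    · exact key h

theorem PP_mem_sl (q : ℕ → V3) {u : ℝ} (h0 : 0 ≤ u) (h1 : u ≤ 1) (l : ℕ) :
    ∀ k i, k ≤ i → i < k + l → PP q i u ∈ poly (sl q k (l + 1)) := by
  induction l with
  | zero => intro k i h h'; omega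
  | succ l ih =>
    intro k i h h'
    rw [sl_succ, sl_succ, poly_cons, ← sl_succ]
    rcases h.eq_or_lt with rfl | h
    · exact Or.inl (PP_mem q _ h0 h1)
    · exact Or.inr (ih (k + 1) i (by omega) (by omega))

/-- Injectivity of the polygon on the edges with index in `[k, k + l]`. -/
def PInj (q : ℕ → V3) (k l : ℕ) : Prop := ∀ i j : ℕ, ∀ u u' : ℝ, k ≤ i → i ≤ k + l → k ≤ j →
  j ≤ k + l → 0 ≤ u → u < 1 → 0 ≤ u' → u' < 1 → PP q i u = PP q j u' → i = j ∧ u = u'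

theorem arc_sl {q : ℕ → V3} (l : ℕ) : ∀ k, PInj q k l → Arc (sl q k (l + 1)) := by
  induction l with
  | zero => intro k _; simp [sl, Arc]
  | succ l ih =>
    intro k h
    rw [sl_succ, sl_succ, arc_cons, ← sl_succ]
    constructor
    · rintro x ⟨h1, h2⟩
      rcases mem_seg_PP h1 with rfl | ⟨u, h3, h4, hx⟩
      · rfl
      · obtain ⟨i, u', k1, k2, k3, k4, k5, k6⟩ := mem_sl l _ h2
        have := (h k i u u' le_rfl (by omega) (by omega) (by omega) h3 h4 k3 k4
          (hx.symm.trans k6)).1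
        omega
    · apply ih
      intro i j u u' a1 a2 a3 a4
      exact h i j u u' (by omega) (by omega) (by omega) (by omega)

theorem seq_unknot {q : ℕ → V3} {r n : ℕ} {f : V3 →L[ℝ] ℝ} {c : ℝ} (hq : q (r + (n + 2)) = q r)
    (hinj : PInj q r (n + 1)) (hr : c < f (q r))
    (hlow : ∀ i, r < i → i < r + (n + 2) → f (q i) < c)
    (hN : NoH2 (sl q r (n + 3))) : IsUnknot (poly (sl q r (n + 3))) := by
  have e : sl q r (n + 3) = q r :: (sl q (r + 1) (n + 1) ++ [q r]) := by
    rw [sl_succ, sl_last q (r + 1) (n + 1), ← hq]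
    congr 4; omega
  rw [e] at hN ⊢
  refine closed_unknot (f := f) (c := c) (sl_succ q (r + 1) n) (sl_last q (r + 1) n) hr ?_ ?_ ?_ hN
  · intro x hx
    simp only [sl, List.mem_map, List.mem_range'_1] at hx
    obtain ⟨i, ⟨h1, h2⟩, rfl⟩ := hx
    exact hlow i (by omega) (by omega)
  · rw [← sl_succ]; exact arc_sl _ _ hinj
  · rw [← sl_succ]
    rintro x ⟨h1, h2⟩
    have e2 : r + 1 + n = r + (n + 1) := by omega
    have e3 : q r = q (r + (n + 1) + 1) := by rw [← hq]; rfl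
    rw [e2, e3] at h1
    rw [e2]
    rcases mem_seg_PP h1 with rfl | ⟨u, h3, h4, hx⟩
    · right; rw [← e3]; rfl
    · left
      obtain ⟨i, u', k1, k2, k3, k4, k5, k6⟩ := mem_sl _ _ h2
      obtain ⟨a1, a2⟩ := hinj (r + (n + 1)) i u u' (by omega) le_rfl k1 k2 h3 h4 k3 k4
        (hx.symm.trans k6)
      have := k5 a1.symm
      rw [hx, a2, this, PP_zero]

theorem alt_idx {g : ℕ → Bool} {r l : ℕ} {b1 b2 b3 b4 : Bool}
    (h : List.Sublist [b1, b2, b3, b4] ((List.range' r l).map g)) :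
    ∃ i1 i2 i3 i4, r ≤ i1 ∧ i1 < i2 ∧ i2 < i3 ∧ i3 < i4 ∧ i4 < r + l ∧ g i1 = b1 ∧ g i2 = b2 ∧
      g i3 = b3 ∧ g i4 = b4 := by
  obtain ⟨l', h1, h2⟩ := List.sublist_map_iff.1 h
  rcases l' with _ | ⟨i1, _ | ⟨i2, _ | ⟨i3, _ | ⟨i4, _ | ⟨i5, l'⟩⟩⟩⟩⟩ <;> simp at h2
  have hp := List.Pairwise.sublist h1 (List.pairwise_lt_range' (s := r) (n := l))
  have m1 := h1.subset (show i1 ∈ [i1, i2, i3, i4] by simp)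
  have m4 := h1.subset (show i4 ∈ [i1, i2, i3, i4] by simp)
  simp only [List.mem_range'_1] at m1 m4
  simp at hp
  exact ⟨i1, i2, i3, i4, m1.1, hp.1.1, hp.2.1.1, hp.2.2, m4.2, h2.1.symm, h2.2.1.symm,
    h2.2.2.1.symm, h2.2.2.2.symm⟩

theorem noH2_seq {K : ℝ → V3} (hK : Continuous K) (hper : Function.Periodic K 1)
    (hH : ¬ (hull K 2).Nonempty) {T : ℕ → ℝ} (hT : StrictMono T) {n : ℕ}
    (hTn : ∀ i, T (i + n) = T i + 1) (r : ℕ) : NoH2 (sl (fun i => K (T i)) r (n + 1)) := by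
  intro p
  have hp : p ∉ hull K 2 := fun h => hH ⟨p, h⟩
  simp only [hull, mem_ofPred_eq, not_forall] at hp
  obtain ⟨f, hf, hc⟩ := hp
  have hqn : ∀ i, K (T (i + n)) = K (T i) := fun i => by rw [hTn, hper]
  have key : ∀ (g : V3 → Prop) (b1 b2 b3 b4 : Bool), b1 ≠ b4 →
      List.Sublist [b1, b2, b3, b4]
        ((sl (fun i => K (T i)) r (n + 1)).map (fun x => decide (g x))) →
      ∃ τ1 τ2 τ3 τ4, τ1 < τ2 ∧ τ2 < τ3 ∧ τ3 < τ4 ∧ τ4 < τ1 + 1 ∧ decide (g (K τ1)) = b1 ∧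
        decide (g (K τ2)) = b2 ∧ decide (g (K τ3)) = b3 ∧ decide (g (K τ4)) = b4 := by
    intro g b1 b2 b3 b4 hb h
    rw [sl, List.map_map] at h
    obtain ⟨i1, i2, i3, i4, k1, k2, k3, k4, k5, k6, k7, k8, k9⟩ := alt_idx h
    refine ⟨T i1, T i2, T i3, T i4, hT k2, hT k3, hT k4, ?_, k6, k7, k8, k9⟩
    rw [← hTn]
    apply hT
    by_contra hcon
    have e : i4 = i1 + n := by omega
    apply hb
    rw [← k6, ← k9, e]
    simp only [Function.comp, hqn]
  refine ⟨f, hf, ⟨?_, ?_⟩, ⟨?_, ?_⟩⟩ <;> intro h <;>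
    obtain ⟨τ1, τ2, τ3, τ4, h12, h23, h34, h41, g1, g2, g3, g4⟩ := key _ _ _ _ _ (by simp) h <;>
    simp only [decide_eq_true_eq, decide_eq_false_iff_not, not_lt] at g1 g2 g3 g4 <;> apply hc
  · exact cut_gt hK hper h12 h23 h34 h41 (Or.inl ⟨g1, g2, g3, g4⟩)
  · exact cut_gt hK hper h23 h34 h41 (by linarith) (Or.inl ⟨g2, g3, g4, by rw [hper]; exact g1⟩)
  · exact cut_gt hK hper h12 h23 h34 h41 (Or.inr ⟨g1, g2, g3, g4⟩)
  · exact cut_gt hK hper h23 h34 h41 (by linarith) (Or.inr ⟨g2, g3, g4, by rw [hper]; exact g1⟩)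

theorem loop_form {m : ℕ} {v : Fin (m + 1) → V3} {q : ℕ → V3}
    (hq : ∀ i, q i = v ⟨i % (m + 1), Nat.mod_lt _ (Nat.succ_pos m)⟩) {s : ℝ} {i : ℕ} {u : ℝ}
    (hi : i < m + 1) (h0 : 0 ≤ u) (h1 : u < 1) (hs : Int.fract s * (m + 1) = i + u) :
    polyLoop v s = PP q i u := by
  have hfl : ⌊(i : ℝ) + u⌋.toNat = i := by
    have : ⌊(i : ℝ) + u⌋ = (i : ℤ) := by
      rw [Int.floor_eq_iff]; push_cast; constructor <;> linarith
    rw [this]; simp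
  have hmod : i % (m + 1) = i := Nat.mod_eq_of_lt hi
  have hv : q (i + 1) = v (⟨i % (m + 1), Nat.mod_lt _ (Nat.succ_pos m)⟩ + 1) := by
    rw [hq]; congr 1
    apply Fin.ext
    rw [Fin.val_add]
    simp [Fin.val_one', Nat.add_mod]
  unfold polyLoop PP
  simp only [hs, hfl]
  rw [hv, hq i]
  simp only [hmod]
  congr 2
  ring

theorem loop_split (m : ℕ) (s : ℝ) : ∃ (i : ℕ) (u : ℝ), i < m + 1 ∧ 0 ≤ u ∧ u < 1 ∧
    Int.fract s * (m + 1) = i + u := by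
  have h0 := Int.fract_nonneg s
  have h1 := Int.fract_lt_one s
  have hm : (0 : ℝ) < m + 1 := by positivity
  have hx : 0 ≤ Int.fract s * (m + 1) := by positivity
  refine ⟨⌊Int.fract s * (m + 1)⌋₊, Int.fract s * (m + 1) - ⌊Int.fract s * (m + 1)⌋₊, ?_, ?_, ?_,
    by ring⟩
  · rw [Nat.floor_lt hx]; push_cast; nlinarith
  · linarith [Nat.floor_le hx]
  · linarith [Nat.lt_floor_add_one (Int.fract s * (m + 1))]

theorem fract_at {m i : ℕ} {u : ℝ} (hi : i < m + 1) (h0 : 0 ≤ u) (h1 : u < 1) :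
    ((i + u) / (m + 1) : ℝ) ∈ Ico (0 : ℝ) 1 ∧
      Int.fract ((i + u) / (m + 1) : ℝ) * (m + 1) = i + u := by
  have hm : (0 : ℝ) < m + 1 := by positivity
  have hi' : (i : ℝ) + 1 ≤ m + 1 := by exact_mod_cast hi
  have h : ((i + u) / (m + 1) : ℝ) ∈ Ico (0 : ℝ) 1 := by
    refine ⟨by positivity, ?_⟩
    rw [div_lt_one hm]; linarith
  refine ⟨h, ?_⟩
  rw [Int.fract_eq_self.2 h]
  field_simp

theorem times_exist {n : ℕ} (hn : 0 < n) {t : Fin n → ℝ} (ht : StrictMono t)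
    (h01 : ∀ i, t i ∈ Ico (0 : ℝ) 1) : ∃ T : ℕ → ℝ, StrictMono T ∧ (∀ i, T (i + n) = T i + 1) ∧
      ∀ i, T i = t ⟨i % n, Nat.mod_lt _ hn⟩ + ((i / n : ℕ) : ℝ) := by
  refine ⟨fun i => t ⟨i % n, Nat.mod_lt _ hn⟩ + ((i / n : ℕ) : ℝ), ?_, ?_, fun _ => rfl⟩
  · apply strictMono_nat_of_lt_succ
    intro i
    have hdm := Nat.mod_add_div i n
    have hb := Nat.mod_lt i hn
    rcases (show i % n + 1 ≤ n from hb).lt_or_eq with h | h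
    · have e : i + 1 = (i % n + 1) + n * (i / n) := by omega
      have e1 : (i + 1) % n = i % n + 1 := by
        rw [e, Nat.add_mul_mod_self_left, Nat.mod_eq_of_lt h]
      have e2 : (i + 1) / n = i / n := by
        rw [e, Nat.add_mul_div_left _ _ hn, Nat.div_eq_of_lt h, zero_add]
      have : t ⟨i % n, Nat.mod_lt _ hn⟩ < t ⟨(i + 1) % n, Nat.mod_lt _ hn⟩ := by
        apply ht
        rw [Fin.mk_lt_mk]; omega
      rw [e2]; linarith
    · have e : i + 1 = 0 + n * (i / n + 1) := by rw [Nat.mul_add]; omega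
      have e2 : (i + 1) / n = i / n + 1 := by
        rw [e, Nat.add_mul_div_left _ _ hn, Nat.zero_div, zero_add]
      have h1 := (h01 ⟨i % n, Nat.mod_lt _ hn⟩).2
      have h2 := (h01 ⟨(i + 1) % n, Nat.mod_lt _ hn⟩).1
      rw [e2]; push_cast; linarith
  · intro i
    simp only [Nat.add_mod_right, Nat.add_div_right _ hn]
    push_cast; ring

theorem inscribed_unknot {K : ℝ → V3} (hK : Continuous K) (hper : Function.Periodic K 1)
    (hH : ¬ (hull K 2).Nonempty) {m : ℕ} {t : Fin (m + 3) → ℝ} (ht : StrictMono t)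
    (h01 : ∀ i, t i ∈ Ico (0 : ℝ) 1)
    (hinj : ∀ s ∈ Ico (0 : ℝ) 1, ∀ s' ∈ Ico (0 : ℝ) 1,
        polyLoop (K ∘ t) s = polyLoop (K ∘ t) s' → s = s') :
    IsUnknot (Set.range (polyLoop (K ∘ t))) := by
  obtain ⟨T, hT, hTn, hTt⟩ := times_exist (Nat.succ_pos (m + 2)) ht h01
  obtain ⟨q, hq⟩ : ∃ q : ℕ → V3, q = fun i => K (T i) := ⟨_, rfl⟩
  have hqv : ∀ i, q i = (K ∘ t) ⟨i % (m + 2 + 1), Nat.mod_lt _ (Nat.succ_pos (m + 2))⟩ := by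
    intro i
    rw [hq]
    simp only [hTt, Function.comp]
    have := hper.nat_mul (i / (m + 2 + 1)) (t ⟨i % (m + 2 + 1), Nat.mod_lt _ (Nat.succ_pos (m + 2))⟩)
    rw [mul_one] at this
    exact this
  have hqn : ∀ i, q (i + (m + 2 + 1)) = q i := fun i => by rw [hqv, hqv]; simp
  have hPn : ∀ i u, PP q (i + (m + 2 + 1)) u = PP q i u := fun i u => by
    unfold PP
    have : i + (m + 2 + 1) + 1 = (i + 1) + (m + 2 + 1) := by omega
    rw [this, hqn, hqn]
  -- injectivity on the first period
  have inj0 : ∀ i j : ℕ, ∀ u u' : ℝ, i < m + 2 + 1 → j < m + 2 + 1 → 0 ≤ u → u < 1 → 0 ≤ u' →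
      u' < 1 → PP q i u = PP q j u' → i = j ∧ u = u' := by
    intro i j u u' hi hj h0 h1 h0' h1' h
    obtain ⟨a1, a2⟩ := fract_at hi h0 h1
    obtain ⟨b1, b2⟩ := fract_at hj h0' h1'
    have hs := hinj _ a1 _ b1 (by
      rw [loop_form hqv hi h0 h1 a2, loop_form hqv hj h0' h1' b2, h])
    rw [hs, b2] at a2
    have hij : i = j := by
      have c1 : (i : ℝ) < j + 1 := by linarith
      have c2 : (j : ℝ) < i + 1 := by linarith
      have c1' : i < j + 1 := by exact_mod_cast c1
      have c2' : j < i + 1 := by exact_mod_cast c2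
      omega
    subst hij
    exact ⟨rfl, by linarith⟩
  have hPm : ∀ i u, i < 2 * (m + 2 + 1) → PP q i u = PP q (i % (m + 2 + 1)) u := by
    intro i u hi
    rcases lt_or_ge i (m + 2 + 1) with h | h
    · rw [Nat.mod_eq_of_lt h]
    · obtain ⟨j, rfl⟩ : ∃ j, i = j + (m + 2 + 1) := ⟨i - (m + 2 + 1), by omega⟩
      rw [hPn, Nat.add_mod_right, Nat.mod_eq_of_lt (by omega)]
  -- choose a farthest vertex
  obtain ⟨r, hrn, hmax⟩ : ∃ r, r < m + 2 + 1 ∧ ∀ j < m + 2 + 1, ‖q j‖ ≤ ‖q r‖ := by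
    obtain ⟨r, h1, h2⟩ := Finset.exists_max_image (Finset.range (m + 2 + 1)) (fun i => ‖q i‖)
      ⟨0, by simp⟩
    exact ⟨r, Finset.mem_range.1 h1, fun j hj => h2 j (Finset.mem_range.2 hj)⟩
  have hPI : PInj q r (m + 2) := by
    intro i j u u' a1 a2 a3 a4 h0 h1 h0' h1' h
    rw [hPm i u (by omega), hPm j u' (by omega)] at h
    obtain ⟨e1, e2⟩ := inj0 _ _ u u' (Nat.mod_lt _ (by omega)) (Nat.mod_lt _ (by omega))
      h0 h1 h0' h1' h
    refine ⟨?_, e2⟩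
    have d1 := Nat.mod_add_div i (m + 2 + 1)
    have d2 := Nat.mod_add_div j (m + 2 + 1)
    have l1 : i / (m + 2 + 1) < 2 := Nat.div_lt_of_lt_mul (by omega)
    have l2 : j / (m + 2 + 1) < 2 := Nat.div_lt_of_lt_mul (by omega)
    rw [e1] at d1
    interval_cases i / (m + 2 + 1) <;> interval_cases j / (m + 2 + 1) <;> omega
  have hlt : ∀ i, r < i → i < r + (m + 3) → inner ℝ (q r) (q i) < inner ℝ (q r) (q r) := by
    intro i h1 h2
    have hle : ‖q i‖ ≤ ‖q r‖ := by
      have := hPm i 0 (by omega)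
      rw [PP_zero, PP_zero] at this
      rw [this]; exact hmax _ (Nat.mod_lt _ (by omega))
    have hne : q r - q i ≠ 0 := by
      intro h
      have := (hPI r i 0 0 le_rfl (by omega) h1.le (by omega) le_rfl one_pos le_rfl one_pos
        (by rw [PP_zero, PP_zero]; exact sub_eq_zero.1 h)).1
      omega
    have hpos := norm_pos_iff.2 hne
    have h3 := norm_sub_sq_real (q r) (q i)
    rw [real_inner_self_eq_norm_sq]
    nlinarith [norm_nonneg (q i), norm_nonneg (q r)]
  obtain ⟨c, hc1, hc2⟩ : ∃ c, c < inner ℝ (q r) (q r) ∧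
      ∀ i ∈ Finset.Ioo r (r + (m + 3)), inner ℝ (q r) (q i) < c := by
    obtain ⟨i0, hi0, hm0⟩ := Finset.exists_max_image (Finset.Ioo r (r + (m + 3)))
      (fun i => inner ℝ (q r) (q i)) ⟨r + 1, by simp⟩
    rw [Finset.mem_Ioo] at hi0
    obtain ⟨c, h1, h2⟩ := exists_between (hlt i0 hi0.1 hi0.2)
    exact ⟨c, h2, fun i hi => (hm0 i hi).trans_lt h1⟩
  have hrange : Set.range (polyLoop (K ∘ t)) = poly (sl q r (m + 1 + 3)) := by
    apply Subset.antisymm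
    · rintro _ ⟨s, rfl⟩
      obtain ⟨i, u, hi, h0, h1, hs⟩ := loop_split (m + 2) s
      rw [loop_form hqv hi h0 h1 hs]
      rcases lt_or_ge i r with h | h
      · rw [← hPn]
        exact PP_mem_sl q h0 h1.le (m + 3) r _ (by omega) (by omega)
      · exact PP_mem_sl q h0 h1.le (m + 3) r _ h (by omega)
    · intro x hx
      obtain ⟨i, u, h1, h2, h3, h4, h5, rfl⟩ := mem_sl (m + 3) r hx
      rw [hPm i u (by omega)]
      have hi := Nat.mod_lt i (Nat.succ_pos (m + 2))
      exact ⟨_, loop_form hqv hi h3 h4 (fract_at hi h3 h4).2⟩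
  rw [hrange]
  refine seq_unknot (f := innerSL ℝ (q r)) (c := c) (hqn r) hPI ?_ ?_ ?_
  · simpa using hc1
  · intro i a1 a2
    simpa using hc2 i (Finset.mem_Ioo.2 ⟨a1, a2⟩)
  · rw [hq]
    exact noH2_seq hK hper hH hT hTn r

/-- **Main Theorem.** If `K` is a closed curve in `ℝ³` of finite
total curvature which has a knotted inscribed polygon, then its second hull is
nonempty: there is a point `p` such that every plane through `p` cuts `K` at
least four times. -/
theorem second_hull_nonempty
    (K : ℝ → EuclideanSpace ℝ (Fin 3))
    (hK : Continuous K) (hper : Function.Periodic K 1)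
    (htc : totalCurvature K ≠ ⊤)
    (hknotted : ∃ (m : ℕ) (t : Fin (m + 3) → ℝ), StrictMono t ∧
      (∀ i, t i ∈ Ico (0 : ℝ) 1) ∧
      (∀ s ∈ Ico (0 : ℝ) 1, ∀ s' ∈ Ico (0 : ℝ) 1,
        polyLoop (K ∘ t) s = polyLoop (K ∘ t) s' → s = s') ∧
      ¬ IsUnknot (Set.range (polyLoop (K ∘ t))) ) :
    (hull K 2).Nonempty := by
  by_contra hH
  obtain ⟨m, t, ht, h01, hinj, hkn⟩ := hknotted
  exact hkn (inscribed_unknot hK hper hH ht h01 hinj)
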